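/- arXiv:2510.18916 — 2 statements merged into one kernel-verified Lean document; each statement's English description precedes it below -/
import Mathlib

section
/- Let g ≥ 2 be an integer. If integers k ≥ 1, digits 1 ≤ d₁, d₂, d₃, d₄ ≤ g − 1 and exponents 1 ≤ ℓ ≤ m ≤ n ≤ t with t ≥ 2 satisfy N_k = d₁(gˡ−1)/(g−1) · d₂(gᵐ−1)/(g−1) · d₃(gⁿ−1)/(g−1) · d₄(gᵗ−1)/(g−1), then t < 1.1·10⁵⁷ · (log t)⁴ · (log g)⁸. -/
/-- The Narayana sequence: N₀ = 0, N₁ = N₂ = 1, Nₙ = Nₙ₋₁ + Nₙ₋₃. -/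
def narayana : ℕ → ℕ
  | 0 => 0
  | 1 => 1
  | 2 => 1
  | n + 3 => narayana (n + 2) + narayana n


open Polynomial in
theorem fpoly_irr : Irreducible (X ^ 3 - X ^ 2 - 1 : ℚ[X]) := by
  have hdeg : (X ^ 3 - X ^ 2 - 1 : ℚ[X]).natDegree = 3 := by compute_degree!
  refine Polynomial.irreducible_of_degree_le_three_of_not_isRoot (by rw [hdeg]; decide) ?_
  intro x hx
  have hx' : x ^ 3 - x ^ 2 - 1 = 0 := by simpa [IsRoot] using hx
  have hIntegral : IsIntegral ℤ x := by
    refine ⟨X ^ 3 - X ^ 2 - 1, by monicity!, ?_⟩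
    simpa using hx'
  obtain ⟨z, hz⟩ := IsIntegrallyClosed.isIntegral_iff.1 hIntegral
  have hz' : z ^ 3 - z ^ 2 - 1 = 0 := by
    rw [← hz] at hx'
    simp only [eq_intCast] at hx'
    exact_mod_cast hx'
  have h1 : z ^ 2 * (z - 1) = 1 := by linarith
  have h2 : z ^ 2 ∣ 1 := ⟨_, h1.symm⟩
  have h3 : z ∣ 1 := (dvd_pow_self z two_ne_zero).trans h2
  rcases Int.isUnit_iff.1 (isUnit_of_dvd_one h3) with h | h <;> subst h <;> norm_num at hz'

open Polynomial in
theorem root_transfer {F E : Type*} [Field F] [CharZero F] [Field E] [CharZero E] (z : F) (w : E)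
    (hz : z ^ 3 = z ^ 2 + 1) (hw : w ^ 3 = w ^ 2 + 1) (P : ℤ[X]) (hP : aeval z P ≠ 0) :
    aeval w P ≠ 0 := by
  intro hw0
  have hnd : ¬ (X ^ 3 - X ^ 2 - 1 : ℚ[X]) ∣ P.map (Int.castRingHom ℚ) := by
    rintro ⟨c, hc⟩
    apply hP
    have : aeval z P = aeval z (P.map (Int.castRingHom ℚ)) := by
      rw [aeval_def, aeval_def, eval₂_map]
      congr 1
      exact RingHom.ext_int _ _
    rw [this, hc]
    simp [hz]
  have hcop := (fpoly_irr.coprime_iff_not_dvd).2 hnd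
  obtain ⟨a, b, hab⟩ := hcop
  have h1 := congrArg (aeval w) hab
  have h2 : aeval w P = aeval w (P.map (Int.castRingHom ℚ)) := by
    rw [aeval_def, aeval_def, eval₂_map]
    congr 1
    exact RingHom.ext_int _ _
  rw [map_add, map_mul, map_mul, ← h2, hw0] at h1
  simp [hw] at h1

open Polynomial in
theorem mod_form {E : Type*} [Field E] (P : ℤ[X]) : ∃ c0 c1 c2 : ℤ, ∀ (F : Type) [Field F] (z : F),
    z ^ 3 = z ^ 2 + 1 → aeval z P = c0 + c1 * z + c2 * z ^ 2 := by
  set f : ℤ[X] := X ^ 3 - X ^ 2 - 1 with hf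
  have hm : f.Monic := by rw [hf]; monicity!
  have hd : f.natDegree = 3 := by rw [hf]; compute_degree!
  set r := P %ₘ f with hr
  have hrd : r.natDegree < 3 := by
    rw [← hd]; apply natDegree_modByMonic_lt _ hm
    intro h; rw [h] at hd; simp at hd
  refine ⟨r.coeff 0, r.coeff 1, r.coeff 2, ?_⟩
  intro F _ z hz
  rw [← modByMonic_add_div P f, map_add, map_mul]
  have h1 : aeval z f = 0 := by simp [hf, hz]
  rw [h1, zero_mul, add_zero, ← hr, aeval_eq_sum_range' hrd]
  simp [Finset.sum_range_succ]

open Polynomial ComplexConjugate in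
theorem norm_bound (α : ℝ) (hα : α ^ 3 = α ^ 2 + 1) (β : ℂ) (hβ : β ^ 3 = β ^ 2 + 1)
    (hs : β + conj β = 1 - α) (hp : β * conj β = α ^ 2 - α)
    {F : Type*} [Field F] [CharZero F] (z : F) (hz : z ^ 3 = z ^ 2 + 1)
    (P : ℤ[X]) (hP : aeval z P ≠ 0) : 1 ≤ |aeval α P| * ‖aeval β P‖ ^ 2 := by
  have hPα := root_transfer z α hz hα P hP
  have hPβ := root_transfer z β hz hβ P hP
  obtain ⟨c0, c1, c2, hc⟩ := mod_form (E := ℚ) P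
  have eα := hc ℝ α hα
  have eβ := hc ℂ β hβ
  set M : ℤ := c0^3+c0^2*c1+c0^2*c2 -3*c0*c1*c2 -2*c0*c2^2 + c1^3 + c1^2*c2 + c2^3 with hM
  have hn : ((aeval α P * ‖aeval β P‖ ^ 2 : ℝ) : ℂ) = ((M : ℝ) : ℂ) := by
    rw [Complex.ofReal_mul, Complex.ofReal_pow, ← Complex.mul_conj', eα, eβ, hM]
    have hα' : (α : ℂ) ^ 3 = α ^ 2 + 1 := by exact_mod_cast hα
    have hconj : (c0 + c1 * β + c2 * β ^ 2 : ℂ) * conj (c0 + c1 * β + c2 * β ^ 2 : ℂ)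
      = c0^2+c0*c1*(1-α)+c0*c2*((1-α)^2-2*(α^2-α))+c1^2*(α^2-α)+c1*c2*(1-α)*(α^2-α)+c2^2*(α^2-α)^2 := by
      simp only [map_add, map_mul, map_pow, map_intCast]
      rw [← hs, ← hp]
      ring
    rw [hconj]
    push_cast
    linear_combination ((α^3-α^2+1)*c2^3 -3*c0*c1*c2 -2*c0*c2^2 + c1^3+c1^2*c2) * hα'
  have hn' : aeval α P * ‖aeval β P‖ ^ 2 = M := by exact_mod_cast hn
  have hne : aeval α P * ‖aeval β P‖ ^ 2 ≠ 0 := mul_ne_zero hPα (pow_ne_zero _ (norm_ne_zero_iff.2 hPβ))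
  have h1 : |aeval α P| * ‖aeval β P‖ ^ 2 = |(M : ℝ)| := by
    rw [← hn', abs_mul, abs_of_nonneg (by positivity : 0 ≤ ‖aeval β P‖ ^ 2)]
  rw [h1]
  have hM0 : M ≠ 0 := by
    intro h0
    rw [hn', h0] at hne
    simp at hne
  exact_mod_cast Int.one_le_abs hM0

open ComplexConjugate in
theorem exists_roots : ∃ (α : ℝ) (β : ℂ), 1.46 < α ∧ α < 1.4656 ∧ α ^ 3 = α ^ 2 + 1 ∧
    β ^ 3 = β ^ 2 + 1 ∧ β + conj β = 1 - α ∧ β * conj β = α ^ 2 - α := by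
  have hc : ContinuousOn (fun x : ℝ => x ^ 3 - x ^ 2 - 1) (Set.Icc 1.46 1.4656) := by fun_prop
  have h0 : (0 : ℝ) ∈ Set.Ioo ((1.46 : ℝ) ^ 3 - 1.46 ^ 2 - 1) ((1.4656 : ℝ) ^ 3 - 1.4656 ^ 2 - 1) := by
    constructor <;> norm_num
  obtain ⟨α, ⟨h1, h2⟩, h3⟩ := intermediate_value_Ioo (by norm_num) hc h0
  have h3' : α ^ 3 = α ^ 2 + 1 := by simp only at h3; linarith
  set d := α ^ 2 - α - (1 - α) ^ 2 / 4 with hd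
  have hd0 : 0 ≤ d := by rw [hd]; nlinarith
  set β : ℂ := ⟨(1 - α) / 2, Real.sqrt d⟩ with hβ
  have hs : β + conj β = 1 - α := by
    apply Complex.ext
    · simp [hβ]
    · simp [hβ]
  have hp : β * conj β = α ^ 2 - α := by
    rw [Complex.mul_conj, Complex.normSq_apply]
    have : β.re * β.re + β.im * β.im = α ^ 2 - α := by
      simp only [hβ]
      rw [Real.mul_self_sqrt hd0, hd]; ring
    rw [this]; push_cast; ring
  refine ⟨α, β, h1, h2, h3', ?_, hs, hp⟩
  have hq : β ^ 2 = (1 - α) * β - (α ^ 2 - α) := by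
    rw [← hs, ← hp]; ring
  have hα' : (α : ℂ) ^ 3 = α ^ 2 + 1 := by exact_mod_cast h3'
  linear_combination (β - α) * hq + hα'



theorem newton_comb (L : ℕ) (N : ℕ → ℝ) (hN : ∀ l, 0 ≤ N l) (τ W : ℝ) (hτ : 0 < τ) (hW : 1 ≤ W)
    (hτW : τ * W < 1) (l0 : ℕ) (hl0 : l0 < L) (hl0N : 0 < N l0)
    (hwin : ∀ j < L, ∀ l < L, 0 < N l → ∃ l' < L, l' ≠ l ∧
      N l * (τ ^ (2 * j)) ^ l ≤ N l' * (τ ^ (2 * j)) ^ l' * W ^ ((l - l') + (l' - l))) : False := by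
  have hτ1 : τ < 1 := by nlinarith
  have key : ∀ j, j < L → ∃ m < L, m + j ≤ L - 1 ∧ 0 < N m ∧
      ∀ l < L, N l * (τ ^ (2 * j) / τ) ^ l ≤ N m * (τ ^ (2 * j) / τ) ^ m := by
    have argmax : ∀ y : ℝ, 0 < y → ∃ m < L, 0 < N m ∧ ∀ l < L, N l * y ^ l ≤ N m * y ^ m := by
      intro y hy
      obtain ⟨m, hm, hmax⟩ := Finset.exists_max_image (Finset.range L) (fun l => N l * y ^ l)
        ⟨l0, Finset.mem_range.2 hl0⟩
      refine ⟨m, Finset.mem_range.1 hm, ?_, fun l hl => hmax l (Finset.mem_range.2 hl)⟩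
      have h1 := hmax l0 (Finset.mem_range.2 hl0)
      have h2 : 0 < N l0 * y ^ l0 := by positivity
      have h3 : 0 < N m * y ^ m := lt_of_lt_of_le h2 h1
      exact pos_of_mul_pos_left h3 (by positivity)
    intro j
    induction j with
    | zero =>
      intro hj
      obtain ⟨m, hm, h1, h2⟩ := argmax (τ ^ (2 * 0) / τ) (by positivity)
      exact ⟨m, hm, by omega, h1, h2⟩
    | succ j ih =>
      intro hj
      obtain ⟨m, hm, hmj, hNm, hmax⟩ := ih (by omega)
      obtain ⟨m', hm', hNm', hmax'⟩ := argmax (τ ^ (2 * (j + 1)) / τ) (by positivity)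
      refine ⟨m', hm', ?_, hNm', hmax'⟩
      obtain ⟨l', hl', hne, hcomp⟩ := hwin j (by omega) m hm hNm
      set y := τ ^ (2 * j) / τ with hy
      have hy0 : 0 < y := by positivity
      have hz : τ ^ (2 * j) = y * τ := by rw [hy]; field_simp
      have hy' : τ ^ (2 * (j + 1)) / τ = y * τ * τ := by
        rw [hy]; field_simp; ring
      rw [hz] at hcomp
      rw [hy'] at hmax'
      have hpow1 : ∀ n, n ≠ 0 → (τ * W) ^ n < 1 := fun n hn =>
        pow_lt_one₀ (by positivity) hτW hn
      have hl'm : l' < m := by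
        by_contra hcon
        obtain ⟨n, rfl⟩ : ∃ n, l' = m + n := ⟨l' - m, by omega⟩
        have hn : n ≠ 0 := by rintro rfl; simp at hne
        have e1 : (m - (m + n)) + (m + n - m) = n := by omega
        rw [e1] at hcomp
        have h1 := hmax (m + n) hl'
        have h2 : N (m + n) * (y * τ) ^ (m + n) * W ^ n
            = N (m + n) * y ^ (m + n) * τ ^ m * (τ * W) ^ n := by
          rw [mul_pow, mul_pow, pow_add τ]; ring
        have h3 : N m * (y * τ) ^ m = N m * y ^ m * τ ^ m := by rw [mul_pow]; ring
        rw [h2, h3] at hcomp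
        have h4 : N (m + n) * y ^ (m + n) * τ ^ m ≤ N m * y ^ m * τ ^ m := by gcongr
        have h5 : 0 < N m * y ^ m * τ ^ m := by positivity
        have h6 := hpow1 n hn
        have h7 : 0 ≤ (τ * W) ^ n := by positivity
        nlinarith
      have hm'm : m' < m := by
        by_contra hcon
        obtain ⟨q, rfl⟩ : ∃ n, m' = m + n := ⟨m' - m, by omega⟩
        obtain ⟨n, rfl⟩ : ∃ n, m = l' + n := ⟨m - l', by omega⟩
        have hn : n ≠ 0 := by rintro rfl; simp at hne
        have e1 : (l' + n - l') + (l' - (l' + n)) = n := by omega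
        rw [e1] at hcomp
        have h1 := hmax _ hm'
        have h2 := hmax' l' hl'
        have a1 : N (l' + n + q) * (y * τ * τ) ^ (l' + n + q)
            = N (l' + n + q) * y ^ (l' + n + q) * (τ * τ) ^ (l' + n) * (τ * τ) ^ q := by
          rw [mul_assoc y, mul_pow, pow_add (τ * τ)]; ring
        have a2 : N (l' + n + q) * y ^ (l' + n + q) * (τ * τ) ^ (l' + n) * (τ * τ) ^ q
            ≤ N (l' + n) * y ^ (l' + n) * (τ * τ) ^ (l' + n) * 1 := by
          gcongr
          exact pow_le_one₀ (by positivity) (by nlinarith)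
        have a3 : N (l' + n) * y ^ (l' + n) * (τ * τ) ^ (l' + n) * 1
            = N (l' + n) * (y * τ) ^ (l' + n) * τ ^ (l' + n) := by
          rw [mul_pow, mul_pow]; ring
        have a4 : N (l' + n) * (y * τ) ^ (l' + n) * τ ^ (l' + n)
            ≤ N l' * (y * τ) ^ l' * W ^ n * τ ^ (l' + n) := by gcongr
        have a5 : N l' * (y * τ) ^ l' * W ^ n * τ ^ (l' + n)
            = N l' * (y * τ * τ) ^ l' * (τ * W) ^ n := by
          rw [mul_pow _ τ, mul_pow _ W, pow_add τ]; ring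
        have h6 := hpow1 n hn
        have h7 : 0 ≤ (τ * W) ^ n := by positivity
        have h8 : 0 < N (l' + n) * (y * τ) ^ (l' + n) * τ ^ (l' + n) := by positivity
        have h9 : 0 < N l' * (y * τ * τ) ^ l' * (τ * W) ^ n := by linarith
        have h10 : 0 < N l' * (y * τ * τ) ^ l' := pos_of_mul_pos_left h9 h7
        nlinarith
      omega
  obtain ⟨m, hm, hmj, hNm, hmax⟩ := key (L - 1) (by omega)
  have hm0 : m = 0 := by omega
  subst hm0
  obtain ⟨l', hl', hne, hcomp⟩ := hwin (L - 1) (by omega) 0 hm hNm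
  have h1 := hmax l' hl'
  have hz : τ ^ (2 * (L - 1)) = τ ^ (2 * (L - 1)) / τ * τ := by field_simp
  set y := τ ^ (2 * (L - 1)) / τ with hy
  rw [hz] at hcomp
  simp only [pow_zero, mul_one, zero_tsub, tsub_zero, zero_add] at h1 hcomp
  have h2 : N l' * (y * τ) ^ l' * W ^ l' = N l' * y ^ l' * (τ * W) ^ l' := by
    rw [mul_pow, mul_pow]; ring
  rw [h2] at hcomp
  have h6 : (τ * W) ^ l' < 1 := pow_lt_one₀ (by positivity) hτW hne
  have h7 : 0 ≤ (τ * W) ^ l' := by positivity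
  nlinarith


section ultra
variable {F : Type*} [NormedField F] [IsUltrametricDist F]

theorem um_sum_le {ι : Type*} (s : Finset ι) (f : ι → F) (B : ℝ) (hB : 0 ≤ B)
    (h : ∀ i ∈ s, ‖f i‖ ≤ B) : ‖∑ i ∈ s, f i‖ ≤ B :=
  IsUltrametricDist.norm_sum_le_of_forall_le_of_nonneg hB h

theorem um_int_le (z : ℤ) : ‖(z : F)‖ ≤ 1 := IsUltrametricDist.norm_intCast_le_one F z

theorem poly_bdd (q : Polynomial F) (K : ℕ) (hq : q.degree < K) (a : ℤ) (B : ℝ) (hB : 0 ≤ B)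
    (h : ∀ i < K, ‖q.eval ((a + (i : ℤ) : ℤ) : F)‖ ≤ B) (y : ℤ) : ‖q.eval (y : F)‖ ≤ B := by
  rcases Nat.eq_zero_or_pos K with hK0 | hKpos
  · subst hK0
    have : q = 0 := by
      rw [← Polynomial.degree_eq_bot]
      exact Nat.WithBot.lt_zero_iff.1 (by simpa using hq)
    simp [this, hB]
  have hd : ∀ z : ℤ, ∑ k ∈ Finset.range (K + 1),
      ((-1 : ℤ) ^ (K - k) * K.choose k) • q.eval ((z + (k : ℤ) : ℤ) : F) = 0 := by
    intro z
    have hqn : q.natDegree < K := by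
      by_cases h0 : q = 0
      · simpa [h0] using hKpos
      · exact (Polynomial.natDegree_lt_iff_degree_lt h0).2 hq
    have h1 := Polynomial.fwdDiff_iter_eq_zero_of_degree_lt (P := q) hqn
    have h2 := fwdDiff_iter_eq_sum_shift (1 : F) q.eval K (z : F)
    rw [h1] at h2
    simp only [Pi.zero_apply] at h2
    rw [h2]
    refine Finset.sum_congr rfl fun k _ => ?_
    simp
  have hup : ∀ z : ℤ, (∀ i < K, ‖q.eval ((z + (i : ℤ) : ℤ) : F)‖ ≤ B) →
      (∀ i < K, ‖q.eval ((z + 1 + (i : ℤ) : ℤ) : F)‖ ≤ B) := by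
    intro z hz i hi
    by_cases hi' : i + 1 < K
    · have := hz (i + 1) hi'
      convert this using 3
      push_cast; ring
    · have hiK : i + 1 = K := by omega
      have h1 := hd z
      rw [Finset.sum_range_succ] at h1
      have h2 : q.eval ((z + 1 + (i : ℤ) : ℤ) : F) =
        - ∑ k ∈ Finset.range K, ((-1 : ℤ) ^ (K - k) * K.choose k) • q.eval ((z + (k : ℤ) : ℤ) : F) := by
        rw [eq_neg_iff_add_eq_zero, add_comm, ← h1]
        congr 1
        simp only [tsub_self, pow_zero, Nat.choose_self, Nat.cast_one, mul_one, one_smul]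
        congr 2
        rw [← hiK]; push_cast; ring
      rw [h2, norm_neg]
      refine um_sum_le _ _ _ hB fun k hk => ?_
      rw [zsmul_eq_mul, norm_mul]
      have h3 := um_int_le (F := F) ((-1 : ℤ) ^ (K - k) * K.choose k)
      have h4 := hz k (Finset.mem_range.1 hk)
      nlinarith [norm_nonneg (q.eval ((z + (k : ℤ) : ℤ) : F))]
  have hdown : ∀ z : ℤ, (∀ i < K, ‖q.eval ((z + 1 + (i : ℤ) : ℤ) : F)‖ ≤ B) →
      (∀ i < K, ‖q.eval ((z + (i : ℤ) : ℤ) : F)‖ ≤ B) := by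
    intro z hz i hi
    rcases Nat.eq_zero_or_pos i with h0 | h0
    · subst h0
      have h1 := hd z
      rw [Finset.sum_range_succ'] at h1
      have h2 : ((-1 : ℤ) ^ K) • q.eval ((z + ((0 : ℕ) : ℤ) : ℤ) : F) =
        - ∑ k ∈ Finset.range K, ((-1 : ℤ) ^ (K - (k + 1)) * K.choose (k + 1)) •
          q.eval ((z + ((k + 1 : ℕ) : ℤ) : ℤ) : F) := by
        rw [eq_neg_iff_add_eq_zero, add_comm, ← h1]
        simp
      have h3 : ‖((-1 : ℤ) ^ K) • q.eval ((z + ((0 : ℕ) : ℤ) : ℤ) : F)‖ =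
          ‖q.eval ((z + ((0 : ℕ) : ℤ) : ℤ) : F)‖ := by
        rw [zsmul_eq_mul, norm_mul]
        simp
      rw [← h3, h2, norm_neg]
      refine um_sum_le _ _ _ hB fun k hk => ?_
      rw [zsmul_eq_mul, norm_mul]
      have h3 := um_int_le (F := F) ((-1 : ℤ) ^ (K - (k + 1)) * K.choose (k + 1))
      have h4 := hz k (Finset.mem_range.1 hk)
      have h5 : z + ((k + 1 : ℕ) : ℤ) = z + 1 + (k : ℤ) := by push_cast; ring
      rw [h5]
      nlinarith [norm_nonneg (q.eval ((z + 1 + (k : ℤ) : ℤ) : F))]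
    · have := hz (i - 1) (by omega)
      convert this using 3
      push_cast [Nat.cast_sub h0]; ring
  have hall : ∀ z : ℤ, (∀ i < K, ‖q.eval ((z + (i : ℤ) : ℤ) : F)‖ ≤ B) := by
    intro z
    induction z using Int.inductionOn' (b := a) with
    | zero => exact h
    | succ k _ ih => exact hup k ih
    | pred k _ ih =>
      apply hdown (k - 1)
      simpa using ih
  simpa using hall y 0 hKpos

end ultra


section ultra
variable {F : Type*} [NormedField F] [IsUltrametricDist F]

theorem prod_eval (s0 : ℤ) (S' m : ℕ) :
    (∏ i ∈ Finset.range S', (Polynomial.X - Polynomial.C ((s0 + (i : ℤ) : ℤ) : F))).eval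
      ((s0 + (m : ℤ) : ℤ) : F) = (S'.factorial : F) * (m.choose S' : F) := by
  rw [Polynomial.eval_prod]
  have h1 : (S'.factorial : F) * (m.choose S' : F) = ((m.descFactorial S' : ℕ) : F) := by
    rw [Nat.descFactorial_eq_factorial_mul_choose]; push_cast; ring
  rw [h1]
  by_cases hm : m < S'
  · rw [Nat.descFactorial_eq_zero_iff_lt.2 hm, Nat.cast_zero]
    exact Finset.prod_eq_zero (Finset.mem_range.2 hm) (by simp)
  · rw [Nat.descFactorial_eq_prod_range, Nat.cast_prod]
    refine Finset.prod_congr rfl fun i hi => ?_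
    have : i ≤ m := by have := Finset.mem_range.1 hi; omega
    rw [Nat.cast_sub this]
    simp

theorem prod_bdd (s0 : ℤ) (S' : ℕ) (y : ℤ) :
    ‖(∏ i ∈ Finset.range S', (Polynomial.X - Polynomial.C ((s0 + (i : ℤ) : ℤ) : F))).eval
      (y : F)‖ ≤ ‖(S'.factorial : F)‖ := by
  refine poly_bdd _ (S' + 1) ?_ s0 _ (norm_nonneg _) ?_ y
  · have : (∏ i ∈ Finset.range S', (Polynomial.X - Polynomial.C ((s0 + (i : ℤ) : ℤ) : F))).degree
        = (S' : WithBot ℕ) := by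
      rw [Polynomial.degree_prod]
      simp only [Polynomial.degree_X_sub_C]
      simp
    rw [this]
    exact_mod_cast Nat.lt_succ_self S'
  · intro m hm
    rw [prod_eval]
    rw [norm_mul]
    have := um_int_le (F := F) (m.choose S' : ℤ)
    rw [Int.cast_natCast] at this
    nlinarith [norm_nonneg (S'.factorial : F)]

theorem block_bdd [CharZero F] (hch : ∀ m k : ℕ, k ≤ m → 1 ≤ m → 1 ≤ (m : ℝ) * ‖(m.choose k : F)‖)
    (S' b2 n : ℕ) (hS' : 1 ≤ S') (hb2 : S' ≤ b2) (hn1 : 1 ≤ n) (T : ℕ) : b2 * T + S' ≤ n →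
    ∀ (q : Polynomial F) (s0 : ℤ) (B : ℝ), 0 ≤ B → q.degree < ((S' * T : ℕ) : WithBot ℕ) →
    (∀ s < S', ∀ t < T, ‖q.eval ((s0 + (s : ℤ) + (b2 : ℤ) * (t : ℤ) : ℤ) : F)‖ ≤ B) →
    ∀ y : ℤ, ‖q.eval (y : F)‖ ≤ B * (n : ℝ) ^ T := by
  induction T with
  | zero =>
    intro _ q s0 B hB hq _ y
    have : q = 0 := by
      rw [← Polynomial.degree_eq_bot]
      exact Nat.WithBot.lt_zero_iff.1 (by simpa using hq)
    simp [this, hB]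
  | succ T ih =>
    intro hn q s0 B hB hq h y
    set φ := ∏ i ∈ Finset.range S', (Polynomial.X - Polynomial.C ((s0 + (i : ℤ) : ℤ) : F)) with hφ
    have hmon : φ.Monic := Polynomial.monic_prod_of_monic _ _ fun i _ => Polynomial.monic_X_sub_C _
    have hdeg : φ.degree = S' := by
      rw [hφ, Polynomial.degree_prod]
      simp only [Polynomial.degree_X_sub_C]
      simp
    set q1 := q /ₘ φ with hq1
    set r := q %ₘ φ with hr
    have hqr : ∀ z : F, q.eval z = r.eval z + φ.eval z * q1.eval z := by
      intro z
      conv_lhs => rw [← Polynomial.modByMonic_add_div q φ]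
      simp [hr, hq1]
    have hrdeg : r.degree < S' := by rw [← hdeg]; exact Polynomial.degree_modByMonic_lt _ hmon
    have hrb : ∀ z : ℤ, ‖r.eval (z : F)‖ ≤ B := by
      apply poly_bdd r S' hrdeg s0 B hB
      intro i hi
      have h1 := h i hi 0 (by omega)
      have h2 := hqr ((s0 + (i : ℤ) : ℤ) : F)
      rw [hφ, prod_eval, Nat.choose_eq_zero_of_lt hi] at h2
      simp only [Nat.cast_zero, mul_zero, zero_mul, add_zero] at h2 h1
      rwa [← h2]
    have hfac : 0 < ‖(S'.factorial : F)‖ := by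
      rw [norm_pos_iff]; exact_mod_cast Nat.factorial_ne_zero S'
    have hn1' : (1 : ℝ) ≤ n := by exact_mod_cast hn1
    have hq1deg : q1.degree < ((S' * T : ℕ) : WithBot ℕ) := by
      by_cases h0 : q1 = 0
      · rw [h0, Polynomial.degree_zero]; exact WithBot.bot_lt_coe _
      · have hle : φ.degree ≤ q.degree := by
          by_contra hcon
          exact h0 ((Polynomial.divByMonic_eq_zero_iff hmon).2 (not_le.1 hcon))
        have h1 := Polynomial.degree_add_divByMonic hmon hle
        rw [← hq1, hdeg] at h1
        rw [← h1, Polynomial.degree_eq_natDegree h0, ← Nat.cast_add, Nat.cast_lt] at hq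
        rw [Polynomial.degree_eq_natDegree h0, Nat.cast_lt]
        have : S' * (T + 1) = S' * T + S' := by ring
        omega
    have hq1b := ih (by nlinarith) q1 (s0 + b2) (B * n / ‖(S'.factorial : F)‖) (by positivity) hq1deg (by
      intro s hs t ht
      have h1 := h s hs (t + 1) (by omega)
      set m := s + b2 * (t + 1) with hm
      have e1 : s0 + (s : ℤ) + (b2 : ℤ) * ((t + 1 : ℕ) : ℤ) = s0 + (m : ℤ) := by
        rw [hm]; push_cast; ring
      have e2 : s0 + (b2 : ℤ) + (s : ℤ) + (b2 : ℤ) * (t : ℤ) = s0 + (m : ℤ) := by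
        rw [hm]; push_cast; ring
      rw [e1] at h1
      rw [e2]
      have hmS : S' ≤ m := by rw [hm]; nlinarith
      have hmn : m ≤ n := by
        have : b2 * (t + 1) ≤ b2 * (T + 1) := Nat.mul_le_mul_left _ (by omega)
        omega
      have h2 := hqr ((s0 + (m : ℤ) : ℤ) : F)
      rw [hφ, prod_eval] at h2
      have h3 : ‖(S'.factorial : F) * (m.choose S' : F) * q1.eval ((s0 + (m : ℤ) : ℤ) : F)‖ ≤ B := by
        have : (S'.factorial : F) * (m.choose S' : F) * q1.eval ((s0 + (m : ℤ) : ℤ) : F) =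
          q.eval ((s0 + (m : ℤ) : ℤ) : F) - r.eval ((s0 + (m : ℤ) : ℤ) : F) := by rw [h2]; ring
        rw [this]
        rw [sub_eq_add_neg]
        refine (IsUltrametricDist.norm_add_le_max _ _).trans (max_le h1 ?_)
        rw [norm_neg]; exact hrb _
      rw [norm_mul, norm_mul] at h3
      have h4 := hch m S' hmS (by omega)
      rw [le_div_iff₀ hfac]
      have hmn' : (m : ℝ) ≤ n := by exact_mod_cast hmn
      set X := ‖q1.eval ((s0 + (m : ℤ) : ℤ) : F)‖
      have hX : 0 ≤ X := norm_nonneg _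
      calc X * ‖(S'.factorial : F)‖ = X * ‖(S'.factorial : F)‖ * 1 := by ring
        _ ≤ X * ‖(S'.factorial : F)‖ * (m * ‖(m.choose S' : F)‖) := by gcongr
        _ = (‖(S'.factorial : F)‖ * ‖(m.choose S' : F)‖ * X) * m := by ring
        _ ≤ B * n := by gcongr)
    rw [hqr]
    refine (IsUltrametricDist.norm_add_le_max _ _).trans (max_le ?_ ?_)
    · refine (hrb y).trans ?_
      have : (1 : ℝ) ≤ (n : ℝ) ^ (T + 1) := one_le_pow₀ hn1'
      nlinarith
    · rw [norm_mul]
      calc ‖φ.eval (y : F)‖ * ‖q1.eval (y : F)‖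
          ≤ ‖(S'.factorial : F)‖ * (B * n / ‖(S'.factorial : F)‖ * n ^ T) := by
            gcongr
            · exact prod_bdd s0 S' y
            · exact hq1b y
        _ = B * n ^ (T + 1) := by field_simp; ring

/-- a function on ℤ² which is a polynomial of bounded degree in each variable -/
structure BiPoly (K1 K2 : ℕ) (f : ℤ → ℤ → F) : Prop where
  hx : ∀ y, ∃ q : Polynomial F, q.degree < K1 ∧ ∀ x : ℤ, f x y = q.eval (x : F)
  hy : ∀ x, ∃ q : Polynomial F, q.degree < K2 ∧ ∀ y : ℤ, f x y = q.eval (y : F)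

theorem bipoly_max (K1 K2 : ℕ) (hK1 : 0 < K1) (hK2 : 0 < K2) (f : ℤ → ℤ → F) (hf : BiPoly K1 K2 f) :
    ∃ x0 y0, ∀ x y, ‖f x y‖ ≤ ‖f x0 y0‖ := by
  obtain ⟨v, hv, hmax⟩ := Finset.exists_max_image (Finset.range K1 ×ˢ Finset.range K2)
    (fun v => ‖f v.1 v.2‖) ⟨(0, 0), by simp [hK1, hK2]⟩
  refine ⟨v.1, v.2, fun x y => ?_⟩
  obtain ⟨q, hq, hqe⟩ := hf.hy x
  rw [hqe]
  refine poly_bdd q K2 hq 0 _ (norm_nonneg _) (fun j hj => ?_) y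
  rw [← hqe]
  obtain ⟨q', hq', hqe'⟩ := hf.hx (0 + j)
  rw [hqe']
  refine poly_bdd q' K1 hq' 0 _ (norm_nonneg _) (fun i hi => ?_) x
  rw [← hqe']
  have := hmax (i, j) (by simp [hi, hj])
  simpa using this

theorem bipoly_window [CharZero F]
    (hch : ∀ m k : ℕ, k ≤ m → 1 ≤ m → 1 ≤ (m : ℝ) * ‖(m.choose k : F)‖)
    (K1 K2 S' T b1 b2 n : ℕ) (hK1 : 0 < K1) (hS' : 1 ≤ S') (hT : 0 < T) (hb2 : S' ≤ b2)
    (hn : b2 * T + S' ≤ n) (hK2 : K2 ≤ S' * T) (f : ℤ → ℤ → F) (hf : BiPoly K1 K2 f) (s0 : ℕ) :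
    ∃ r < K1, ∃ s < S', ∃ t < T, ∀ x y, ‖f x y‖ ≤
      ‖f ((r : ℤ) - (t : ℤ) * b1) (((s0 + s : ℕ) : ℤ) + (t : ℤ) * b2)‖ * (n : ℝ) ^ T := by
  obtain ⟨v, hv, hmax⟩ := Finset.exists_max_image
    (Finset.range K1 ×ˢ Finset.range S' ×ˢ Finset.range T)
    (fun v => ‖f ((v.1 : ℤ) - (v.2.2 : ℤ) * b1) (((s0 + v.2.1 : ℕ) : ℤ) + (v.2.2 : ℤ) * b2)‖)
    ⟨(0, 0, 0), by simp; omega⟩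
  simp only [Finset.mem_product, Finset.mem_range] at hv
  refine ⟨v.1, hv.1, v.2.1, hv.2.1, v.2.2, hv.2.2, fun x y => ?_⟩
  obtain ⟨q, hq, hqe⟩ := hf.hy x
  rw [hqe]
  refine block_bdd hch S' b2 n hS' hb2 (by omega) T hn q s0 _ (norm_nonneg _)
    (lt_of_lt_of_le hq (by exact_mod_cast hK2)) (fun s hs t ht => ?_) y
  rw [← hqe]
  obtain ⟨q', hq', hqe'⟩ := hf.hx ((s0 : ℤ) + s + b2 * t)
  rw [hqe']
  refine poly_bdd q' K1 hq' (-(t : ℤ) * b1) _ (norm_nonneg _) (fun i hi => ?_) x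
  rw [← hqe']
  have := hmax (i, s, t) (by simp [hi, hs, ht])
  have e1 : -(t : ℤ) * b1 + (i : ℤ) = (i : ℤ) - (t : ℤ) * b1 := by ring
  have e2 : (s0 : ℤ) + s + b2 * t = ((s0 + s : ℕ) : ℤ) + (t : ℤ) * b2 := by push_cast; ring
  rw [e1, e2]
  exact this

end ultra


section ultra
variable {F : Type*} [NormedField F] [IsUltrametricDist F]

theorem um_competitor (L : ℕ) (a : ℕ → F) (l : ℕ) (hl : l < L) (hal : a l ≠ 0)
    (h : ∑ i ∈ Finset.range L, a i = 0) : ∃ l' < L, l' ≠ l ∧ ‖a l‖ ≤ ‖a l'‖ := by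
  by_contra hcon
  push Not at hcon
  have h1 : ∑ i ∈ (Finset.range L).erase l, a i = - a l := by
    rw [eq_neg_iff_add_eq_zero, Finset.sum_erase_add _ _ (Finset.mem_range.2 hl), h]
  have hne : ((Finset.range L).erase l).Nonempty := by
    rw [Finset.nonempty_iff_ne_empty]
    intro h0
    rw [h0] at h1
    simp at h1
    exact hal h1
  obtain ⟨m, hm, hmax⟩ := Finset.exists_max_image _ (fun i => ‖a i‖) hne
  have h2 : ‖∑ i ∈ (Finset.range L).erase l, a i‖ ≤ ‖a m‖ :=
    um_sum_le _ _ _ (norm_nonneg _) hmax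
  rw [h1, norm_neg] at h2
  have hm' := Finset.mem_erase.1 hm
  have := hcon m (Finset.mem_range.1 hm'.2) hm'.1
  linarith

theorem zero_lemma [CharZero F]
    (hch : ∀ m k : ℕ, k ≤ m → 1 ≤ m → 1 ≤ (m : ℝ) * ‖(m.choose k : F)‖)
    (K1 K2 S' S T L b1 b2 n D : ℕ) (hK1 : 0 < K1) (hK2' : 0 < K2)
    (hS' : 1 ≤ S') (hT : 0 < T) (hb2 : S' ≤ b2)
    (hn : b2 * T + S' ≤ n) (hK2 : K2 ≤ S' * T) (hS : 2 * D * (L - 1) + S' ≤ S)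
    (al g η : F) (hal : ‖al‖ = 1) (hg0 : g ≠ 0) (hη0 : η ≠ 0)
    (Q : ℝ) (hQ1 : 1 ≤ Q) (hQ : ∀ s < S', ∀ t < T, ‖g‖ ^ s * ‖η‖ ^ t ≤ Q ∧ 1 ≤ Q * (‖g‖ ^ s * ‖η‖ ^ t))
    (hD : ‖g‖ ^ D * ((n : ℝ) ^ T * Q) < 1)
    (f : ℕ → ℤ → ℤ → F) (hf : ∀ l < L, BiPoly K1 K2 (f l))
    (hvan : ∀ r < K1, ∀ s < S, ∀ t < T, ∑ l ∈ Finset.range L,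
      f l ((r : ℤ) - (t : ℤ) * b1) ((s : ℤ) + (t : ℤ) * b2) * (al ^ r * g ^ s * η ^ t) ^ l = 0) :
    ∀ l < L, ∀ x y, f l x y = 0 := by
  have hmx : ∀ l, ∃ M : ℝ, 0 ≤ M ∧ (l < L → (∀ x y, ‖f l x y‖ ≤ M) ∧
      ∀ M', (∀ x y, ‖f l x y‖ ≤ M') → M ≤ M') := by
    intro l
    by_cases hl : l < L
    · obtain ⟨x0, y0, h⟩ := bipoly_max K1 K2 hK1 hK2' (f l) (hf l hl)
      exact ⟨‖f l x0 y0‖, norm_nonneg _, fun _ => ⟨h, fun M' hM' => hM' x0 y0⟩⟩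
    · exact ⟨0, le_rfl, fun h => absurd h hl⟩
  choose N hN0 hN using hmx
  by_contra hcon
  push Not at hcon
  obtain ⟨l0, hl0, x0, y0, hne⟩ := hcon
  have hl0N : 0 < N l0 := lt_of_lt_of_le (norm_pos_iff.2 hne) ((hN l0 hl0).1 x0 y0)
  have hn1 : (1 : ℝ) ≤ n := by exact_mod_cast (by omega : 1 ≤ n)
  have hC1 : (1 : ℝ) ≤ (n : ℝ) ^ T := one_le_pow₀ hn1
  have hg : 0 < ‖g‖ := norm_pos_iff.2 hg0
  have hη : 0 < ‖η‖ := norm_pos_iff.2 hη0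
  have hW1 : 1 ≤ (n : ℝ) ^ T * Q := one_le_mul_of_one_le_of_one_le hC1 hQ1
  refine newton_comb L N hN0 (‖g‖ ^ D) ((n : ℝ) ^ T * Q) (by positivity) hW1 hD l0 hl0 hl0N ?_
  intro j hj l hl hNl
  obtain ⟨r, hr, s, hs, t, ht, hbd⟩ := bipoly_window hch K1 K2 S' T b1 b2 n hK1 hS' hT hb2 hn hK2
    (f l) (hf l hl) (D * (2 * j))
  set X := (r : ℤ) - (t : ℤ) * b1
  set Y := ((D * (2 * j) + s : ℕ) : ℤ) + (t : ℤ) * b2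
  have hNle : N l ≤ ‖f l X Y‖ * (n : ℝ) ^ T := (hN l hl).2 _ hbd
  have hfne : f l X Y ≠ 0 := by
    intro h0
    rw [h0] at hNle
    simp at hNle
    linarith
  have hsS : D * (2 * j) + s < S := by
    have : D * (2 * j) ≤ 2 * D * (L - 1) := by
      have h1 : j ≤ L - 1 := by omega
      have : D * (2 * j) = 2 * D * j := by ring
      rw [this]
      exact Nat.mul_le_mul_left _ h1
    omega
  have hv := hvan r hr (D * (2 * j) + s) hsS t ht
  set Z := al ^ r * g ^ (D * (2 * j) + s) * η ^ t with hZ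
  have hal0 : al ≠ 0 := by
    intro h0; rw [h0] at hal; simp at hal
  have hZ0 : Z ≠ 0 := by
    rw [hZ]; exact mul_ne_zero (mul_ne_zero (pow_ne_zero _ hal0) (pow_ne_zero _ hg0)) (pow_ne_zero _ hη0)
  obtain ⟨l', hl', hne', hcomp⟩ := um_competitor L (fun l => f l X Y * Z ^ l) l hl
    (mul_ne_zero hfne (pow_ne_zero _ hZ0)) hv
  refine ⟨l', hl', hne', ?_⟩
  simp only [norm_mul, norm_pow] at hcomp
  set z := (‖g‖ ^ D) ^ (2 * j) with hz
  have hz0 : 0 < z := by positivity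
  set ζ := ‖g‖ ^ s * ‖η‖ ^ t with hζ
  have hζ0 : 0 < ζ := by positivity
  have hnZ : ‖Z‖ = z * ζ := by
    rw [hZ, norm_mul, norm_mul, norm_pow, norm_pow, norm_pow, hal, one_pow, one_mul, pow_add, pow_mul,
      hz, hζ]
    ring
  rw [hnZ] at hcomp
  obtain ⟨hQa, hQb⟩ := hQ s hs t ht
  rw [← hζ] at hQa hQb
  set C := (n : ℝ) ^ T with hC
  have hfl' : ‖f l' X Y‖ ≤ N l' := (hN l' hl').1 X Y
  -- main chain
  have h1 : N l * (z * ζ) ^ l ≤ C * (N l' * (z * ζ) ^ l') := by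
    calc N l * (z * ζ) ^ l ≤ ‖f l X Y‖ * C * (z * ζ) ^ l := by gcongr
      _ = C * (‖f l X Y‖ * (z * ζ) ^ l) := by ring
      _ ≤ C * (‖f l' X Y‖ * (z * ζ) ^ l') := by gcongr
      _ ≤ C * (N l' * (z * ζ) ^ l') := by gcongr
  have hζl : 0 < ζ ^ l := by positivity
  have h2 : ζ ^ l' ≤ Q ^ (l - l' + (l' - l)) * ζ ^ l := by
    rcases le_total l l' with hll | hll
    · obtain ⟨k, rfl⟩ := Nat.exists_eq_add_of_le hll
      have e : l - (l + k) + (l + k - l) = k := by omega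
      rw [e, pow_add, mul_comm]
      gcongr
    · obtain ⟨k, rfl⟩ := Nat.exists_eq_add_of_le hll
      have e : l' + k - l' + (l' - (l' + k)) = k := by omega
      rw [e, pow_add, mul_left_comm, ← mul_pow]
      exact le_mul_of_one_le_right (by positivity) (one_le_pow₀ hQb)
  have h3 : C ≤ C ^ (l - l' + (l' - l)) := by
    have : l - l' + (l' - l) ≠ 0 := by omega
    exact le_self_pow₀ hC1 this
  have hNl' := hN0 l'
  have h4 : N l * z ^ l * ζ ^ l ≤ N l' * z ^ l' * (C * Q) ^ (l - l' + (l' - l)) * ζ ^ l := by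
    calc N l * z ^ l * ζ ^ l = N l * (z * ζ) ^ l := by rw [mul_pow]; ring
      _ ≤ C * (N l' * (z * ζ) ^ l') := h1
      _ = C * (N l' * z ^ l' * ζ ^ l') := by rw [mul_pow]; ring
      _ ≤ C ^ (l - l' + (l' - l)) * (N l' * z ^ l' * (Q ^ (l - l' + (l' - l)) * ζ ^ l)) := by gcongr
      _ = _ := by rw [mul_pow]; ring
  exact le_of_mul_le_mul_right h4 hζl

end ultra

/-- binomials in `PadicAlgCl p` -/
theorem padic_choose (p : ℕ) [Fact p.Prime] (m k : ℕ) (hk : k ≤ m) (hm : 1 ≤ m) :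
    1 ≤ (m : ℝ) * ‖(m.choose k : PadicAlgCl p)‖ := by
  have h1 : ‖(m.choose k : PadicAlgCl p)‖ = ‖((m.choose k : ℕ) : ℚ_[p])‖ := by
    rw [← PadicAlgCl.norm_extends]; simp
  have hp : p.Prime := Fact.out
  have hc : m.choose k ≠ 0 := (Nat.choose_pos hk).ne'
  have h2 : ((p ^ (m.choose k).factorization p : ℕ) : ℝ) ≤ m := by
    exact_mod_cast Nat.pow_factorization_choose_le (by omega)
  have h3 : ‖((m.choose k : ℕ) : ℚ_[p])‖ = ((p : ℝ) ^ (m.choose k).factorization p)⁻¹ := by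
    rw [Padic.norm_eq_zpow_neg_valuation (by exact_mod_cast hc), Padic.valuation_natCast,
      Nat.factorization_def _ hp, zpow_neg, zpow_natCast]
  rw [h1, h3]
  have hp0 : (0 : ℝ) < (p : ℝ) ^ (m.choose k).factorization p := by
    have := hp.pos
    positivity
  rw [← div_eq_mul_inv, le_div_iff₀ hp0, one_mul]
  exact_mod_cast h2


theorem exists_minor {F : Type*} [Field F] {ι ρ : Type*} [Fintype ι] [DecidableEq ι] (M : ρ → ι → F)
    (h : ∀ c : ι → F, (∀ v, ∑ i, c i * M v i = 0) → c = 0) :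
    ∃ σ : ι → ρ, (Matrix.of fun i j => M (σ i) j).det ≠ 0 := by
  have hspan : Submodule.span F (Set.range M) = ⊤ := by
    by_contra hcon
    obtain ⟨φ, hφ, hle⟩ := Submodule.exists_le_ker_of_lt_top _ (lt_top_iff_ne_top.2 hcon)
    apply hφ
    have h1 := h (fun i => φ (Pi.single i 1)) (by
      intro v
      have h2 : φ (M v) = 0 := hle (Submodule.subset_span ⟨v, rfl⟩)
      rw [← h2]
      conv_rhs => rw [pi_eq_sum_univ' (M v)]
      rw [map_sum]
      refine Finset.sum_congr rfl fun i _ => ?_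
      rw [map_smul, smul_eq_mul, mul_comm]
      )
    ext i
    exact congrFun h1 i
  obtain ⟨b, hb, hbs, hbl⟩ := exists_linearIndependent F (Set.range M)
  rw [hspan] at hbs
  let B := Module.Basis.mk hbl (by rw [Subtype.range_coe]; exact hbs.ge)
  let e : ι ≃ b := (Pi.basisFun F ι).indexEquiv B
  have hc : ∀ i, ∃ v, M v = (e i : ι → F) := fun i => hb (e i).2
  choose σ hσ using hc
  refine ⟨σ, ?_⟩
  rw [← isUnit_iff_ne_zero, ← Matrix.isUnit_iff_isUnit_det, ← Matrix.linearIndependent_rows_iff_isUnit]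
  have : (Matrix.of fun i j => M (σ i) j).row = (fun x : b => (x : ι → F)) ∘ e := by
    funext i j
    simp [Matrix.row, hσ]
  rw [this]
  exact hbl.comp _ e.injective

theorem coeffs_zero {F : Type*} [Field F] [CharZero F] (K : ℕ) (a : Fin K → F)
    (h : ∀ y : ℤ, ∑ k, a k * (y : F) ^ (k : ℕ) = 0) : a = 0 := by
  have hP : (∑ k, Polynomial.C (a k) * Polynomial.X ^ (k : ℕ)) = 0 := by
    apply Polynomial.eq_zero_of_infinite_isRoot
    apply Set.Infinite.mono (s := Set.range (fun y : ℤ => (y : F)))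
    · rintro _ ⟨y, rfl⟩
      simp only [Set.mem_ofPred_eq, Polynomial.IsRoot, Polynomial.eval_finsetSum]
      simpa using h y
    · exact Set.infinite_range_of_injective Int.cast_injective
  funext k
  have := congrArg (fun p => Polynomial.coeff p (k : ℕ)) hP
  simp only [Polynomial.finsetSum_coeff, Polynomial.coeff_C_mul, Polynomial.coeff_X_pow,
    Polynomial.coeff_zero] at this
  rw [Finset.sum_eq_single k] at this
  · simpa using this
  · intro i _ hi
    have : (k : ℕ) ≠ i := fun h => hi (Fin.ext h.symm)
    simp [this]
  · simp

theorem bipoly_of_sum {F : Type*} [NormedField F] [IsUltrametricDist F] (K1 K2 : ℕ) (c : Fin K1 → Fin K2 → F) :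
    BiPoly K1 K2 (fun x y : ℤ => ∑ i, ∑ j, c i j * (x : F) ^ (i : ℕ) * (y : F) ^ (j : ℕ)) := by
  constructor
  · intro y
    refine ⟨∑ i : Fin K1, Polynomial.C (∑ j, c i j * (y : F) ^ (j : ℕ)) * Polynomial.X ^ (i : ℕ), ?_, ?_⟩
    · exact Polynomial.degree_sum_fin_lt _
    · intro x
      simp only [Polynomial.eval_finsetSum, Polynomial.eval_mul, Polynomial.eval_C, Polynomial.eval_pow,
        Polynomial.eval_X, Finset.sum_mul]
      refine Finset.sum_congr rfl fun i _ => Finset.sum_congr rfl fun j _ => by ring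
  · intro x
    refine ⟨∑ j : Fin K2, Polynomial.C (∑ i, c i j * (x : F) ^ (i : ℕ)) * Polynomial.X ^ (j : ℕ), ?_, ?_⟩
    · exact Polynomial.degree_sum_fin_lt _
    · intro y
      simp only [Polynomial.eval_finsetSum, Polynomial.eval_mul, Polynomial.eval_C, Polynomial.eval_pow,
        Polynomial.eval_X, Finset.sum_mul]
      rw [Finset.sum_comm]

theorem padic_nat_ge (p : ℕ) [Fact p.Prime] (m : ℕ) (hm : 1 ≤ m) :
    1 ≤ (m : ℝ) * ‖(m : PadicAlgCl p)‖ := by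
  have := padic_choose p m 1 hm hm
  simpa using this

theorem padic_nat_coprime (p : ℕ) [Fact p.Prime] (m : ℕ) (hm : Nat.Coprime p m) :
    ‖(m : PadicAlgCl p)‖ = 1 := by
  have h1 : ‖(m : PadicAlgCl p)‖ = ‖((m : ℕ) : ℚ_[p])‖ := by
    rw [← PadicAlgCl.norm_extends]; simp
  rw [h1]
  exact Padic.norm_natCast_eq_one_iff.2 hm

theorem padic_g_le (p : ℕ) [Fact p.Prime] (g : ℕ) (hpg : p ∣ g) :
    ‖(g : PadicAlgCl p)‖ ≤ 1 / 2 := by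
  obtain ⟨m, rfl⟩ := hpg
  have h1 : ‖((p : ℕ) : PadicAlgCl p)‖ = ‖((p : ℕ) : ℚ_[p])‖ := by
    rw [← PadicAlgCl.norm_extends]; simp
  have h2 : ‖(m : PadicAlgCl p)‖ ≤ 1 := IsUltrametricDist.norm_natCast_le_one _ m
  rw [Nat.cast_mul, norm_mul, h1, Padic.norm_p]
  have hp : (2 : ℝ) ≤ p := by exact_mod_cast (Fact.out : p.Prime).two_le
  have h3 : (p : ℝ)⁻¹ ≤ 1 / 2 := by
    rw [one_div]; exact inv_anti₀ (by norm_num) hp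
  have h4 : 0 ≤ (p : ℝ)⁻¹ := by positivity
  nlinarith [norm_nonneg (m : PadicAlgCl p)]

theorem padic_root (p : ℕ) [Fact p.Prime] : ∃ z : PadicAlgCl p, z ^ 3 = z ^ 2 + 1 ∧ ‖z‖ = 1 ∧
    ‖3 * z - 2‖ ≤ 1 ∧ 1 ≤ 31 * ‖3 * z - 2‖ := by
  obtain ⟨z, hz⟩ := IsAlgClosed.exists_root
    (Polynomial.X ^ 3 - Polynomial.X ^ 2 - 1 : Polynomial (PadicAlgCl p)) (by
      have : (Polynomial.X ^ 3 - Polynomial.X ^ 2 - 1 : Polynomial (PadicAlgCl p)).degree = 3 := by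
        compute_degree!
      rw [this]; decide)
  have hz' : z ^ 3 = z ^ 2 + 1 := by
    have : z ^ 3 - z ^ 2 - 1 = 0 := by simpa [Polynomial.IsRoot] using hz
    linear_combination this
  have hle : ‖z‖ ≤ 1 := by
    by_contra hcon
    push Not at hcon
    have h1 : ‖z ^ 2 + 1‖ ≤ max ‖z ^ 2‖ ‖(1 : PadicAlgCl p)‖ := IsUltrametricDist.norm_add_le_max _ _
    rw [← hz', norm_pow, norm_pow, norm_one] at h1
    have h2 : max (‖z‖ ^ 2) 1 = ‖z‖ ^ 2 := max_eq_left (by nlinarith)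
    rw [h2] at h1
    have h3 : ‖z‖ ^ 2 < ‖z‖ ^ 3 := pow_lt_pow_right₀ hcon (by norm_num)
    linarith
  have hge : 1 ≤ ‖z‖ := by
    have h0 : z ^ 2 * (z + (-1)) = 1 := by linear_combination hz'
    have h1 : ‖z + (-1)‖ ≤ 1 := by
      refine (IsUltrametricDist.norm_add_le_max _ _).trans (max_le hle ?_)
      rw [norm_neg, norm_one]
    have h2 := congrArg norm h0
    rw [norm_mul, norm_pow, norm_one] at h2
    nlinarith [norm_nonneg z, norm_nonneg (z + (-1))]
  have hn : ∀ m : ℤ, ‖(m : PadicAlgCl p)‖ ≤ 1 := um_int_le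
  have mul1 : ∀ x y : PadicAlgCl p, ‖x‖ ≤ 1 → ‖y‖ ≤ 1 → ‖x * y‖ ≤ 1 := by
    intro x y hx hy
    rw [norm_mul]; exact mul_le_one₀ hx (norm_nonneg _) hy
  have add1 : ∀ x y : PadicAlgCl p, ‖x‖ ≤ 1 → ‖y‖ ≤ 1 → ‖x + y‖ ≤ 1 := by
    intro x y hx hy
    exact (IsUltrametricDist.norm_add_le_max _ _).trans (max_le hx hy)
  have h3 : ‖3 * z - 2‖ ≤ 1 := by
    have e : 3 * z - 2 = ((3 : ℤ) : PadicAlgCl p) * z + ((-2 : ℤ) : PadicAlgCl p) := by push_cast; ring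
    rw [e]
    exact add1 _ _ (mul1 _ _ (hn _) hle) (hn _)
  refine ⟨z, hz', le_antisymm hle hge, h3, ?_⟩
  have e2 : ‖((9 : ℤ) : PadicAlgCl p) * (z * z) + (((-3 : ℤ) : PadicAlgCl p) * z + ((-2 : ℤ) : PadicAlgCl p))‖ ≤ 1 :=
    add1 _ _ (mul1 _ _ (hn _) (mul1 _ _ hle hle)) (add1 _ _ (mul1 _ _ (hn _) hle) (hn _))
  have e3 : (3 * z - 2) * (((9 : ℤ) : PadicAlgCl p) * (z * z) + (((-3 : ℤ) : PadicAlgCl p) * z + ((-2 : ℤ) : PadicAlgCl p)))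
      = ((31 : ℕ) : PadicAlgCl p) := by
    push_cast; linear_combination 27 * hz'
  have e4 := padic_nat_ge p 31 (by norm_num)
  rw [← e3, norm_mul] at e4
  push_cast at e4
  have := norm_nonneg (3 * z - 2)
  calc (1 : ℝ) ≤ _ := e4
    _ ≤ 31 * (‖3 * z - 2‖ * 1) := by push_cast at e2; gcongr
    _ = _ := by ring


/-- entry of the interpolation matrix -/
noncomputable def entP (g u w b1 b2 L K1 K2 : ℕ) (v : ℕ × ℕ × ℕ) (c : Fin L × Fin K1 × Fin K2) :
    Polynomial ℤ :=
  Polynomial.C (((v.1 : ℤ) - (v.2.2 : ℤ) * b1) ^ (c.2.1 : ℕ) *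
    ((v.2.1 : ℤ) + (v.2.2 : ℤ) * b2) ^ (c.2.2 : ℕ) *
    ((g : ℤ) ^ (v.2.1 * c.1) * (u : ℤ) ^ (v.2.2 * c.1) * (w : ℤ) ^ (v.2.2 * (L - 1 - c.1)))) *
  (Polynomial.X ^ (v.1 * c.1) * (3 * Polynomial.X - 2) ^ (v.2.2 * (L - 1 - c.1)))

theorem entP_aeval {E : Type*} [Field E] (g u w b1 b2 L K1 K2 : ℕ) (v : ℕ × ℕ × ℕ)
    (c : Fin L × Fin K1 × Fin K2) (z : E) :
    Polynomial.aeval z (entP g u w b1 b2 L K1 K2 v c) =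
    (((v.1 : ℤ) - (v.2.2 : ℤ) * b1 : ℤ) : E) ^ (c.2.1 : ℕ) *
    (((v.2.1 : ℤ) + (v.2.2 : ℤ) * b2 : ℤ) : E) ^ (c.2.2 : ℕ) *
    ((g : E) ^ (v.2.1 * c.1) * (u : E) ^ (v.2.2 * c.1) * (w : E) ^ (v.2.2 * (L - 1 - c.1))) *
    (z ^ (v.1 * c.1) * (3 * z - 2) ^ (v.2.2 * (L - 1 - c.1))) := by
  have h3 : Polynomial.aeval z (3 : Polynomial ℤ) = 3 := map_ofNat _ 3
  have h2 : Polynomial.aeval z (2 : Polynomial ℤ) = 2 := map_ofNat _ 2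
  simp only [entP, map_mul, map_pow, map_sub, Polynomial.aeval_C, Polynomial.aeval_X, h3, h2]
  simp

theorem entP_aeval' {E : Type*} [Field E] (g u w b1 b2 L K1 K2 : ℕ) (v : ℕ × ℕ × ℕ)
    (c : Fin L × Fin K1 × Fin K2) (z : E) (hw : (w : E) * (3 * z - 2) ≠ 0) :
    Polynomial.aeval z (entP g u w b1 b2 L K1 K2 v c) =
    ((w : E) * (3 * z - 2)) ^ (v.2.2 * (L - 1)) *
    ((((v.1 : ℤ) - (v.2.2 : ℤ) * b1 : ℤ) : E) ^ (c.2.1 : ℕ) *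
    (((v.2.1 : ℤ) + (v.2.2 : ℤ) * b2 : ℤ) : E) ^ (c.2.2 : ℕ) *
    (z ^ v.1 * (g : E) ^ v.2.1 * ((u : E) / (w * (3 * z - 2))) ^ v.2.2) ^ (c.1 : ℕ)) := by
  rw [entP_aeval]
  have hl : (c.1 : ℕ) + (L - 1 - c.1) = L - 1 := by have := c.1.2; omega
  have e1 : ((w : E) * (3 * z - 2)) ^ (v.2.2 * (L - 1)) =
      ((w : E) * (3 * z - 2)) ^ (v.2.2 * c.1) * ((w : E) * (3 * z - 2)) ^ (v.2.2 * (L - 1 - c.1)) := by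
    rw [← pow_add, ← mul_add, hl]
  have e2 : (u : E) ^ (v.2.2 * c.1) = ((w : E) * (3 * z - 2)) ^ (v.2.2 * c.1) *
      ((u : E) / (w * (3 * z - 2))) ^ (v.2.2 * c.1) := by
    rw [← mul_pow, mul_div_cancel₀ _ hw]
  rw [e1, e2, mul_pow _ _ (v.2.2 * (L - 1 - c.1)), mul_pow _ _ (c.1 : ℕ), mul_pow _ _ (c.1 : ℕ), ← pow_mul, ← pow_mul,
    ← pow_mul]
  ring

open ComplexConjugate in
theorem main_minor (p : ℕ) [Fact p.Prime] (g u w' D b1 b2 L K1 K2 S S' T n e : ℕ)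
    (hL : 0 < L) (hK1 : 0 < K1) (hK2' : 0 < K2)
    (hpg : p ∣ g) (hg2 : 2 ≤ g) (hu : Nat.Coprime p u) (hw' : Nat.Coprime p w')
    (hD : 1 ≤ D)
    (hS' : 1 ≤ S') (hT : 0 < T) (hb2 : S' ≤ b2) (hn : b2 * T + S' ≤ n) (hK2 : K2 ≤ S' * T)
    (he : 31 * D * n ≤ 2 ^ e) (hS : 2 * (S' + T * e + 1) * (L - 1) + S' ≤ S) 
    (α : ℝ) (hα : α ^ 3 = α ^ 2 + 1) (β : ℂ) (hβ : β ^ 3 = β ^ 2 + 1)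
    (hs : β + conj β = 1 - α) (hp : β * conj β = α ^ 2 - α) :
    ∃ σ : Fin L × Fin K1 × Fin K2 → ℕ × ℕ × ℕ,
      (∀ i, (σ i).1 < K1 ∧ (σ i).2.1 < S ∧ (σ i).2.2 < T) ∧
      1 ≤ |(Matrix.of fun i j => Polynomial.aeval α (entP g u (D * w') b1 b2 L K1 K2 (σ i) j)).det| *
        ‖(Matrix.of fun i j => Polynomial.aeval β (entP g u (D * w') b1 b2 L K1 K2 (σ i) j)).det‖ ^ 2 := by
  obtain ⟨z, hz, hz1, hz3, hz31⟩ := padic_root p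
  have hz30 : 3 * z - 2 ≠ 0 := by
    intro h0; rw [h0] at hz31; norm_num at hz31
  have hw0 : w' ≠ 0 := by
    rintro rfl
    have := (Fact.out : p.Prime).one_lt
    simp at hw'; omega
  have hu0 : u ≠ 0 := by
    rintro rfl
    have := (Fact.out : p.Prime).one_lt
    simp at hu; omega
  have hWne : ((D * w' : ℕ) : PadicAlgCl p) * (3 * z - 2) ≠ 0 := by
    refine mul_ne_zero ?_ hz30
    exact_mod_cast Nat.mul_ne_zero (by omega) hw0
  set η : PadicAlgCl p := (u : PadicAlgCl p) / (((D * w' : ℕ) : PadicAlgCl p) * (3 * z - 2)) with hη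
  have hη0 : η ≠ 0 := div_ne_zero (by exact_mod_cast hu0) hWne
  have hDn1 : ‖(D : PadicAlgCl p)‖ ≤ 1 := IsUltrametricDist.norm_natCast_le_one _ D
  have hDn2 : 1 ≤ (D : ℝ) * ‖(D : PadicAlgCl p)‖ := padic_nat_ge p D hD
  have hDpos : 0 < ‖(D : PadicAlgCl p)‖ := norm_pos_iff.2 (by exact_mod_cast (by omega : D ≠ 0))
  have hzpos : 0 < ‖3 * z - 2‖ := norm_pos_iff.2 hz30
  have hηn : ‖η‖ = 1 / (‖(D : PadicAlgCl p)‖ * ‖3 * z - 2‖) := by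
    rw [hη, norm_div, norm_mul, Nat.cast_mul, norm_mul, padic_nat_coprime p u hu,
      padic_nat_coprime p w' hw', mul_one]
  have hη1 : 1 ≤ ‖η‖ := by
    rw [hηn, le_div_iff₀ (by positivity), one_mul]
    exact mul_le_one₀ hDn1 (norm_nonneg _) hz3
  have hη2 : ‖η‖ ≤ 31 * D := by
    rw [hηn, div_le_iff₀ (by positivity)]
    calc (1 : ℝ) = 1 * 1 := by ring
      _ ≤ (31 * ‖3 * z - 2‖) * (D * ‖(D : PadicAlgCl p)‖) := by gcongr
      _ = _ := by ring
  have hgn : ‖(g : PadicAlgCl p)‖ ≤ 1 / 2 := padic_g_le p g hpg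
  have hg0 : (g : PadicAlgCl p) ≠ 0 := by exact_mod_cast (by omega : g ≠ 0)
  have hgpos : 0 < ‖(g : PadicAlgCl p)‖ := norm_pos_iff.2 hg0
  set θ := ‖(g : PadicAlgCl p)‖ with hθ
  have hDr : (1 : ℝ) ≤ D := by exact_mod_cast hD
  have h31 : (1 : ℝ) ≤ (31 * D) ^ T := one_le_pow₀ (by linarith)
  have hθS : 1 ≤ (θ ^ S')⁻¹ := by
    rw [one_le_inv₀ (by positivity)]
    exact pow_le_one₀ hgpos.le (by linarith)
  set Q : ℝ := (θ ^ S')⁻¹ * (31 * D) ^ T with hQ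
  have zl := zero_lemma (F := PadicAlgCl p) (padic_choose p) K1 K2 S' S T L b1 b2 n (S' + T * e + 1) hK1 hK2' hS' hT hb2
    hn hK2 hS z (g : PadicAlgCl p) η hz1 hg0 hη0 Q (one_le_mul_of_one_le_of_one_le hθS h31)
    (by
      intro s hs t ht
      have a1 : θ ^ s ≤ 1 := pow_le_one₀ hgpos.le (by linarith)
      have a2 : 1 ≤ ‖η‖ ^ t := one_le_pow₀ hη1
      have a3 : ‖η‖ ^ t ≤ (31 * D) ^ T := 
        (pow_le_pow_left₀ (norm_nonneg _) hη2 t).trans (pow_le_pow_right₀ (by linarith) ht.le)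
      have a4 : θ ^ S' ≤ θ ^ s := pow_le_pow_of_le_one hgpos.le (by linarith) hs.le
      constructor
      · rw [hQ]
        calc θ ^ s * ‖η‖ ^ t ≤ 1 * (31 * D) ^ T := by gcongr
          _ ≤ (θ ^ S')⁻¹ * (31 * D) ^ T := by gcongr
      · rw [hQ]
        calc (1 : ℝ) = (θ ^ S')⁻¹ * 1 * (θ ^ S' * 1) := by field_simp
          _ ≤ (θ ^ S')⁻¹ * (31 * D) ^ T * (θ ^ s * ‖η‖ ^ t) := by gcongr)
    (by
      rw [hQ, pow_succ, pow_add, pow_mul']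
      have a5 : θ ^ e * (31 * D * n) ≤ 1 := by
        have : ((31 * D * n : ℕ) : ℝ) ≤ ((2 ^ e : ℕ) : ℝ) := by exact_mod_cast he
        push_cast at this
        calc θ ^ e * (31 * D * n) ≤ (1 / 2) ^ e * 2 ^ e := by gcongr
          _ = 1 := by rw [← mul_pow]; norm_num
      calc θ ^ S' * (θ ^ e) ^ T * θ * ((n : ℝ) ^ T * ((θ ^ S')⁻¹ * (31 * D) ^ T))
          = (θ ^ e * (31 * D * n)) ^ T * θ := by simp only [mul_pow]; field_simp
        _ ≤ 1 ^ T * (1 / 2) := by gcongr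
        _ < 1 := by norm_num)
  obtain ⟨σ, hσ⟩ := exists_minor (F := PadicAlgCl p) (ι := Fin L × Fin K1 × Fin K2)
    (ρ := Fin K1 × Fin S × Fin T)
    (fun v c => Polynomial.aeval z (entP g u (D * w') b1 b2 L K1 K2 (v.1, v.2.1, v.2.2) c)) (by
      intro c hc
      have := zl (fun l x y => if hl : l < L then ∑ i, ∑ j, c (⟨l, hl⟩, i, j) * (x : PadicAlgCl p) ^ (i : ℕ) * (y : PadicAlgCl p) ^ (j : ℕ) else 0)
        (by
          intro l hl
          simp only [hl, dif_pos]
          exact bipoly_of_sum K1 K2 (fun i j => c (⟨l, hl⟩, i, j)))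
        (by
          intro r hr s hs t ht
          have h1 := hc (⟨r, hr⟩, ⟨s, hs⟩, ⟨t, ht⟩)
          have h2 : (((D * w' : ℕ) : PadicAlgCl p) * (3 * z - 2)) ^ (t * (L - 1)) ≠ 0 := pow_ne_zero _ hWne
          apply mul_left_cancel₀ h2
          rw [mul_zero]
          refine Eq.trans ?_ h1
          rw [Fintype.sum_prod_type, Finset.mul_sum, ← Fin.sum_univ_eq_sum_range
            (fun l => (((D * w' : ℕ) : PadicAlgCl p) * (3 * z - 2)) ^ (t * (L - 1)) * ((if hl : l < L then ∑ i, ∑ j, c (⟨l, hl⟩, i, j) * ((((r : ℤ) - (t : ℤ) * b1 : ℤ)) : PadicAlgCl p) ^ (i : ℕ) * ((((s : ℤ) + (t : ℤ) * b2 : ℤ)) : PadicAlgCl p) ^ (j : ℕ) else 0) * (z ^ r * (g : PadicAlgCl p) ^ s * η ^ t) ^ l))]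
          refine Finset.sum_congr rfl fun l _ => ?_
          rw [Fintype.sum_prod_type, dif_pos l.2, Finset.sum_mul, Finset.mul_sum]
          refine Finset.sum_congr rfl fun i _ => ?_
          rw [Finset.sum_mul, Finset.mul_sum]
          refine Finset.sum_congr rfl fun j _ => ?_
          have h5 := entP_aeval' g u (D * w') b1 b2 L K1 K2 (r, s, t) (l, i, j) z hWne
          refine Eq.trans ?_ (congrArg (fun x => c (l, i, j) * x) h5.symm)
          simp only [← hη]
          ring)
      funext ⟨l, i, j⟩
      have h3 := this l l.2
      simp only [l.2, dif_pos] at h3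
      have h4 : ∀ x : ℤ, ∀ j, ∑ i, c (l, i, j) * (x : PadicAlgCl p) ^ (i : ℕ) = 0 := by
        intro x j
        have := coeffs_zero K2 (fun j => ∑ i, c (l, i, j) * (x : PadicAlgCl p) ^ (i : ℕ)) (by
          intro y
          rw [← h3 x y, Finset.sum_comm]
          refine Finset.sum_congr rfl fun j _ => ?_
          rw [Finset.sum_mul])
        exact congrFun this j
      exact congrFun (coeffs_zero K1 (fun i => c (l, i, j)) (fun x => h4 x j)) i)
  refine ⟨fun i => ((σ i).1, (σ i).2.1, (σ i).2.2), fun i => ⟨(σ i).1.2, (σ i).2.1.2, (σ i).2.2.2⟩, ?_⟩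
  set PM : Matrix (Fin L × Fin K1 × Fin K2) (Fin L × Fin K1 × Fin K2) (Polynomial ℤ) :=
    Matrix.of fun i j => entP g u (D * w') b1 b2 L K1 K2 ((σ i).1, (σ i).2.1, (σ i).2.2) j with hPM
  have key := norm_bound α hα β hβ hs hp z hz PM.det (by
    rw [AlgHom.map_det]
    exact hσ)
  rw [AlgHom.map_det, AlgHom.map_det] at key
  exact key


open Asymptotics Filter Topology in
theorem schwarz_gen (ρ : ℝ) (hρ : 1 ≤ ρ) (n : ℕ) : ∀ (f : ℂ → ℂ) (M : ℝ), Differentiable ℂ f →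
    f =O[𝓝 0] (fun z : ℂ => z ^ n) → (∀ z : ℂ, ‖z‖ = ρ → ‖f z‖ ≤ M) → ‖f 1‖ * ρ ^ n ≤ M := by
  induction n with
  | zero =>
    intro f M hf _ hM
    have h : ‖f 1‖ ≤ M := by
      refine Complex.norm_le_of_forall_mem_frontier_norm_le (U := Metric.ball 0 ρ)
        Metric.isBounded_ball hf.diffContOnCl ?_ ?_
      · intro z hz
        rw [frontier_ball _ (by positivity)] at hz
        exact hM z (by simpa using hz)
      · rw [closure_ball _ (by positivity)]
        simpa using hρ
    simpa using h
  | succ n ih =>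
    intro f M hf hO hM
    have hρ0 : 0 < ρ := by linarith
    have hf0 : f 0 = 0 := by
      obtain ⟨C, hC⟩ := hO.bound
      have := hC.self_of_nhds
      simpa using this
    have hd : Differentiable ℂ (dslope f 0) := by
      rw [← differentiableOn_univ]
      exact (Complex.differentiableOn_dslope univ_mem).2 hf.differentiableOn
    have hval : ∀ z : ℂ, z ≠ 0 → dslope f 0 z = f z / z := by
      intro z hz
      rw [dslope_of_ne _ hz, slope_def_field, hf0]; simp
    have hO' : dslope f 0 =O[𝓝 0] (fun z : ℂ => z ^ n) := by
      obtain ⟨C, hC⟩ := hO.bound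
      refine IsBigO.of_bound C ?_
      have hp : ∀ z : ℂ, z ≠ 0 → ‖f z‖ ≤ C * ‖z ^ (n + 1)‖ → ‖dslope f 0 z‖ ≤ C * ‖z ^ n‖ := by
        intro z hz h
        rw [hval z hz, norm_div, div_le_iff₀ (norm_pos_iff.2 hz)]
        calc ‖f z‖ ≤ _ := h
          _ = _ := by rw [pow_succ, norm_mul]; ring
      have h0 : ‖dslope f 0 0‖ ≤ C * ‖(0 : ℂ) ^ n‖ := by
        have hl : Tendsto (fun z => ‖dslope f 0 z‖) (𝓝[≠] 0) (𝓝 ‖dslope f 0 0‖) :=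
          (hd.continuous.norm.tendsto 0).mono_left nhdsWithin_le_nhds
        have hr : Tendsto (fun z : ℂ => C * ‖z ^ n‖) (𝓝[≠] 0) (𝓝 (C * ‖(0 : ℂ) ^ n‖)) := by
          have : Continuous fun z : ℂ => C * ‖z ^ n‖ := by fun_prop
          exact (this.tendsto 0).mono_left nhdsWithin_le_nhds
        refine le_of_tendsto_of_tendsto hl hr ?_
        filter_upwards [hC.filter_mono nhdsWithin_le_nhds, self_mem_nhdsWithin] with z h1 h2
        exact hp z h2 h1
      filter_upwards [hC] with z h1
      by_cases hz : z = 0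
      · rw [hz]; exact h0
      · exact hp z hz h1
    have := ih (dslope f 0) (M / ρ) hd hO' (by
      intro z hz
      have hz0 : z ≠ 0 := by
        rintro rfl; simp at hz; linarith
      rw [hval z hz0, norm_div, hz]
      exact div_le_div_of_nonneg_right (hM z hz) hρ0.le)
    rw [hval 1 one_ne_zero, div_one, le_div_iff₀ hρ0] at this
    calc _ = ‖f 1‖ * ρ ^ n * ρ := by ring
      _ ≤ M := this

open Asymptotics Filter Topology in
/-- determinant order lemma -/
theorem det_bigO {ι : Type*} [Fintype ι] [DecidableEq ι] (D n0 : ℕ) (h : ι → ι → ℂ → ℂ)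
    (v : ι → ℕ → ι → ℂ)
    (hh : ∀ i j, (fun z : ℂ => h i j z - ∑ n ∈ Finset.range D, v j n i * z ^ n) =O[𝓝 0]
      (fun z : ℂ => z ^ D))
    (hv : ∀ r : ι → ℕ, (∀ j, r j ≤ D) → ∑ j, r j < n0 → ∀ B : Matrix ι ι ℂ,
      (∀ j, r j < D → ∃ c : ℂ, ∀ i, B i j = c * v j (r j) i) → B.det = 0) :
    (fun z : ℂ => (Matrix.of fun i j => h i j z).det) =O[𝓝 0] (fun z : ℂ => z ^ n0) := by
  classical
  set e : ι → ι → ℂ → ℂ := fun i j z => h i j z - ∑ n ∈ Finset.range D, v j n i * z ^ n with he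
  set B : (ι → Fin (D + 1)) → ℂ → Matrix ι ι ℂ := fun r z => Matrix.of fun i j =>
    if (r j : ℕ) < D then v j (r j) i * z ^ (r j : ℕ) else e i j z with hB
  have hexp : ∀ z, (Matrix.of fun i j => h i j z).det = ∑ r : ι → Fin (D + 1), (B r z).det := by
    intro z
    have h1 := (Matrix.detRowAlternating (n := ι) (R := ℂ)).toMultilinearMap.map_sum
      (α := fun _ : ι => Fin (D + 1))
      (fun j (a : Fin (D + 1)) => (fun i => if (a : ℕ) < D then v j a i * z ^ (a : ℕ) else e i j z))
    have h2 : ∀ r : ι → Fin (D + 1), (B r z).det =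
      (Matrix.detRowAlternating (n := ι) (R := ℂ)).toMultilinearMap
        (fun j => (fun i => if (r j : ℕ) < D then v j (r j) i * z ^ (r j : ℕ) else e i j z)) := by
      intro r
      rw [← Matrix.det_transpose]
      rfl
    simp_rw [h2]
    rw [← h1, ← Matrix.det_transpose]
    change Matrix.det _ = Matrix.det _
    congr 1
    ext j i
    simp only [Matrix.transpose_apply, Matrix.of_apply, Finset.sum_apply]
    rw [Fin.sum_univ_castSucc]
    simp only [Fin.val_castSucc, Fin.is_lt, if_true, Fin.val_last, lt_irrefl, if_false, he]
    rw [Finset.sum_range]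
    ring
  simp_rw [hexp]
  refine IsBigO.fun_sum fun r _ => ?_
  by_cases hr : ∑ j, (r j : ℕ) < n0
  · have : (fun z => (B r z).det) = fun _ => 0 := by
      funext z
      refine hv (fun j => r j) (fun j => by omega) hr _ ?_
      intro j hj
      refine ⟨z ^ (r j : ℕ), fun i => ?_⟩
      simp [hB, hj, mul_comm]
    rw [this]
    exact isBigO_zero _ _
  · push Not at hr
    have h1 : (fun z : ℂ => z ^ (∑ j, (r j : ℕ))) =O[𝓝 0] (fun z : ℂ => z ^ n0) := by
      refine IsBigO.of_bound 1 ?_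
      filter_upwards [Metric.ball_mem_nhds (0 : ℂ) one_pos] with z hz
      have hz2 : ‖z‖ < 1 := by simpa using hz
      rw [one_mul, norm_pow, norm_pow]
      exact pow_le_pow_of_le_one (norm_nonneg _) hz2.le hr
    refine IsBigO.trans ?_ h1
    simp_rw [Matrix.det_apply']
    refine IsBigO.fun_sum fun σ _ => ?_
    refine IsBigO.const_mul_left ?_ _
    simp_rw [← Finset.prod_pow_eq_pow_sum]
    refine IsBigO.finsetProd fun j _ => ?_
    simp only [hB, Matrix.of_apply]
    split_ifs with hj
    · exact (isBigO_refl _ _).const_mul_left _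
    · have : (r j : ℕ) = D := by omega
      rw [this]
      exact hh _ _

theorem exists_level {ι : Type*} [Fintype ι] (D : ℕ) (F : ℕ → ℕ) (r : ι → ℕ)
    (hr : ∀ j, r j ≤ D) (n0 : ℕ) (hn : n0 + ∑ d ∈ Finset.range D, F d ≤ D * Fintype.card ι)
    (hs : ∑ j, r j < n0) : ∃ d < D, F d < (Finset.univ.filter fun j => r j ≤ d).card := by
  by_contra hcon
  push Not at hcon
  have h1 : ∑ d ∈ Finset.range D, (Finset.univ.filter fun j => r j ≤ d).card
      = ∑ j, (D - r j) := by
    simp_rw [Finset.card_filter]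
    rw [Finset.sum_comm]
    refine Finset.sum_congr rfl fun j _ => ?_
    rw [← Finset.card_filter]
    have : (Finset.range D).filter (fun d => r j ≤ d) = Finset.Ico (r j) D := by
      ext d; simp; omega
    rw [this, Nat.card_Ico]
  have h2 : ∑ d ∈ Finset.range D, (Finset.univ.filter fun j => r j ≤ d).card ≤
      ∑ d ∈ Finset.range D, F d :=
    Finset.sum_le_sum fun d hd => hcon d (Finset.mem_range.1 hd)
  have h3 : ∑ j, (D - r j) + ∑ j, r j = D * Fintype.card ι := by
    rw [← Finset.sum_add_distrib, Finset.sum_congr rfl (fun j _ => Nat.sub_add_cancel (hr j))]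
    simp [mul_comm]
  omega

theorem det_zero_of_span {ι : Type*} [Fintype ι] [DecidableEq ι] (B : Matrix ι ι ℂ)
    (J : Finset ι) (W : Finset (ι → ℂ)) (hJ : W.card < J.card)
    (h : ∀ j ∈ J, (fun i => B i j) ∈ Submodule.span ℂ (W : Set (ι → ℂ))) : B.det = 0 := by
  classical
  by_contra hdet
  have hli := Matrix.linearIndependent_cols_of_det_ne_zero hdet
  have h2 : LinearIndependent ℂ (fun j : J => B.col j) := hli.comp _ Subtype.val_injective
  have h3 := linearIndependent_le_span_aux' _ h2 (W : Set (ι → ℂ)) (by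
    rintro _ ⟨j, rfl⟩
    exact h j j.2)
  simp at h3
  omega


theorem span_mem {ι : Type*} (κ d : ℕ) (x y ω : ι → ℂ) (p q s : ℂ)
    (hy : ∀ i, y i = p * ω i + q * x i + s) (W : Set (ι → ℂ))
    (hW : ∀ a < κ, ∀ b < d + κ, (fun i => x i ^ a * ω i ^ b) ∈ W) (k2 : ℕ) :
    ∀ k1 n, k1 + k2 < κ → n + k2 < d + κ →
      (fun i => x i ^ k1 * y i ^ k2 * ω i ^ n) ∈ Submodule.span ℂ W := by
  induction k2 with
  | zero =>
    intro k1 n h1 h2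
    refine Submodule.subset_span ?_
    simpa using hW k1 (by omega) n (by omega)
  | succ k ih =>
    intro k1 n h1 h2
    have e : (fun i => x i ^ k1 * y i ^ (k + 1) * ω i ^ n) =
        p • (fun i => x i ^ k1 * y i ^ k * ω i ^ (n + 1)) +
        q • (fun i => x i ^ (k1 + 1) * y i ^ k * ω i ^ n) +
        s • (fun i => x i ^ k1 * y i ^ k * ω i ^ n) := by
      funext i
      simp only [Pi.add_apply, Pi.smul_apply, smul_eq_mul]
      have : y i ^ (k + 1) = y i ^ k * (p * ω i + q * x i + s) := by rw [pow_succ, ← hy i]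
      rw [this]; ring
    rw [e]
    refine Submodule.add_mem _ (Submodule.add_mem _ ?_ ?_) ?_ <;> refine Submodule.smul_mem _ _ ?_
    · exact ih _ _ (by omega) (by omega)
    · exact ih _ _ (by omega) (by omega)
    · exact ih _ _ (by omega) (by omega)

open Asymptotics Filter Topology in
theorem exp_expand (D : ℕ) (hD : 0 < D) (m a b : ℂ) :
    (fun z : ℂ => m * Complex.exp (a * z + b * z ^ D) -
      ∑ n ∈ Finset.range D, (m * a ^ n / (n.factorial : ℂ)) * z ^ n) =O[𝓝 0]
      (fun z : ℂ => z ^ D) := by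
  have h1 : (fun z : ℂ => Complex.exp (a * z) - ∑ n ∈ Finset.range D, (a * z) ^ n / (n.factorial : ℂ))
      =O[𝓝 0] (fun z : ℂ => z ^ D) := by
    have h := (Complex.exp_sub_sum_range_isBigO_pow D).comp_tendsto
      (k := fun z : ℂ => a * z) (l' := 𝓝 0) (by
        have : Continuous fun z : ℂ => a * z := by fun_prop
        simpa using this.tendsto 0)
    refine IsBigO.trans h ?_
    simp only [Function.comp_def, mul_pow]
    exact (isBigO_refl _ _).const_mul_left _
  have h2 : (fun z : ℂ => Complex.exp (b * z ^ D) - 1) =O[𝓝 0] (fun z : ℂ => z ^ D) := by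
    have h := (Complex.exp_sub_sum_range_isBigO_pow 1).comp_tendsto
      (k := fun z : ℂ => b * z ^ D) (l' := 𝓝 0) (by
        have : Continuous fun z : ℂ => b * z ^ D := by fun_prop
        simpa [hD.ne'] using this.tendsto 0)
    simp only [Function.comp_def, Finset.sum_range_one, pow_zero, Nat.factorial_zero, Nat.cast_one,
      div_one, pow_one] at h
    refine h.trans ?_
    exact (isBigO_refl _ _).const_mul_left _
  have h3 : (fun z : ℂ => Complex.exp (a * z) * (Complex.exp (b * z ^ D) - 1)) =O[𝓝 0]
      (fun z : ℂ => z ^ D) := by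
    have h4 : (fun z : ℂ => Complex.exp (a * z)) =O[𝓝 0] (fun _ : ℂ => (1 : ℂ)) := by
      have : Continuous fun z : ℂ => Complex.exp (a * z) := by fun_prop
      exact (this.tendsto 0).isBigO_one ℂ
    simpa using h4.mul h2
  have h5 := (h1.add h3).const_mul_left m
  refine h5.congr_left fun z => ?_
  rw [Complex.exp_add, mul_add, mul_sub, Finset.mul_sum]
  simp_rw [mul_pow]
  have : ∀ n, m * (a ^ n * z ^ n / (n.factorial : ℂ)) = m * a ^ n / (n.factorial : ℂ) * z ^ n := by
    intro n; ring
  simp_rw [this]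
  ring

theorem det_norm_le {ι : Type*} [Fintype ι] [DecidableEq ι] (A : Matrix ι ι ℂ) (c : ι → ℝ)
    (h : ∀ i j, ‖A i j‖ ≤ c j) : ‖A.det‖ ≤ (Fintype.card ι).factorial * ∏ j, c j := by
  rw [Matrix.det_apply']
  refine (norm_sum_le _ _).trans ?_
  have : ∀ σ ∈ (Finset.univ : Finset (Equiv.Perm ι)),
      ‖((Equiv.Perm.sign σ : ℤ) : ℂ) * ∏ i, A (σ i) i‖ ≤ ∏ j, c j := by
    intro σ _
    rw [norm_mul, norm_prod]
    have h1 : ‖((Equiv.Perm.sign σ : ℤ) : ℂ)‖ = 1 := by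
      rcases Int.units_eq_one_or (Equiv.Perm.sign σ) with h | h <;> simp [h]
    rw [h1, one_mul]
    exact Finset.prod_le_prod (fun _ _ => norm_nonneg _) (fun j _ => h _ j)
  refine (Finset.sum_le_card_nsmul _ _ _ this).trans ?_
  rw [Finset.card_univ, Fintype.card_perm, nsmul_eq_mul]

theorem det_analytic {ι : Type*} [Fintype ι] [DecidableEq ι] (D n0 κ : ℕ) (hD : 0 < D)
    (x y ω τ lam : ι → ℝ)
    (k1 k2 : ι → ℕ) (hk : ∀ j, k1 j + k2 j < κ) (p q s : ℝ)
    (hy : ∀ i, y i = p * ω i + q * x i + s)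
    (hn : n0 + ∑ d ∈ Finset.range D, κ * (d + κ) ≤ D * Fintype.card ι)
    (Xm Ym Ω ρ : ℝ) (hX : ∀ i, |x i| ≤ Xm) (hY : ∀ i, |y i| ≤ Ym) (hΩ : ∀ i, |ω i| ≤ Ω)
    (hρ : 1 ≤ ρ) (hτ : ∀ i, |τ i| * ρ ^ D ≤ 1) :
    |(Matrix.of fun i j => x i ^ k1 j * y i ^ k2 j * Real.exp (lam j * (ω i + τ i))).det| * ρ ^ n0 ≤
      (Fintype.card ι).factorial *
        ∏ j, (Xm ^ k1 j * Ym ^ k2 j * Real.exp (|lam j| * (ρ * Ω + 1))) := by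
  classical
  set h : ι → ι → ℂ → ℂ := fun i j z => ((x i : ℂ) ^ k1 j * (y i : ℂ) ^ k2 j) *
    Complex.exp (((lam j : ℂ) * ω i) * z + ((lam j : ℂ) * τ i) * z ^ D) with hh
  set f : ℂ → ℂ := fun z => (Matrix.of fun i j => h i j z).det with hf
  have hf1 : f 1 = (((Matrix.of fun i j =>
      x i ^ k1 j * y i ^ k2 j * Real.exp (lam j * (ω i + τ i))).det : ℝ) : ℂ) := by
    have := RingHom.map_det Complex.ofRealHom (Matrix.of fun i j =>
      x i ^ k1 j * y i ^ k2 j * Real.exp (lam j * (ω i + τ i)))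
    simp only [Complex.ofRealHom_eq_coe] at this
    rw [this]
    simp only [hf]
    congr 1
    ext i j
    simp only [hh, Matrix.of_apply, RingHom.mapMatrix_apply, Matrix.map_apply,
      Complex.ofRealHom_eq_coe]
    push_cast
    congr 2
    ring
  have hdiff : Differentiable ℂ f := by
    simp only [hf, Matrix.det_apply', Matrix.of_apply, hh]
    fun_prop
  have hO : f =O[nhds 0] (fun z : ℂ => z ^ n0) := by
    refine det_bigO D n0 h (fun j n i => ((x i : ℂ) ^ k1 j * (y i : ℂ) ^ k2 j) *
      ((lam j : ℂ) * ω i) ^ n / (n.factorial : ℂ)) ?_ ?_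
    · intro i j
      exact exp_expand D hD _ _ _
    · intro r hr hs B hB
      obtain ⟨d, hd, hlt⟩ := exists_level D (fun d => κ * (d + κ)) r hr n0 hn hs
      set W : Finset (ι → ℂ) := (Finset.range κ ×ˢ Finset.range (d + κ)).image
        (fun ab i => (x i : ℂ) ^ ab.1 * (ω i : ℂ) ^ ab.2) with hW
      refine det_zero_of_span B _ W (lt_of_le_of_lt ?_ hlt) ?_
      · refine Finset.card_image_le.trans ?_
        simp
      · intro j hj
        have hj' : r j ≤ d := by simpa using hj
        obtain ⟨c, hc⟩ := hB j (by omega)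
        have hm := span_mem κ d (fun i => (x i : ℂ)) (fun i => (y i : ℂ)) (fun i => (ω i : ℂ)) p q s
          (fun i => by rw [hy i]; push_cast; ring) (W : Set (ι → ℂ)) (by
            intro a ha b hb
            simp only [hW, Finset.coe_image, Set.mem_image, Finset.mem_coe, Finset.mem_product,
              Finset.mem_range]
            exact ⟨(a, b), ⟨ha, hb⟩, rfl⟩) (k2 j) (k1 j) (r j) (hk j) (by have := hk j; omega)
        have e : (fun i => B i j) = (c * (lam j : ℂ) ^ r j / ((r j).factorial : ℂ)) •
            (fun i => (x i : ℂ) ^ k1 j * (y i : ℂ) ^ k2 j * (ω i : ℂ) ^ r j) := by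
          funext i
          rw [hc i]
          simp only [Pi.smul_apply, smul_eq_mul]
          ring
        rw [e]
        exact Submodule.smul_mem _ _ hm
  have hb : ∀ z : ℂ, ‖z‖ = ρ → ‖f z‖ ≤ (Fintype.card ι).factorial *
        ∏ j, (Xm ^ k1 j * Ym ^ k2 j * Real.exp (|lam j| * (ρ * Ω + 1))) := by
    intro z hz
    refine det_norm_le _ _ fun i j => ?_
    simp only [Matrix.of_apply, hh]
    rw [norm_mul, norm_mul, norm_pow, norm_pow, Complex.norm_real, Complex.norm_real,
      Complex.norm_exp, Real.norm_eq_abs, Real.norm_eq_abs]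
    have hX0 : 0 ≤ Xm := (abs_nonneg _).trans (hX i)
    have hY0 : 0 ≤ Ym := (abs_nonneg _).trans (hY i)
    gcongr
    · exact hX i
    · exact hY i
    · refine (Complex.re_le_norm _).trans ?_
      refine (norm_add_le _ _).trans ?_
      rw [norm_mul, norm_mul, norm_mul, norm_mul, norm_pow, hz]
      simp only [Complex.norm_real, Real.norm_eq_abs]
      have h1 := hτ i
      have h2 := hΩ i
      have h3 : |lam j| * |ω i| * ρ ≤ |lam j| * Ω * ρ := by gcongr
      have h4 : |lam j| * (|τ i| * ρ ^ D) ≤ |lam j| * 1 := by gcongr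
      nlinarith
  have := schwarz_gen ρ hρ n0 f _ hdiff hO hb
  rwa [hf1, Complex.norm_real, Real.norm_eq_abs] at this


theorem sum_abs_lam (L : ℕ) : ∑ l ∈ Finset.range L, |2 * (l : ℝ) - ((L : ℝ) - 1)| ≤ (L : ℝ) ^ 2 / 2 := by
  induction L using Nat.twoStepInduction with
  | zero => simp
  | one => norm_num
  | more L ih _ =>
    rw [Finset.sum_range_succ, Finset.sum_range_succ']
    have h1 : ∑ l ∈ Finset.range L, |2 * ((l + 1 : ℕ) : ℝ) - (((L + 2 : ℕ) : ℝ) - 1)| =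
        ∑ l ∈ Finset.range L, |2 * (l : ℝ) - ((L : ℝ) - 1)| := by
      refine Finset.sum_congr rfl fun l _ => ?_
      congr 1; push_cast; ring
    rw [h1]
    have hL : (0 : ℝ) ≤ L := Nat.cast_nonneg L
    have h2 : |2 * ((0 : ℕ) : ℝ) - (((L + 2 : ℕ) : ℝ) - 1)| = L + 1 := by
      rw [abs_of_nonpos (by push_cast; linarith)]; push_cast; ring
    have h3 : |2 * ((L + 1 : ℕ) : ℝ) - (((L + 2 : ℕ) : ℝ) - 1)| = L + 1 := by
      rw [abs_of_nonneg (by push_cast; linarith)]; push_cast; ring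
    rw [h2, h3]; push_cast; nlinarith

theorem sum_lam (L : ℕ) : ∑ l ∈ Finset.range L, (2 * (l : ℝ) - ((L : ℝ) - 1)) = 0 := by
  have h := Finset.sum_range_id_mul_two L
  have h2 : (∑ l ∈ Finset.range L, (l : ℝ)) * 2 = L * ((L : ℝ) - 1) := by
    rcases Nat.eq_zero_or_pos L with h0 | h0
    · simp [h0]
    · have : (((∑ l ∈ Finset.range L, l) * 2 : ℕ) : ℝ) = ((L * (L - 1) : ℕ) : ℝ) := by rw [h]
      push_cast [Nat.cast_sub h0] at this
      exact this
  rw [Finset.sum_sub_distrib, ← Finset.mul_sum]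
  simp
  linarith

theorem sum_fin1 (L K1 K2 : ℕ) (f : ℕ → ℝ) :
    ∑ j : Fin L × Fin K1 × Fin K2, f (j.1 : ℕ) = K1 * K2 * ∑ l ∈ Finset.range L, f l := by
  rw [Fintype.sum_prod_type, Finset.sum_range, Finset.mul_sum]
  refine Finset.sum_congr rfl fun l _ => ?_
  simp

theorem sum_fin2 (L K1 K2 : ℕ) (f : ℕ → ℝ) :
    ∑ j : Fin L × Fin K1 × Fin K2, f (j.2.1 : ℕ) = L * K2 * ∑ l ∈ Finset.range K1, f l := by
  rw [Fintype.sum_prod_type]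
  simp only [Fintype.sum_prod_type, Finset.sum_const, Finset.card_univ, Fintype.card_fin,
    nsmul_eq_mul, ← Finset.mul_sum]
  rw [Finset.sum_range]; ring

theorem sum_fin3 (L K1 K2 : ℕ) (f : ℕ → ℝ) :
    ∑ j : Fin L × Fin K1 × Fin K2, f (j.2.2 : ℕ) = L * K1 * ∑ l ∈ Finset.range K2, f l := by
  rw [Fintype.sum_prod_type]
  simp only [Fintype.sum_prod_type, Finset.sum_const, Finset.card_univ, Fintype.card_fin,
    nsmul_eq_mul, ← Finset.mul_sum]
  rw [Finset.sum_range]; ring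

theorem sum_id_le (K : ℕ) : ∑ l ∈ Finset.range K, (l : ℝ) ≤ (K : ℝ) ^ 2 / 2 := by
  induction K with
  | zero => simp
  | succ n ih => rw [Finset.sum_range_succ]; push_cast; nlinarith

theorem det_norm_le' {ι : Type*} [Fintype ι] [DecidableEq ι] (A : Matrix ι ι ℂ) (a c : ι → ℝ)
    (h : ∀ i j, ‖A i j‖ ≤ a i * c j) :
    ‖A.det‖ ≤ (Fintype.card ι).factorial * ((∏ i, a i) * ∏ j, c j) := by
  rw [Matrix.det_apply']
  refine (norm_sum_le _ _).trans ?_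
  have : ∀ σ ∈ (Finset.univ : Finset (Equiv.Perm ι)),
      ‖((Equiv.Perm.sign σ : ℤ) : ℂ) * ∏ i, A (σ i) i‖ ≤ (∏ i, a i) * ∏ j, c j := by
    intro σ _
    rw [norm_mul, norm_prod]
    have h1 : ‖((Equiv.Perm.sign σ : ℤ) : ℂ)‖ = 1 := by
      rcases Int.units_eq_one_or (Equiv.Perm.sign σ) with h | h <;> simp [h]
    rw [h1, one_mul, ← Equiv.prod_comp σ a, ← Finset.prod_mul_distrib]
    exact Finset.prod_le_prod (fun _ _ => norm_nonneg _) (fun j _ => h _ j)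
  refine (Finset.sum_le_card_nsmul _ _ _ this).trans ?_
  rw [Finset.card_univ, Fintype.card_perm, nsmul_eq_mul]

theorem pow_exp_log {x : ℝ} (hx : 0 < x) (n : ℕ) : x ^ n = Real.exp (n * Real.log x) := by
  rw [mul_comm, ← Real.rpow_def_of_pos hx, Real.rpow_natCast]

theorem entry_exp (G U W z y : ℝ) (hG : 0 < G) (hU : 0 < U) (hW : 0 < W) (hz : 0 < z) (hy : 0 < y)
    (r s t l L : ℕ) (hl : l < L) :
    (G ^ (s * l) * U ^ (t * l) * W ^ (t * (L - 1 - l))) * (z ^ (r * l) * y ^ (t * (L - 1 - l))) =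
    Real.exp (((L : ℝ) - 1) / 2 * (r * Real.log z + s * Real.log G +
        t * (Real.log U + Real.log W + Real.log y)) +
      ((2 * (l : ℝ) - ((L : ℝ) - 1)) / 2) * (r * Real.log z + s * Real.log G +
        t * (Real.log U - Real.log W - Real.log y))) := by
  have hc : ((L - 1 - l : ℕ) : ℝ) = (L : ℝ) - 1 - l := by
    rw [Nat.sub_sub, Nat.cast_sub (by omega)]; push_cast; ring
  rw [pow_exp_log hG, pow_exp_log hU, pow_exp_log hW, pow_exp_log hz, pow_exp_log hy]
  rw [← Real.exp_add, ← Real.exp_add, ← Real.exp_add, ← Real.exp_add]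
  congr 1
  push_cast [hc]
  ring


/-- centered column exponent -/
noncomputable def lamc {L K1 K2 : ℕ} (j : Fin L × Fin K1 × Fin K2) : ℝ :=
  (2 * ((j.1 : ℕ) : ℝ) - ((L : ℝ) - 1)) / 2

theorem sum_lamc (L K1 K2 : ℕ) : ∑ j : Fin L × Fin K1 × Fin K2, lamc j = 0 := by
  have := sum_fin1 L K1 K2 (fun l => (2 * (l : ℝ) - ((L : ℝ) - 1)) / 2)
  unfold lamc
  rw [this, ← Finset.sum_div, sum_lam]; simp

theorem sum_abs_lamc (L K1 K2 : ℕ) :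
    ∑ j : Fin L × Fin K1 × Fin K2, |lamc j| ≤ (K1 * K2 * L : ℝ) * (L / 4) := by
  have := sum_fin1 L K1 K2 (fun l => |(2 * (l : ℝ) - ((L : ℝ) - 1)) / 2|)
  unfold lamc
  rw [this]
  have h2 : ∑ l ∈ Finset.range L, |(2 * (l : ℝ) - ((L : ℝ) - 1)) / 2| ≤ (L : ℝ) ^ 2 / 4 := by
    have h := sum_abs_lam L
    simp_rw [abs_div, ← Finset.sum_div]
    rw [show |(2 : ℝ)| = 2 by norm_num]
    linarith
  calc (K1 * K2 : ℝ) * _ ≤ (K1 * K2 : ℝ) * ((L : ℝ) ^ 2 / 4) := by gcongr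
    _ = _ := by ring

theorem real_det_bound (g u w b1 b2 L K1 K2 S T D n0 : ℕ) (hg : 2 ≤ g) (hu : 0 < u) (hw : 0 < w)
    (hD : 0 < D) (α : ℝ) (hα : 1.46 < α)
    (σ : Fin L × Fin K1 × Fin K2 → ℕ × ℕ × ℕ)
    (hσ : ∀ i, (σ i).1 < K1 ∧ (σ i).2.1 < S ∧ (σ i).2.2 < T)
    (Λ : ℝ) (hΛ : Λ = b1 * Real.log α - b2 * Real.log g +
      (Real.log u - Real.log w - Real.log (3 * α - 2)))
    (hsmall : T * |Λ| * 4 ^ D ≤ 1)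
    (hn : n0 + ∑ d ∈ Finset.range D, (K1 + K2) * (d + (K1 + K2)) ≤ D * (L * (K1 * K2)))
    (Xm Ym Hl : ℝ) (hX : (K1 : ℝ) + T * b1 ≤ Xm) (hY : (S : ℝ) + T * b2 ≤ Ym)
    (hHl : |Real.log u - Real.log w - Real.log (3 * α - 2)| ≤ Hl) :
    |(Matrix.of fun i j => Polynomial.aeval α (entP g u w b1 b2 L K1 K2 (σ i) j)).det| * 4 ^ n0 ≤
      ((L * (K1 * K2)).factorial : ℝ) *
      (Real.exp (∑ i, (((L : ℝ) - 1) / 2 * ((σ i).1 * Real.log α + (σ i).2.1 * Real.log g +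
          (σ i).2.2 * (Real.log u + Real.log w + Real.log (3 * α - 2))))) *
       ((∏ j : Fin L × Fin K1 × Fin K2, (Xm ^ (j.2.1 : ℕ) * Ym ^ (j.2.2 : ℕ))) *
        Real.exp ((∑ j : Fin L × Fin K1 × Fin K2, |lamc j|) *
          (4 * (K1 * Real.log α / 2 + S * Real.log g + T * Hl + 1) + 1)))) := by
  set A := Real.log α with hA
  set γ := Real.log g with hγ
  set l3 := Real.log u - Real.log w - Real.log (3 * α - 2) with hl3
  have hA0 : 0 ≤ A := Real.log_nonneg (by linarith)
  have hγ0 : 0 < γ := Real.log_pos (by exact_mod_cast hg)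
  have hpow : (1 : ℝ) ≤ 4 ^ D := one_le_pow₀ (by norm_num)
  set x : Fin L × Fin K1 × Fin K2 → ℝ := fun i => ((σ i).1 : ℝ) - (σ i).2.2 * b1 with hx
  set y : Fin L × Fin K1 × Fin K2 → ℝ := fun i => ((σ i).2.1 : ℝ) + (σ i).2.2 * b2 with hy
  set r0 : ℝ := ((K1 : ℝ) - 1) / 2 with hr0
  set ω : Fin L × Fin K1 × Fin K2 → ℝ := fun i => x i * A + y i * γ - r0 * A with hω
  set τ : Fin L × Fin K1 × Fin K2 → ℝ := fun i => (σ i).2.2 * Λ with hτ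
  have hTt : ∀ i, ((σ i).2.2 : ℝ) ≤ T := fun i => by exact_mod_cast (hσ i).2.2.le
  have hSs : ∀ i, ((σ i).2.1 : ℝ) ≤ S := fun i => by exact_mod_cast (hσ i).2.1.le
  have hRr : ∀ i, ((σ i).1 : ℝ) + 1 ≤ K1 := fun i => by exact_mod_cast (hσ i).1
  have hτb : ∀ i, |τ i| * 4 ^ D ≤ 1 := by
    intro i
    refine le_trans ?_ hsmall
    simp only [hτ, abs_mul, Nat.abs_cast]
    gcongr
    exact (hσ i).2.2.le
  have hτ1 : ∀ i, |τ i| ≤ 1 := fun i =>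
    le_trans (by nlinarith [abs_nonneg (τ i)]) (hτb i)
  have hωe : ∀ i, ω i = ((σ i).1 - r0) * A + (σ i).2.1 * γ + (σ i).2.2 * l3 - τ i := by
    intro i
    simp only [hω, hx, hy, hτ, hΛ]; ring
  have hr0b : ∀ i, |((σ i).1 : ℝ) - r0| ≤ K1 / 2 := by
    intro i
    have h1 := hRr i
    have h2 : (0 : ℝ) ≤ (σ i).1 := Nat.cast_nonneg _
    rw [abs_le]; constructor <;> simp only [hr0] <;> linarith
  have key := det_analytic D n0 (K1 + K2) hD x y ω τ lamc (fun j => (j.2.1 : ℕ)) (fun j => (j.2.2 : ℕ))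
    (fun j => by have := j.2.1.2; have := j.2.2.2; omega) (1 / γ) (-(A / γ)) (r0 * A / γ)
    (by intro i; simp only [hω]; field_simp; ring)
    (by simpa using hn) Xm Ym (K1 * A / 2 + S * γ + T * Hl + 1) 4
    (by
      intro i
      have h1 := hRr i
      have h2 : (0 : ℝ) ≤ (σ i).1 := Nat.cast_nonneg _
      have h3 : ((σ i).2.2 : ℝ) * b1 ≤ T * b1 := by gcongr; exact (hσ i).2.2.le
      have h4 : (0 : ℝ) ≤ (σ i).2.2 * b1 := by positivity
      rw [abs_le]; constructor <;> simp only [hx] <;> linarith)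
    (by
      intro i
      have h3 : ((σ i).2.2 : ℝ) * b2 ≤ T * b2 := by gcongr; exact (hσ i).2.2.le
      have h5 := hSs i
      rw [abs_of_nonneg (by simp only [hy]; positivity)]
      simp only [hy]; linarith)
    (by
      intro i
      rw [hωe i]
      have e1 : |(((σ i).1 : ℝ) - r0) * A| ≤ K1 * A / 2 := by
        rw [abs_mul, abs_of_nonneg hA0]
        have := mul_le_mul_of_nonneg_right (hr0b i) hA0
        linarith
      have e2 : |((σ i).2.1 : ℝ) * γ| ≤ S * γ := by
        rw [abs_of_nonneg (by positivity)]
        exact mul_le_mul_of_nonneg_right (hSs i) hγ0.le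
      have e3 : |((σ i).2.2 : ℝ) * l3| ≤ T * Hl := by
        rw [abs_mul, Nat.abs_cast]
        gcongr
        exact (hσ i).2.2.le
      have e4 := hτ1 i
      calc _ ≤ _ := abs_sub _ _
        _ ≤ |(((σ i).1 : ℝ) - r0) * A| + |((σ i).2.1 : ℝ) * γ| + |((σ i).2.2 : ℝ) * l3| + |τ i| := by
            gcongr; exact abs_add_three _ _ _
        _ ≤ _ := by linarith)
    (by norm_num) hτb
  set M' : Matrix (Fin L × Fin K1 × Fin K2) (Fin L × Fin K1 × Fin K2) ℝ := Matrix.of fun i j =>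
    x i ^ (j.2.1 : ℕ) * y i ^ (j.2.2 : ℕ) * Real.exp (lamc j * (ω i + τ i)) with hM'
  set a : Fin L × Fin K1 × Fin K2 → ℝ := fun i =>
    Real.exp (((L : ℝ) - 1) / 2 * ((σ i).1 * A + (σ i).2.1 * γ +
          (σ i).2.2 * (Real.log u + Real.log w + Real.log (3 * α - 2)))) with ha
  set c : Fin L × Fin K1 × Fin K2 → ℝ := fun j => Real.exp (lamc j * (r0 * A)) with hc
  have hmat : (Matrix.of fun i j => Polynomial.aeval α (entP g u w b1 b2 L K1 K2 (σ i) j)) =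
      Matrix.of fun i j => a i * (Matrix.of fun i j => c j * M' i j) i j := by
    ext i j
    simp only [Matrix.of_apply]
    rw [entP_aeval, mul_assoc, entry_exp (g : ℝ) u w α (3 * α - 2) (by positivity) (by positivity)
      (by positivity) (by linarith) (by linarith) _ _ _ _ _ j.1.2]
    simp only [hM', ha, hc, Matrix.of_apply]
    rw [show (((((σ i).1 : ℤ) - ((σ i).2.2 : ℤ) * b1 : ℤ)) : ℝ) = x i by simp [hx],
      show (((((σ i).2.1 : ℤ) + ((σ i).2.2 : ℤ) * b2 : ℤ)) : ℝ) = y i by simp [hy]]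
    have : ∀ P e1 e2 e3 : ℝ, Real.exp e1 * (Real.exp e2 * (P * Real.exp e3)) =
        P * Real.exp (e1 + (e2 + e3)) := by
      intro P e1 e2 e3; rw [Real.exp_add, Real.exp_add]; ring
    rw [this]
    congr 2
    rw [hωe i]
    unfold lamc
    ring
  rw [hmat, Matrix.det_mul_column, Matrix.det_mul_row]
  have hc1 : ∏ j, c j = 1 := by
    simp only [hc]
    rw [← Real.exp_sum, ← Finset.sum_mul, sum_lamc, zero_mul, Real.exp_zero]
  have ha1 : ∏ i, a i = Real.exp (∑ i, (((L : ℝ) - 1) / 2 * ((σ i).1 * A + (σ i).2.1 * γ +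
          (σ i).2.2 * (Real.log u + Real.log w + Real.log (3 * α - 2))))) := by
    rw [Real.exp_sum]
  rw [hc1, one_mul, abs_mul, ha1, abs_of_pos (Real.exp_pos _)]
  rw [Finset.prod_mul_distrib, ← Real.exp_sum, ← Finset.sum_mul] at key
  simp only [Fintype.card_prod, Fintype.card_fin] at key
  calc _ = Real.exp (∑ i, (((L : ℝ) - 1) / 2 * ((σ i).1 * A + (σ i).2.1 * γ +
          (σ i).2.2 * (Real.log u + Real.log w + Real.log (3 * α - 2))))) * (|M'.det| * 4 ^ n0) := by ring
    _ ≤ _ := mul_le_mul_of_nonneg_left key (Real.exp_pos _).le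
    _ = _ := by ring

theorem conj_det_bound (g u w b1 b2 L K1 K2 S T : ℕ) (hg : 2 ≤ g) (hu : 0 < u) (hw : 0 < w)
    (A q : ℝ) (hA0 : 0 ≤ A) (β : ℂ) (hβ : 0 < ‖β‖) (hβ3 : 0 < ‖3 * β - 2‖)
    (hβl : Real.log ‖β‖ = -A / 2)
    (hql : Real.log ‖3 * β - 2‖ = q)
    (σ : Fin L × Fin K1 × Fin K2 → ℕ × ℕ × ℕ)
    (hσ : ∀ i, (σ i).1 < K1 ∧ (σ i).2.1 < S ∧ (σ i).2.2 < T)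
    (Xm Ym Hl : ℝ) (hX : (K1 : ℝ) + T * b1 ≤ Xm) (hY : (S : ℝ) + T * b2 ≤ Ym)
    (hHl : |Real.log u - Real.log w - q| ≤ Hl) :
    ‖(Matrix.of fun i j => Polynomial.aeval β (entP g u w b1 b2 L K1 K2 (σ i) j)).det‖ ≤
      ((L * (K1 * K2)).factorial : ℝ) *
      (Real.exp (∑ i, (((L : ℝ) - 1) / 2 * ((σ i).1 * (-A / 2) + (σ i).2.1 * Real.log g +
          (σ i).2.2 * (Real.log u + Real.log w + q)))) *
       ((∏ j : Fin L × Fin K1 × Fin K2, (Xm ^ (j.2.1 : ℕ) * Ym ^ (j.2.2 : ℕ))) *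
        Real.exp ((∑ j : Fin L × Fin K1 × Fin K2, |lamc j|) *
          (K1 * A / 4 + S * Real.log g + T * Hl)))) := by
  set γ := Real.log g with hγ
  set l3 := Real.log u - Real.log w - q with hl3
  have hγ0 : 0 < γ := Real.log_pos (by exact_mod_cast hg)
  set r0 : ℝ := ((K1 : ℝ) - 1) / 2 with hr0
  have hTt : ∀ i, ((σ i).2.2 : ℝ) ≤ T := fun i => by exact_mod_cast (hσ i).2.2.le
  have hSs : ∀ i, ((σ i).2.1 : ℝ) ≤ S := fun i => by exact_mod_cast (hσ i).2.1.le
  have hRr : ∀ i, ((σ i).1 : ℝ) + 1 ≤ K1 := fun i => by exact_mod_cast (hσ i).1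
  have hr0b : ∀ i, |((σ i).1 : ℝ) - r0| ≤ K1 / 2 := by
    intro i
    have h1 := hRr i
    have h2 : (0 : ℝ) ≤ (σ i).1 := Nat.cast_nonneg _
    rw [abs_le]; constructor <;> simp only [hr0] <;> linarith
  set a : Fin L × Fin K1 × Fin K2 → ℝ := fun i =>
    Real.exp (((L : ℝ) - 1) / 2 * ((σ i).1 * (-A / 2) + (σ i).2.1 * γ +
          (σ i).2.2 * (Real.log u + Real.log w + q))) with ha
  set c : Fin L × Fin K1 × Fin K2 → ℝ := fun j => Real.exp (lamc j * (r0 * (-A / 2))) with hc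
  set Ω' : ℝ := K1 * A / 4 + S * γ + T * Hl with hΩ'
  have key := det_norm_le'
    (Matrix.of fun i j => Polynomial.aeval β (entP g u w b1 b2 L K1 K2 (σ i) j)) a
    (fun j => c j * (Xm ^ (j.2.1 : ℕ) * Ym ^ (j.2.2 : ℕ) * Real.exp (|lamc j| * Ω'))) (by
      intro i j
      have hX' : |((σ i).1 : ℝ) - (σ i).2.2 * b1| ≤ Xm := by
        have h1 := hRr i
        have h2 : (0 : ℝ) ≤ (σ i).1 := Nat.cast_nonneg _
        have h3 : ((σ i).2.2 : ℝ) * b1 ≤ T * b1 := by gcongr; exact (hσ i).2.2.le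
        have h4 : (0 : ℝ) ≤ (σ i).2.2 * b1 := by positivity
        rw [abs_le]; constructor <;> linarith
      have hY' : |((σ i).2.1 : ℝ) + (σ i).2.2 * b2| ≤ Ym := by
        have h3 : ((σ i).2.2 : ℝ) * b2 ≤ T * b2 := by gcongr; exact (hσ i).2.2.le
        have h5 := hSs i
        rw [abs_of_nonneg (by positivity)]
        linarith
      have hX0 : 0 ≤ Xm := (abs_nonneg _).trans hX'
      have hY0 : 0 ≤ Ym := (abs_nonneg _).trans hY'
      have hω : |(((σ i).1 : ℝ) - r0) * (-A / 2) + (σ i).2.1 * γ + (σ i).2.2 * l3| ≤ Ω' := by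
        have e1 : |(((σ i).1 : ℝ) - r0) * (-A / 2)| ≤ K1 * A / 4 := by
          rw [abs_mul, abs_of_nonpos (by linarith : -A / 2 ≤ 0)]
          have := mul_le_mul_of_nonneg_right (hr0b i) hA0
          linarith
        have e2 : |((σ i).2.1 : ℝ) * γ| ≤ S * γ := by
          rw [abs_of_nonneg (by positivity)]
          exact mul_le_mul_of_nonneg_right (hSs i) hγ0.le
        have e3 : |((σ i).2.2 : ℝ) * l3| ≤ T * Hl := by
          rw [abs_mul, Nat.abs_cast]
          gcongr
          exact (hσ i).2.2.le
        refine (abs_add_three _ _ _).trans ?_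
        linarith
      simp only [Matrix.of_apply]
      rw [entP_aeval, norm_mul, norm_mul, norm_mul, norm_mul, norm_mul, norm_mul]
      simp only [norm_pow]
      rw [show ‖(((((σ i).1 : ℤ) - ((σ i).2.2 : ℤ) * b1 : ℤ)) : ℂ)‖ =
          |((σ i).1 : ℝ) - (σ i).2.2 * b1| by
            rw [Complex.norm_intCast]; push_cast; rfl,
        show ‖(((((σ i).2.1 : ℤ) + ((σ i).2.2 : ℤ) * b2 : ℤ)) : ℂ)‖ =
          |((σ i).2.1 : ℝ) + (σ i).2.2 * b2| by
            rw [Complex.norm_intCast]; push_cast; rfl]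
      rw [Complex.norm_natCast, Complex.norm_natCast, Complex.norm_natCast]
      have he := entry_exp (g : ℝ) u w ‖β‖ ‖3 * β - 2‖ (by positivity) (by positivity)
        (by positivity) hβ hβ3 (σ i).1 (σ i).2.1 (σ i).2.2 j.1 L j.1.2
      rw [mul_assoc, he, hβl, hql]
      have hexp : ((L : ℝ) - 1) / 2 * ((σ i).1 * (-A / 2) + (σ i).2.1 * Real.log g +
          (σ i).2.2 * (Real.log u + Real.log w + q)) +
          (2 * ((j.1 : ℕ) : ℝ) - ((L : ℝ) - 1)) / 2 * ((σ i).1 * (-A / 2) + (σ i).2.1 * Real.log g +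
          (σ i).2.2 * (Real.log u - Real.log w - q)) ≤
          ((L : ℝ) - 1) / 2 * ((σ i).1 * (-A / 2) + (σ i).2.1 * γ +
          (σ i).2.2 * (Real.log u + Real.log w + q)) + lamc j * (r0 * (-A / 2)) + |lamc j| * Ω' := by
        have h7 : lamc j * ((((σ i).1 : ℝ) - r0) * (-A / 2) + (σ i).2.1 * γ + (σ i).2.2 * l3) ≤
            |lamc j| * Ω' := by
          refine (le_abs_self _).trans ?_
          rw [abs_mul]
          gcongr
        have h8 : (2 * ((j.1 : ℕ) : ℝ) - ((L : ℝ) - 1)) / 2 = lamc j := rfl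
        rw [h8]
        linarith
      have hexp2 := Real.exp_le_exp.2 hexp
      calc _ ≤ (Xm ^ (j.2.1 : ℕ) * Ym ^ (j.2.2 : ℕ)) * _ := by
            refine mul_le_mul ?_ hexp2 (Real.exp_pos _).le (by positivity)
            gcongr
        _ = _ := by simp only [ha, hc]; rw [Real.exp_add, Real.exp_add]; ring)
  have hc1 : ∏ j, c j = 1 := by
    simp only [hc]
    rw [← Real.exp_sum, ← Finset.sum_mul, sum_lamc, zero_mul, Real.exp_zero]
  have ha1 : ∏ i, a i = Real.exp (∑ i, (((L : ℝ) - 1) / 2 * ((σ i).1 * (-A / 2) + (σ i).2.1 * γ +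
          (σ i).2.2 * (Real.log u + Real.log w + q)))) := by
    rw [Real.exp_sum]
  have he1 : ∏ j : Fin L × Fin K1 × Fin K2, Real.exp (|lamc j| * Ω') =
      Real.exp ((∑ j : Fin L × Fin K1 × Fin K2, |lamc j|) * Ω') := by
    rw [← Real.exp_sum, Finset.sum_mul]
  rw [Finset.prod_mul_distrib, hc1, one_mul, Finset.prod_mul_distrib, he1, ha1] at key
  simpa only [Fintype.card_prod, Fintype.card_fin] using key


theorem combine_exp (Δ Δ' F P a1 a2 b1 b2 : ℝ) (n0 : ℕ) (hΔ' : 0 ≤ Δ') (hF : 0 < F)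
    (hP : 0 < P)
    (h : 1 ≤ Δ * Δ' ^ 2) (h1 : Δ * 4 ^ n0 ≤ F * (Real.exp a1 * (P * Real.exp b1)))
    (h2 : Δ' ≤ F * (Real.exp a2 * (P * Real.exp b2))) :
    n0 * Real.log 4 ≤ 3 * Real.log F + 3 * Real.log P + (a1 + 2 * a2) + (b1 + 2 * b2) := by
  have e1 : ∀ a b : ℝ, F * (Real.exp a * (P * Real.exp b)) =
      Real.exp (Real.log F + Real.log P + a + b) := by
    intro a b
    rw [Real.exp_add, Real.exp_add, Real.exp_add, Real.exp_log hF, Real.exp_log hP]; ring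
  rw [e1] at h1 h2
  have h3 : (4 : ℝ) ^ n0 = Real.exp (n0 * Real.log 4) := pow_exp_log (by norm_num) n0
  have h4 : (4 : ℝ) ^ n0 ≤ Real.exp (Real.log F + Real.log P + a1 + b1) *
      (Real.exp (Real.log F + Real.log P + a2 + b2)) ^ 2 := by
    calc (4 : ℝ) ^ n0 = 1 * 4 ^ n0 := by ring
      _ ≤ (Δ * Δ' ^ 2) * 4 ^ n0 := by gcongr
      _ = (Δ * 4 ^ n0) * Δ' ^ 2 := by ring
      _ ≤ _ := by gcongr
  rw [h3, ← Real.exp_nat_mul, ← Real.exp_add] at h4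
  have h5 := Real.exp_le_exp.1 h4
  push_cast at h5
  linarith

theorem alpha_facts (α : ℝ) (hα : 1.46 < α) (hα2 : α < 1.4656) (h3 : α ^ 3 = α ^ 2 + 1) (β : ℂ)
    (hs : β + (starRingEnd ℂ) β = 1 - (α : ℂ))
    (hp : β * (starRingEnd ℂ) β = (α : ℂ) ^ 2 - α) :
    0 < ‖β‖ ∧ 0 < ‖3 * β - 2‖ ∧ Real.log ‖β‖ = - Real.log α / 2 ∧
      Real.log ‖3 * β - 2‖ = (Real.log 31 - Real.log (3 * α - 2)) / 2 ∧
      Real.log α ≤ 0.4 ∧ 0 < Real.log (3 * α - 2) ∧ Real.log (3 * α - 2) ≤ 1 ∧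
      3.4 ≤ Real.log 31 ∧ Real.log 31 ≤ 3.5 := by
  have hb2 : ‖β‖ ^ 2 = α ^ 2 - α := by
    have := Complex.mul_conj β
    rw [hp, Complex.normSq_eq_norm_sq] at this
    exact_mod_cast this.symm
  have hb3 : ‖3 * β - 2‖ ^ 2 = 9 * α ^ 2 - 3 * α - 2 := by
    have h := Complex.mul_conj (3 * β - 2)
    rw [Complex.normSq_eq_norm_sq] at h
    have h' : (3 * β - 2) * (starRingEnd ℂ) (3 * β - 2) = ((9 * α ^ 2 - 3 * α - 2 : ℝ) : ℂ) := by
      have e : (3 * β - 2) * (starRingEnd ℂ) (3 * β - 2) =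
          9 * (β * (starRingEnd ℂ) β) - 6 * (β + (starRingEnd ℂ) β) + 4 := by
        simp only [map_sub, map_mul]
        have h3 : (starRingEnd ℂ) (3 : ℂ) = 3 := Complex.conj_ofNat 3
        have h2 : (starRingEnd ℂ) (2 : ℂ) = 2 := Complex.conj_ofNat 2
        rw [h3, h2]; ring
      rw [e, hs, hp]; push_cast; ring
    rw [h'] at h
    exact_mod_cast h.symm
  have p1 : 0 < ‖β‖ := by
    by_contra hcon
    have : ‖β‖ = 0 := le_antisymm (not_lt.1 hcon) (norm_nonneg _)
    rw [this] at hb2; nlinarith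
  have p2 : 0 < ‖3 * β - 2‖ := by
    by_contra hcon
    have : ‖3 * β - 2‖ = 0 := le_antisymm (not_lt.1 hcon) (norm_nonneg _)
    rw [this] at hb3; nlinarith
  refine ⟨p1, p2, ?_, ?_, ?_, ?_, ?_, ?_, ?_⟩
  · have h1 : α * ‖β‖ ^ 2 = 1 := by rw [hb2]; nlinarith
    have h2 := congrArg Real.log h1
    rw [Real.log_mul (by linarith) (by positivity), Real.log_pow, Real.log_one] at h2
    push_cast at h2; linarith
  · have h1 : (3 * α - 2) * ‖3 * β - 2‖ ^ 2 = 31 := by rw [hb3]; nlinarith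
    have h2 := congrArg Real.log h1
    rw [Real.log_mul (by linarith) (by positivity), Real.log_pow] at h2
    push_cast at h2; linarith
  · rw [Real.log_le_iff_le_exp (by linarith)]
    have := Real.sum_le_exp_of_nonneg (show (0 : ℝ) ≤ 0.4 by norm_num) 4
    norm_num [Finset.sum_range_succ, Nat.factorial] at this
    norm_num
    linarith
  · exact Real.log_pos (by linarith)
  · rw [Real.log_le_iff_le_exp (by linarith)]
    have := Real.exp_one_gt_d9; norm_num at this ⊢; linarith
  · rw [Real.le_log_iff_exp_le (by norm_num)]
    have h := Real.exp_one_lt_d9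
    have h5 : Real.exp 3.4 ^ 5 = Real.exp 1 ^ 17 := by
      rw [← Real.exp_nat_mul, ← Real.exp_nat_mul]; norm_num
    have h6 : Real.exp 1 ^ 17 ≤ (2.7182818286 : ℝ) ^ 17 := by gcongr
    have h7 : (2.7182818286 : ℝ) ^ 17 ≤ 31 ^ 5 := by norm_num
    rw [← h5] at h6
    exact le_of_pow_le_pow_left₀ (by norm_num) (by norm_num) (h6.trans h7)
  · rw [Real.log_le_iff_le_exp (by norm_num)]
    have h := Real.exp_one_gt_d9
    have h5 : Real.exp 3.5 ^ 2 = Real.exp 1 ^ 7 := by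
      rw [← Real.exp_nat_mul, ← Real.exp_nat_mul]; norm_num
    have h6 : (2.7182818283 : ℝ) ^ 7 ≤ Real.exp 1 ^ 7 := by gcongr
    have h7 : (31 : ℝ) ^ 2 ≤ (2.7182818283 : ℝ) ^ 7 := by norm_num
    rw [← h5] at h6
    exact le_of_pow_le_pow_left₀ (by norm_num) (Real.exp_pos _).le (h7.trans h6)

/-- logarithmic form of the fundamental inequality -/
theorem ineqI (p : ℕ) [Fact p.Prime] (g u w' D0 b1 b2 L K1 K2 S S' T n e D n0 : ℕ)
    (hL : 0 < L) (hK1 : 0 < K1) (hK2' : 0 < K2) (hpg : p ∣ g) (hg2 : 2 ≤ g)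
    (hu : Nat.Coprime p u) (hw' : Nat.Coprime p w') (hu0 : 0 < u) (hw0 : 0 < w') (hD0 : 1 ≤ D0)
    (hS' : 1 ≤ S') (hT : 0 < T) (hb2 : S' ≤ b2) (hn : b2 * T + S' ≤ n) (hK2 : K2 ≤ S' * T)
    (he : 31 * D0 * n ≤ 2 ^ e) (hS : 2 * (S' + T * e + 1) * (L - 1) + S' ≤ S)
    (hD : 0 < D)
    (α : ℝ) (hα : 1.46 < α) (hα2 : α < 1.4656) (h3 : α ^ 3 = α ^ 2 + 1) (β : ℂ)
    (hβ : β ^ 3 = β ^ 2 + 1)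
    (hs : β + (starRingEnd ℂ) β = 1 - (α : ℂ))
    (hp : β * (starRingEnd ℂ) β = (α : ℂ) ^ 2 - α)
    (hsmall : T * |b1 * Real.log α - b2 * Real.log g +
      (Real.log u - Real.log (D0 * w' : ℕ) - Real.log (3 * α - 2))| * 4 ^ D ≤ 1)
    (hn0 : n0 + ∑ d ∈ Finset.range D, (K1 + K2) * (d + (K1 + K2)) ≤ D * (L * (K1 * K2)))
    (B H : ℝ) (hB : 0 ≤ B) (hX : (K1 : ℝ) + T * b1 ≤ Real.exp B)
    (hY : (S : ℝ) + T * b2 ≤ Real.exp B)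
    (hHu : Real.log u ≤ H) (hHw : Real.log (D0 * w' : ℕ) ≤ H) :
    (n0 : ℝ) * Real.log 4 ≤ (K1 * K2 * L : ℝ) * (3 * Real.log (L * (K1 * K2)) +
      3 * B * (K1 + K2) / 2 +
      (L / 4) * (4 * (K1 * 0.4 / 2 + S * Real.log g + T * (H + 1) + 1) + 1 +
        2 * (K1 * 0.4 / 4 + S * Real.log g + T * (H + 2))) +
      (L / 2) * (3 * (S * Real.log g) + T * (6 * H + 3.5))) := by
  obtain ⟨p1, p2, lb, lq, lA, l31, l32, l33, l34⟩ := alpha_facts α hα hα2 h3 β hs hp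
  obtain ⟨σ, hσ, hdet⟩ := main_minor p g u w' D0 b1 b2 L K1 K2 S S' T n e hL hK1 hK2' hpg hg2 hu hw'
    hD0 hS' hT hb2 hn hK2 he hS α h3 β hβ hs hp
  have hA0 : 0 ≤ Real.log α := Real.log_nonneg (by linarith)
  have hγ0 : 0 ≤ Real.log g := Real.log_nonneg (by exact_mod_cast (by omega : 1 ≤ g))
  have hu1 : 0 ≤ Real.log u := Real.log_nonneg (by exact_mod_cast hu0)
  have hw1' : 0 < D0 * w' := Nat.mul_pos hD0 hw0
  have hw1 : 0 ≤ Real.log (D0 * w' : ℕ) := Real.log_nonneg (by exact_mod_cast hw1')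
  have hHl1 : |Real.log u - Real.log (D0 * w' : ℕ) - Real.log (3 * α - 2)| ≤ H + 1 := by
    rw [abs_le]; constructor <;> linarith
  have hHl2 : |Real.log u - Real.log (D0 * w' : ℕ) - (Real.log 31 - Real.log (3 * α - 2)) / 2|
      ≤ H + 2 := by
    rw [abs_le]; constructor <;> linarith
  have R := real_det_bound g u (D0 * w') b1 b2 L K1 K2 S T D n0 hg2 hu0 hw1' hD α hα σ hσ _ rfl
    hsmall hn0 (Real.exp B) (Real.exp B) (H + 1) hX hY hHl1
  have C := conj_det_bound g u (D0 * w') b1 b2 L K1 K2 S T hg2 hu0 hw1' (Real.log α) _ hA0 β p1 p2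
    lb lq σ hσ (Real.exp B) (Real.exp B) (H + 2) hX hY hHl2
  have hP0 : 0 < ∏ j : Fin L × Fin K1 × Fin K2,
      (Real.exp B ^ (j.2.1 : ℕ) * Real.exp B ^ (j.2.2 : ℕ)) :=
    Finset.prod_pos fun j _ => by positivity
  have hI := combine_exp _ _ _ _ _ _ _ _ n0 (norm_nonneg _)
    (by exact_mod_cast Nat.factorial_pos _) hP0 hdet R C
  refine hI.trans ?_
  have t1 : Real.log ((L * (K1 * K2)).factorial : ℝ) ≤
      (K1 * K2 * L : ℝ) * Real.log (L * (K1 * K2)) := by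
    have h1 : (((L * (K1 * K2)).factorial : ℕ) : ℝ) ≤ ((L * (K1 * K2) : ℕ) : ℝ) ^ (L * (K1 * K2)) := by
      exact_mod_cast Nat.factorial_le_pow _
    have h2 := Real.log_le_log (by exact_mod_cast Nat.factorial_pos _) h1
    rw [Real.log_pow] at h2
    push_cast at h2
    calc _ ≤ _ := h2
      _ = _ := by ring
  have t2 : Real.log (∏ j : Fin L × Fin K1 × Fin K2,
      (Real.exp B ^ (j.2.1 : ℕ) * Real.exp B ^ (j.2.2 : ℕ))) ≤
      (K1 * K2 * L : ℝ) * (B * (K1 + K2) / 2) := by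
    have h1 : ∏ j : Fin L × Fin K1 × Fin K2,
      (Real.exp B ^ (j.2.1 : ℕ) * Real.exp B ^ (j.2.2 : ℕ)) =
        Real.exp (∑ j : Fin L × Fin K1 × Fin K2, (((j.2.1 : ℕ) : ℝ) + ((j.2.2 : ℕ) : ℝ)) * B) := by
      rw [Real.exp_sum]
      refine Finset.prod_congr rfl fun j _ => ?_
      rw [← Real.exp_nat_mul, ← Real.exp_nat_mul, ← Real.exp_add]
      congr 1; ring
    rw [h1, Real.log_exp, ← Finset.sum_mul, Finset.sum_add_distrib,
      sum_fin2 L K1 K2 (fun n => (n : ℝ)), sum_fin3 L K1 K2 (fun n => (n : ℝ))]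
    have h2 := sum_id_le K1
    have h3 := sum_id_le K2
    calc _ ≤ ((L : ℝ) * K2 * ((K1 : ℝ) ^ 2 / 2) + L * K1 * ((K2 : ℝ) ^ 2 / 2)) * B := by gcongr
      _ = _ := by ring
  have hS0 : (0 : ℝ) ≤ S := Nat.cast_nonneg _
  have hT0 : (0 : ℝ) ≤ T := Nat.cast_nonneg _
  have hL1 : (1 : ℝ) ≤ L := by exact_mod_cast hL
  have hH0 : 0 ≤ H := hu1.trans hHu
  have t3 : (∑ i, (((L : ℝ) - 1) / 2 * ((σ i).1 * Real.log α + (σ i).2.1 * Real.log g +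
          (σ i).2.2 * (Real.log u + Real.log (D0 * w' : ℕ) + Real.log (3 * α - 2))))) +
      2 * (∑ i, (((L : ℝ) - 1) / 2 * ((σ i).1 * (-Real.log α / 2) + (σ i).2.1 * Real.log g +
          (σ i).2.2 * (Real.log u + Real.log (D0 * w' : ℕ) +
            (Real.log 31 - Real.log (3 * α - 2)) / 2)))) ≤
      (K1 * K2 * L : ℝ) * ((L / 2) * (3 * (S * Real.log g) + T * (6 * H + 3.5))) := by
    rw [Finset.mul_sum, ← Finset.sum_add_distrib]
    refine (Finset.sum_le_card_nsmul _ _ ((L / 2 : ℝ) * (3 * (S * Real.log g) + T * (6 * H + 3.5)))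
      ?_).trans ?_
    · intro i _
      have hTt : ((σ i).2.2 : ℝ) ≤ T := by exact_mod_cast (hσ i).2.2.le
      have hSs : ((σ i).2.1 : ℝ) ≤ S := by exact_mod_cast (hσ i).2.1.le
      have e1 : ((σ i).2.1 : ℝ) * Real.log g ≤ S * Real.log g :=
        mul_le_mul_of_nonneg_right hSs hγ0
      have e2 : ((σ i).2.2 : ℝ) * (3 * Real.log u + 3 * Real.log (D0 * w' : ℕ) + Real.log 31) ≤
          T * (6 * H + 3.5) :=
        mul_le_mul hTt (by linarith) (by linarith) hT0
      have e3 : 0 ≤ ((σ i).2.1 : ℝ) * Real.log g := by positivity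
      have e4 : 0 ≤ ((σ i).2.2 : ℝ) * (3 * Real.log u + 3 * Real.log (D0 * w' : ℕ) + Real.log 31) := by
        have : 0 ≤ 3 * Real.log u + 3 * Real.log (D0 * w' : ℕ) + Real.log 31 := by linarith
        positivity
      calc _ = ((L : ℝ) - 1) / 2 * (3 * (((σ i).2.1 : ℝ) * Real.log g) +
            ((σ i).2.2 : ℝ) * (3 * Real.log u + 3 * Real.log (D0 * w' : ℕ) + Real.log 31)) := by ring
        _ ≤ _ := by
          apply mul_le_mul _ _ (by linarith) (by linarith)
          · linarith
          · linarith
    · simp only [Finset.card_univ, Fintype.card_prod, Fintype.card_fin, nsmul_eq_mul]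
      push_cast
      apply le_of_eq; ring
  have t4 : (∑ j : Fin L × Fin K1 × Fin K2, |lamc j|) *
          (4 * (K1 * Real.log α / 2 + S * Real.log g + T * (H + 1) + 1) + 1) +
      2 * ((∑ j : Fin L × Fin K1 × Fin K2, |lamc j|) *
          (K1 * Real.log α / 4 + S * Real.log g + T * (H + 2))) ≤
      (K1 * K2 * L : ℝ) * ((L / 4) * (4 * (K1 * 0.4 / 2 + S * Real.log g + T * (H + 1) + 1) + 1 +
        2 * (K1 * 0.4 / 4 + S * Real.log g + T * (H + 2)))) := by
    have h1 := sum_abs_lamc L K1 K2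
    have h0 : 0 ≤ ∑ j : Fin L × Fin K1 × Fin K2, |lamc j| := Finset.sum_nonneg fun _ _ => abs_nonneg _
    have e0 : (K1 : ℝ) * Real.log α ≤ K1 * 0.4 := by gcongr
    have e5 : 0 ≤ (K1 : ℝ) * Real.log α := by positivity
    have e6 : 0 ≤ S * Real.log g := by positivity
    have e7 : 0 ≤ T * (H + 1) := by positivity
    have e8 : 0 ≤ T * (H + 2) := by positivity
    calc _ = (∑ j : Fin L × Fin K1 × Fin K2, |lamc j|) *
          (4 * (K1 * Real.log α / 2 + S * Real.log g + T * (H + 1) + 1) + 1 +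
          2 * (K1 * Real.log α / 4 + S * Real.log g + T * (H + 2))) := by ring
      _ ≤ ((K1 * K2 * L : ℝ) * (L / 4)) * (4 * (K1 * 0.4 / 2 + S * Real.log g + T * (H + 1) + 1) + 1 +
        2 * (K1 * 0.4 / 4 + S * Real.log g + T * (H + 2))) := by
          apply mul_le_mul h1 _ _ (by positivity)
          · linarith
          · linarith
      _ = _ := by ring
  calc _ ≤ 3 * ((K1 * K2 * L : ℝ) * Real.log (L * (K1 * K2))) +
        3 * ((K1 * K2 * L : ℝ) * (B * (K1 + K2) / 2)) + _ + _ := by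
        refine add_le_add (add_le_add (add_le_add ?_ ?_) t3) t4
        · linarith
        · linarith
    _ = _ := by ring


theorem sum_kappa (κ D : ℕ) : 2 * ∑ d ∈ Finset.range D, κ * (d + κ) ≤ κ * (D ^ 2 + 2 * κ * D) := by
  induction D with
  | zero => simp
  | succ n ih =>
    rw [Finset.sum_range_succ]
    nlinarith

theorem numA (B G H e T κ K S m γ lN l4 : ℝ) (rB : 20 ≤ B) (rG : 1 ≤ G) (rH : 0 ≤ H) (re : 0 ≤ e)
    (rT : T = 32000 * B * G) (rκ : κ = 10720 * B * G * (e + 1) + 50 * (H + 1))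
    (rK : K = T * κ) (rS : S = 160 * B * (3 * κ + T * e + 1)) (rm : m = 30 * B - 4)
    (hγG : γ ≤ G) (hlN : lN ≤ 3 * B) (hl4 : 1.386 ≤ l4)
    (hI : m * K * l4 ≤ 3 * lN + 3 * B * (K + 3 * K) / 2 +
      (80 * B / 4) * (4 * (K * 0.4 / 2 + S * γ + T * (H + 1) + 1) + 1 +
        2 * (K * 0.4 / 4 + S * γ + T * (H + 2))) +
      (80 * B / 2) * (3 * (S * γ) + T * (6 * H + 3.5))) : False := by
  have rT0 : 0 < T := by rw [rT]; positivity
  have rκ0 : 50 ≤ κ := by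
    rw [rκ]
    have : 0 ≤ 10720 * B * G * (e + 1) := by positivity
    linarith
  have rS0 : 0 ≤ S := by rw [rS]; positivity
  have rT1 : 32000 * 20 ≤ T := by rw [rT]; nlinarith
  have rK1 : 32000 * 20 * 50 ≤ K := by
    rw [rK]; exact mul_le_mul rT1 rκ0 (by norm_num) rT0.le
  have hmK : 0 ≤ m * K := by
    have : 0 ≤ m := by linarith
    positivity
  have h6 : m * K * 1.386 ≤ m * K * l4 := by gcongr
  have hSG : S * γ ≤ S * G := by gcongr
  have h7 : 240 * (S * G) + T * (360 * H + 300) ≤ 10.8 * K := by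
    have e1 : 240 * (S * G) = 1.2 * T * (3 * κ + T * e + 1) := by
      rw [rS, rT]; ring
    have e2 : κ = 0.335 * T * (e + 1) + 50 * (H + 1) := by
      rw [rκ, rT]; ring
    rw [e1, rK]
    have e3 : 1.2 * T * (3 * κ + T * e + 1) + T * (360 * H + 300) =
        T * (3.6 * κ + 1.2 * (T * e + 1) + (360 * H + 300)) := by ring
    have e4 : 10.8 * (T * κ) = T * (10.8 * κ) := by ring
    rw [e3, e4]
    have e5 : 0 ≤ T * e := by positivity
    refine mul_le_mul_of_nonneg_left ?_ rT0.le
    linarith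
  have h8 : m * K * 1.386 = B * (41.58 * K) - 5.544 * K := by rw [rm]; ring
  have e1 : B * (S * γ) ≤ B * (S * G) := by gcongr
  have h9 : m * K * 1.386 ≤ B * (26 * K + 109 + (240 * (S * G) + T * (360 * H + 300))) := by
    refine h6.trans (hI.trans ?_)
    ring_nf at e1 ⊢
    linarith
  have h10 : B * (26 * K + 109 + (240 * (S * G) + T * (360 * H + 300))) ≤
      B * (26 * K + 109 + 10.8 * K) := by gcongr
  have h11 : B * (41.58 * K) - 5.544 * K ≤ B * (26 * K + 109 + 10.8 * K) := by linarith
  have h12 : 0 ≤ (B - 20) * (4.78 * K - 109) := mul_nonneg (by linarith) (by linarith)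
  nlinarith

theorem thmA (p : ℕ) [Fact p.Prime] (g u w' D0 b1 b2 B G H e T κ K S : ℕ)
    (hB : 20 ≤ B) (hG : 1 ≤ G)
    (hTd : T = 32000 * B * G) (hκ : κ = 10720 * B * G * (e + 1) + 50 * (H + 1))
    (hK : K = T * κ) (hSd : S = 160 * B * (3 * κ + T * e + 1))
    (hpg : p ∣ g) (hg2 : 2 ≤ g)
    (hu : Nat.Coprime p u) (hw' : Nat.Coprime p w') (hu0 : 0 < u) (hw0 : 0 < w') (hD0 : 1 ≤ D0)
    (hb2 : 3 * κ ≤ b2)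
    (he : 31 * D0 * (b2 * T + 3 * κ) ≤ 2 ^ e)
    (α : ℝ) (hα : 1.46 < α) (hα2 : α < 1.4656) (h3 : α ^ 3 = α ^ 2 + 1) (β : ℂ)
    (hβ : β ^ 3 = β ^ 2 + 1)
    (hs : β + (starRingEnd ℂ) β = 1 - (α : ℂ))
    (hp : β * (starRingEnd ℂ) β = (α : ℂ) ^ 2 - α)
    (hgG : Real.log g ≤ G)
    (hX : (K : ℝ) + T * b1 ≤ Real.exp B)
    (hY : (S : ℝ) + T * b2 ≤ Real.exp B)
    (hHu : Real.log u ≤ H) (hHw : Real.log (D0 * w' : ℕ) ≤ H) :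
    1 < T * |b1 * Real.log α - b2 * Real.log g +
      (Real.log u - Real.log (D0 * w' : ℕ) - Real.log (3 * α - 2))| * 4 ^ (60 * B * K) := by
  by_contra hcon
  push Not at hcon
  have hB0 : 0 < B := by omega
  have hT0 : 0 < T := by rw [hTd]; positivity
  have hκ0 : 0 < κ := by rw [hκ]; positivity
  have hK0 : 0 < K := by rw [hK]; positivity
  obtain ⟨m, hm⟩ : ∃ m, 30 * B = m + 4 := ⟨30 * B - 4, by omega⟩
  have hI := ineqI p g u w' D0 b1 b2 (80 * B) K (3 * K) S (3 * κ) T (b2 * T + 3 * κ) e (60 * B * K)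
    (240 * B * K ^ 2 * (m * K)) (by omega) hK0 (by omega) hpg hg2 hu hw' hu0 hw0 hD0 (by omega) hT0
    hb2 le_rfl (by rw [hK]; apply le_of_eq; ring) he
    (by
      rw [hSd]
      obtain ⟨q, hq⟩ : ∃ q, 80 * B = q + 1 := ⟨80 * B - 1, by omega⟩
      have : 160 * B = 2 * (q + 1) := by omega
      rw [this, hq]
      simp only [Nat.add_sub_cancel]
      nlinarith [Nat.zero_le (T * e)])
    (by positivity) α hα hα2 h3 β hβ hs hp hcon
    (by
      have h1 := sum_kappa (K + 3 * K) (60 * B * K)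
      have h2 : (K + 3 * K) * ((60 * B * K) ^ 2 + 2 * (K + 3 * K) * (60 * B * K)) +
          2 * (240 * B * K ^ 2 * (m * K)) = 2 * (60 * B * K * (80 * B * (K * (3 * K)))) := by
        have e1 : 2 * (240 * B * K ^ 2 * (m * K)) + 1920 * B * K ^ 3 =
            480 * B * K ^ 3 * (m + 4) := by ring
        have e2 : (K + 3 * K) * ((60 * B * K) ^ 2 + 2 * (K + 3 * K) * (60 * B * K)) =
            14400 * B ^ 2 * K ^ 3 + 1920 * B * K ^ 3 := by ring
        have e3 : 480 * B * K ^ 3 * (30 * B) = 14400 * B ^ 2 * K ^ 3 := by ring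
        have e4 : 2 * (60 * B * K * (80 * B * (K * (3 * K)))) = 2 * (14400 * B ^ 2 * K ^ 3) := by ring
        rw [← hm, e3] at e1
        omega
      omega)
    (B : ℝ) (H : ℝ) (by positivity) hX hY hHu hHw
  have rB : (20 : ℝ) ≤ B := by exact_mod_cast hB
  have rG : (1 : ℝ) ≤ G := by exact_mod_cast hG
  have rT : (T : ℝ) = 32000 * B * G := by rw [hTd]; push_cast; ring
  have rκ : (κ : ℝ) = 10720 * B * G * (e + 1) + 50 * (H + 1) := by rw [hκ]; push_cast; ring
  have rK : (K : ℝ) = T * κ := by rw [hK]; push_cast; ring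
  have rS : (S : ℝ) = 160 * B * (3 * κ + T * e + 1) := by rw [hSd]; push_cast; ring
  have rm : (m : ℝ) = 30 * B - 4 := by
    have : ((30 * B : ℕ) : ℝ) = ((m + 4 : ℕ) : ℝ) := by rw [hm]
    push_cast at this; linarith
  have rK0 : (0 : ℝ) < K := by exact_mod_cast hK0
  have rK1 : 80 * B * 3 ≤ K := by
    rw [hK, hTd]
    calc 80 * B * 3 ≤ 32000 * B * 1 * 1 := by omega
      _ ≤ 32000 * B * G * κ := by gcongr; exact hκ0
  -- log of the size
  have hlogN : Real.log ((80 * B : ℕ) * (K * ((3 * K : ℕ) : ℝ))) ≤ 3 * B := by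
    have h1' : (80 * B) * (K * (3 * K)) ≤ K ^ 3 := by
      calc (80 * B) * (K * (3 * K)) = (80 * B * 3) * (K * K) := by ring
        _ ≤ K * (K * K) := by gcongr
        _ = K ^ 3 := by ring
    have h1 : (((80 * B : ℕ) : ℝ) * (K * ((3 * K : ℕ) : ℝ))) ≤ (K : ℝ) ^ 3 := by
      exact_mod_cast h1'
    have h2 := Real.log_le_log (by positivity) h1
    rw [Real.log_pow] at h2
    have h4 : (K : ℝ) ≤ Real.exp B := by
      have : (0 : ℝ) ≤ T * b1 := by positivity
      linarith
    have h5 := (Real.log_le_iff_le_exp rK0).2 h4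
    push_cast at h2 ⊢
    linarith
  have hN0 : (0 : ℝ) < K * (3 * K : ℕ) * (80 * B : ℕ) := by positivity
  have hl4 : (1.386 : ℝ) ≤ Real.log 4 := by
    have : Real.log 4 = 2 * Real.log 2 := by
      rw [show (4 : ℝ) = 2 ^ 2 by norm_num, Real.log_pow]; norm_num
    rw [this]; have := Real.log_two_gt_d9; norm_num at this ⊢; linarith
  have hI2 : (m : ℝ) * K * Real.log 4 ≤ (3 * Real.log ((80 * B : ℕ) * (K * ((3 * K : ℕ) : ℝ))) +
      3 * B * (K + (3 * K : ℕ)) / 2 +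
      ((80 * B : ℕ) / 4) * (4 * (K * 0.4 / 2 + S * Real.log g + T * (H + 1) + 1) + 1 +
        2 * (K * 0.4 / 4 + S * Real.log g + T * (H + 2))) +
      ((80 * B : ℕ) / 2) * (3 * (S * Real.log g) + T * (6 * H + 3.5))) := by
    refine le_of_mul_le_mul_left ?_ hN0
    refine le_trans (le_of_eq ?_) hI
    push_cast; ring
  push_cast at hI2 hlogN
  exact numA B G H e T κ K S m (Real.log g) _ _ rB rG (Nat.cast_nonneg _) (Nat.cast_nonneg _)
    rT rκ rK rS rm hgG hlogN hl4 hI2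


theorem nar_rec (α : ℝ) (h3 : α ^ 3 = α ^ 2 + 1) (k : ℕ) :
    (narayana (k + 2) : ℝ) + (α - 1) * narayana (k + 1) + (α ^ 2 - α) * narayana k = α ^ (k + 1) := by
  induction k with
  | zero => simp [narayana]
  | succ n ih =>
    have h : narayana (n + 1 + 2) = narayana (n + 2) + narayana n := by
      show narayana (n + 3) = _
      rw [narayana]
    rw [h, pow_succ α (n + 1), ← ih]
    push_cast
    rw [show n + 1 + 1 = n + 2 by ring]
    linear_combination (-(narayana n : ℝ)) * h3

theorem nar_err (α : ℝ) (hα : 1.46 < α) (hα2 : α < 1.4656) (h3 : α ^ 3 = α ^ 2 + 1) (k : ℕ) :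
    |(narayana k : ℝ) - α ^ k / (3 * α - 2)| ≤ 1 := by
  obtain ⟨a, ha⟩ : ∃ a, a = 1 / (3 * α - 2) := ⟨_, rfl⟩
  have ha1 : a * (3 * α - 2) = 1 := by
    rw [ha]; field_simp
    exact div_self (by nlinarith)
  have ha2 : 0.41 < a := by nlinarith
  have ha3 : a < 0.42 := by nlinarith
  have hQ : ∀ k : ℕ, ((narayana (k + 1) : ℝ) - a * α ^ (k + 1)) ^ 2 +
      (α - 1) * (narayana (k + 1) - a * α ^ (k + 1)) * (narayana k - a * α ^ k) +
      (α ^ 2 - α) * (narayana k - a * α ^ k) ^ 2 ≤ 0.4 := by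
    intro k
    induction k with
    | zero =>
      simp only [narayana]
      push_cast
      have h1 : (1 - a * α) < 0.41 := by nlinarith
      have h2 : 0.38 < (1 - a * α) := by nlinarith
      have h4 : 0 < (α - 1) * (1 - a * α) * a := by
        have : 0 < 1 - a * α := by linarith
        have : 0 < α - 1 := by linarith
        positivity
      have h5 : α ^ 2 - α < 0.69 := by nlinarith
      have h6 : a ^ 2 < 0.18 := by nlinarith
      have h7 : (1 - a * α) ^ 2 < 0.17 := by nlinarith
      have h8 : 0 < α ^ 2 - α := by nlinarith
      nlinarith
    | succ n ih =>
      have hr := nar_rec α h3 n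
      have he : (narayana (n + 2) : ℝ) - a * α ^ (n + 2) =
          -(α - 1) * (narayana (n + 1) - a * α ^ (n + 1)) - (α ^ 2 - α) * (narayana n - a * α ^ n) := by
        have : α ^ (n + 1) = a * (3 * α - 2) * α ^ (n + 1) := by rw [ha1, one_mul]
        rw [this] at hr
        linear_combination hr
      rw [show n + 1 + 1 = n + 2 by ring, he]
      generalize (narayana (n + 1) : ℝ) - a * α ^ (n + 1) = x at *
      generalize (narayana n : ℝ) - a * α ^ n = w at *
      have h5 : α ^ 2 - α < 1 := by nlinarith
      have h8 : 0 < α ^ 2 - α := by nlinarith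
      have : (-(α - 1) * x - (α ^ 2 - α) * w) ^ 2 + (α - 1) * (-(α - 1) * x - (α ^ 2 - α) * w) * x +
        (α ^ 2 - α) * x ^ 2 = (α ^ 2 - α) * (x ^ 2 + (α - 1) * x * w + (α ^ 2 - α) * w ^ 2) := by ring
      rw [this]
      nlinarith
  have h := hQ k
  have hw : (narayana k : ℝ) - α ^ k / (3 * α - 2) = narayana k - a * α ^ k := by
    rw [ha]; ring
  rw [hw]
  generalize (narayana (k + 1) : ℝ) - a * α ^ (k + 1) = x at *
  generalize (narayana k : ℝ) - a * α ^ k = w at *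
  have h5 : 0.67 < α ^ 2 - α := by nlinarith
  have h6 : (α - 1) ^ 2 < 0.25 := by nlinarith
  have : w ^ 2 ≤ 1 := by
    nlinarith [sq_nonneg (x + (α - 1) / 2 * w), sq_nonneg w]
  exact abs_le_one_iff_mul_self_le_one.mpr (by nlinarith)

theorem abs_log_one_add (δ : ℝ) (h : |δ| ≤ 1 / 2) : |Real.log (1 + δ)| ≤ 2 * |δ| := by
  obtain ⟨h1, h2⟩ := abs_le.mp h
  have hp : 0 < 1 + δ := by linarith
  have a1 := Real.log_le_sub_one_of_pos hp
  have a2 := Real.one_sub_inv_le_log_of_pos hp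
  have a3 : 1 - (1 + δ)⁻¹ = δ / (1 + δ) := by field_simp; ring
  rw [a3] at a2
  have a4 : -(2 * |δ|) ≤ δ / (1 + δ) := by
    rw [le_div_iff₀ hp]
    rcases abs_cases δ with ⟨h, _⟩ | ⟨h, _⟩ <;> rw [h] <;> nlinarith
  rw [abs_le]
  constructor
  · linarith
  · linarith [le_abs_self δ, abs_nonneg δ]

/-- the linear form is small -/
theorem lam_bound (α : ℝ) (hα : 1.46 < α) (hα2 : α < 1.4656) (h3 : α ^ 3 = α ^ 2 + 1)
    (g k D0 w V l t b2 : ℕ) (hg : 2 ≤ g) (hD0 : 1 ≤ D0) (hw : 1 ≤ w) (hV0 : 1 ≤ V)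
    (hN : narayana k * (g - 1) ^ 4 = D0 * w * V)
    (hV : |Real.log V - b2 * Real.log g| ≤ 8 / (g : ℝ) ^ l) (hl : l ≤ t) (ht : 2 ≤ t)
    (hNb : g ^ t ≤ narayana k * g) :
    |k * Real.log α - b2 * Real.log g + (Real.log ((g - 1) ^ 4 : ℕ) - Real.log (D0 * w : ℕ)
      - Real.log (3 * α - 2))| ≤ 6 * g / (g : ℝ) ^ l := by
  have hN2 : 2 ≤ narayana k := by
    have h1 : g ^ 2 ≤ g ^ t := Nat.pow_le_pow_right (by omega) ht
    have : g * g ≤ narayana k * g := by rw [← sq]; omega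
    have := Nat.le_of_mul_le_mul_right this (by omega)
    omega
  have err := nar_err α hα hα2 h3 k
  have hg0 : (2 : ℝ) ≤ g := by exact_mod_cast hg
  have hN2' : (2 : ℝ) ≤ narayana k := by exact_mod_cast hN2
  have hNb' : (g : ℝ) ^ t ≤ narayana k * g := by exact_mod_cast hNb
  have hgl : (0 : ℝ) < (g : ℝ) ^ l := by positivity
  have hu0 : (g - 1) ^ 4 ≠ 0 := pow_ne_zero _ (by omega)
  have hlogN : Real.log (narayana k) + Real.log ((g - 1) ^ 4 : ℕ) =
      Real.log (D0 * w : ℕ) + Real.log V := by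
    rw [← Real.log_mul (by positivity) (by exact_mod_cast hu0), ← Real.log_mul
      (by have : D0 * w ≠ 0 := by positivity
          exact_mod_cast this) (by positivity)]
    congr 1
    exact_mod_cast hN
  obtain ⟨N, hNd⟩ : ∃ N : ℝ, N = narayana k := ⟨_, rfl⟩
  rw [← hNd] at err hN2' hNb' hlogN
  have hN0 : 0 < N := by linarith
  have h32 : 0 < 3 * α - 2 := by linarith
  have hα0 : 0 < α := by linarith
  obtain ⟨δ, hδ⟩ : ∃ δ, δ = (α ^ k / (3 * α - 2) - N) / N := ⟨_, rfl⟩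
  have hδ1 : |δ| ≤ 1 / N := by
    rw [hδ, abs_div, abs_of_pos hN0, abs_sub_comm]
    gcongr
  have hδ2 : 1 / N ≤ g / (g : ℝ) ^ l := by
    rw [div_le_div_iff₀ hN0 hgl]
    have : (g : ℝ) ^ l ≤ g ^ t := pow_le_pow_right₀ (by linarith) hl
    linarith
  have hδ3 : |δ| ≤ 1 / 2 := hδ1.trans (by gcongr)
  have hlog := abs_log_one_add δ hδ3
  have h1δ : 1 + δ = α ^ k / (3 * α - 2) / N := by rw [hδ]; field_simp; ring
  have e1 : Real.log (1 + δ) = k * Real.log α - Real.log (3 * α - 2) - Real.log N := by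
    rw [h1δ, Real.log_div (by positivity) (by positivity), Real.log_div (by positivity) (by positivity),
      Real.log_pow]
  have e2 : k * Real.log α - b2 * Real.log g + (Real.log ((g - 1) ^ 4 : ℕ) - Real.log (D0 * w : ℕ)
      - Real.log (3 * α - 2)) = Real.log (1 + δ) + (Real.log V - b2 * Real.log g) := by
    rw [e1]; linear_combination hlogN
  rw [e2]
  refine (abs_add_le _ _).trans ?_
  have : 8 / (g : ℝ) ^ l ≤ 4 * g / (g : ℝ) ^ l := by gcongr; linarith
  have : 6 * g / (g : ℝ) ^ l = 2 * (g / (g : ℝ) ^ l) + 4 * g / (g : ℝ) ^ l := by ring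
  linarith

theorem step_num (γ B G K T κ l g Λ P : ℝ) (hB : 20 ≤ B) (hG : 1 ≤ G) (hγG : γ ≤ G) (hκ : 50 ≤ κ)
    (hT : T = 32000 * B * G) (hK : K = T * κ) (hg : 2 ≤ g) (hγ : γ = Real.log g)
    (hTB : T ≤ Real.exp B) (hP0 : 0 < P) (hP : Real.log P = l * γ)
    (hΛ : Λ ≤ 6 * g / P) (F : ℝ) (hF0 : 0 < F) (hF : Real.log F = 60 * B * K * Real.log 4)
    (h : 1 < T * Λ * F) : l * γ ≤ 2688000 * B ^ 2 * G * κ := by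
  have hT0 : 0 < T := by rw [hT]; positivity
  have h1 : 1 < T * (6 * g / P) * F := h.trans_le (by gcongr)
  have h2 : P < T * 6 * g * F := by
    have : T * (6 * g / P) * F = T * 6 * g * F / P := by ring
    rw [this, one_lt_div hP0] at h1
    exact h1
  have h3 := Real.log_lt_log hP0 h2
  rw [Real.log_mul (by positivity) (by positivity), Real.log_mul (by positivity) (by positivity),
    Real.log_mul (by positivity) (by positivity), hP, hF, ← hγ] at h3
  have h4 : Real.log T ≤ B := (Real.log_le_iff_le_exp hT0).mpr hTB
  have h5 : Real.log 6 ≤ 5 := by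
    have := Real.log_le_sub_one_of_pos (show (0 : ℝ) < 6 by norm_num)
    linarith
  have h6 : Real.log 4 ≤ 1.3864 := by
    rw [show (4 : ℝ) = 2 ^ 2 by norm_num, Real.log_pow]
    have := Real.log_two_lt_d9
    push_cast; linarith
  have hBK : 0 < 60 * B * K := by rw [hK]; positivity
  have h7 : 60 * B * K * Real.log 4 ≤ 60 * B * K * 1.3864 := by gcongr
  have h8 : 2688000 * B ^ 2 * G * κ = 84 * B * K := by rw [hK, hT]; ring
  rw [h8]
  have h9 : 2 * (B + G + 5) ≤ B * K := by
    have : 1 ≤ κ := by linarith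
    have e1 : B * (32000 * 20 * 1 * 1) ≤ B * K := by rw [hK, hT]; gcongr
    have e2 : 20 * (32000 * 20 * G * 1) ≤ B * K := by rw [hK, hT]; gcongr
    nlinarith
  nlinarith

set_option maxHeartbeats 1000000 in
theorem stepJ (α : ℝ) (hα : 1.46 < α) (hα2 : α < 1.4656) (h3 : α ^ 3 = α ^ 2 + 1) (β : ℂ)
    (hβ : β ^ 3 = β ^ 2 + 1)
    (hs : β + (starRingEnd ℂ) β = 1 - (α : ℂ))
    (hp : β * (starRingEnd ℂ) β = (α : ℂ) ^ 2 - α)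
    (g k D0 w V l t b2 B G L e T κ K S : ℕ) (hg : 2 ≤ g) (hD0 : 1 ≤ D0) (hD0' : D0 ≤ (g - 1) ^ 4)
    (hw : 1 ≤ w) (hV0 : 1 ≤ V)
    (hN : narayana k * (g - 1) ^ 4 = D0 * w * V)
    (hV : |Real.log V - b2 * Real.log g| ≤ 8 / (g : ℝ) ^ l) (hl : l ≤ t) (ht : 2 ≤ t)
    (hNb : g ^ t ≤ narayana k * g) (hb : t ≤ b2)
    (hwc : Nat.Coprime g w) (hwL : Real.log w ≤ L * Real.log g)
    (hB : 20 ≤ B) (hG : 1 ≤ G) (he : e = 2 * B + 6 * G + 5)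
    (hTd : T = 32000 * B * G) (hκ : κ = 10720 * B * G * (e + 1) + 50 * (G * (4 + L) + 1))
    (hK : K = T * κ) (hSd : S = 160 * B * (3 * κ + T * e + 1))
    (hgG : Real.log g ≤ G)
    (hX : (K : ℝ) + T * k ≤ Real.exp B)
    (hY : (S : ℝ) + T * b2 ≤ Real.exp B) :
    l * Real.log g ≤ 2688000 * (B : ℝ) ^ 2 * G * κ := by
  have hγ0 : 0 ≤ Real.log g := Real.log_nonneg (by exact_mod_cast (by omega : 1 ≤ g))
  have hκ50 : 50 ≤ κ := by
    rw [hκ, mul_add 50]; exact le_add_left (le_add_left le_rfl)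
  have rB : (20 : ℝ) ≤ B := by exact_mod_cast hB
  have rG : (1 : ℝ) ≤ G := by exact_mod_cast hG
  have rκ : (50 : ℝ) ≤ κ := by exact_mod_cast hκ50
  by_cases hb2 : 3 * κ ≤ b2
  swap
  · push Not at hb2
    have h1 : (l : ℝ) ≤ 3 * κ := by exact_mod_cast (by omega : l ≤ 3 * κ)
    calc (l : ℝ) * Real.log g ≤ 3 * κ * G := by gcongr
      _ ≤ 2688000 * (B : ℝ) ^ 2 * G * κ := by
        have : (1 : ℝ) ≤ (B : ℝ) ^ 2 := by nlinarith
        have : 0 < (κ : ℝ) * G := by positivity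
        nlinarith
  have hpp : (g.minFac).Prime := Nat.minFac_prime (by omega)
  have : Fact (g.minFac).Prime := ⟨hpp⟩
  have hpg : g.minFac ∣ g := Nat.minFac_dvd g
  have hgu : Nat.Coprime g ((g - 1) ^ 4) := by
    apply Nat.Coprime.pow_right
    have := Nat.coprime_self_add_right (m := g - 1) (n := 1)
    rw [show g = g - 1 + 1 by omega]
    simp
  have hu0 : 0 < (g - 1) ^ 4 := pow_pos (by omega) _
  have hlu : Real.log ((g - 1) ^ 4 : ℕ) ≤ 4 * G := by
    rw [Nat.cast_pow, Real.log_pow]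
    have : Real.log (g - 1 : ℕ) ≤ Real.log g := Real.log_le_log (by exact_mod_cast (by omega : 0 < g - 1))
      (by exact_mod_cast Nat.sub_le g 1)
    push_cast at *
    linarith
  have hlD : Real.log D0 ≤ 4 * G := le_trans (Real.log_le_log (by exact_mod_cast hD0)
    (by exact_mod_cast hD0')) hlu
  have hHu : Real.log ((g - 1) ^ 4 : ℕ) ≤ (G * (4 + L) : ℕ) := by
    push_cast at *
    nlinarith [Nat.cast_nonneg (α := ℝ) L]
  have hHw : Real.log (D0 * w : ℕ) ≤ (G * (4 + L) : ℕ) := by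
    rw [Nat.cast_mul, Real.log_mul (by positivity) (by positivity)]
    push_cast
    have : L * Real.log g ≤ L * G := by gcongr
    linarith
  have hT0 : 0 < T := by rw [hTd]; positivity
  have h2e : 31 * D0 * (b2 * T + 3 * κ) ≤ 2 ^ e := by
    have h1 : ((b2 * T + 3 * κ : ℕ) : ℝ) ≤ Real.exp B := by
      refine le_trans ?_ hY
      have : 3 * κ ≤ S := by
        rw [hSd]
        calc 3 * κ ≤ 3 * κ + T * e + 1 := by omega
          _ ≤ 160 * B * (3 * κ + T * e + 1) := Nat.le_mul_of_pos_left _ (by omega)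
      have : ((3 * κ : ℕ) : ℝ) ≤ S := by exact_mod_cast this
      push_cast at *
      linarith
    have h2 : (D0 : ℝ) ≤ Real.exp (4 * G) := by
      rw [← Real.log_le_iff_le_exp (by exact_mod_cast hD0)]; exact hlD
    have h4 : Real.exp B ≤ 2 ^ (2 * B) := by
      rw [pow_mul, ← Real.exp_one_pow]
      gcongr
      linarith [Real.exp_one_lt_d9]
    have h5 : Real.exp (4 * G) ≤ 2 ^ (6 * G) := by
      rw [pow_mul, show (4 : ℝ) * G = G * 4 by ring, Real.exp_nat_mul]
      gcongr
      rw [show (4 : ℝ) = (4 : ℕ) by norm_num, ← Real.exp_one_pow]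
      have := Real.exp_one_lt_d9
      calc Real.exp 1 ^ 4 ≤ 2.75 ^ 4 := by gcongr; linarith
        _ ≤ _ := by norm_num
    have h6 : (31 : ℝ) * D0 * (b2 * T + 3 * κ : ℕ) ≤ 2 ^ 5 * 2 ^ (6 * G) * 2 ^ (2 * B) := by
      have : (31 : ℝ) ≤ 2 ^ 5 := by norm_num
      have h2' := h2.trans h5
      have h1' := h1.trans h4
      gcongr
    rw [← pow_add, ← pow_add, show 5 + 6 * G + 2 * B = e by omega] at h6
    exact_mod_cast h6
  have hA := thmA g.minFac g ((g - 1) ^ 4) w D0 k b2 B G (G * (4 + L)) e T κ K S hB hG hTd hκ hK hSd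
    hpg hg (Nat.Coprime.coprime_dvd_left hpg hgu) (Nat.Coprime.coprime_dvd_left hpg hwc) hu0 hw hD0
    hb2 h2e α hα hα2 h3 β hβ hs hp hgG hX hY hHu hHw
  have hΛ := lam_bound α hα hα2 h3 g k D0 w V l t b2 hg hD0 hw hV0 hN hV hl ht hNb
  have hTB : (T : ℝ) ≤ Real.exp B := by
    have : (1 : ℝ) ≤ b2 := by exact_mod_cast (by omega : 1 ≤ b2)
    have : (T : ℝ) ≤ T * b2 := by nlinarith [Nat.cast_nonneg (α := ℝ) T]
    linarith [Nat.cast_nonneg (α := ℝ) S]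
  have hg2 : (2 : ℝ) ≤ g := by exact_mod_cast hg
  refine step_num (Real.log g) B G K T κ l g _ ((g : ℝ) ^ l) rB rG hgG rκ (by rw [hTd]; push_cast; ring)
    (by rw [hK]; push_cast; ring) hg2 rfl hTB (by positivity) (Real.log_pow _ _) hΛ (4 ^ (60 * B * K))
    (by positivity) (by rw [Real.log_pow]; push_cast; ring) hA


theorem cop_rep (g l : ℕ) (hg : 2 ≤ g) (hl : 1 ≤ l) : Nat.Coprime g (g ^ l - 1) := by
  have h1 : g ∣ g ^ l := dvd_pow_self g (by omega)
  refine Nat.Coprime.coprime_dvd_left h1 ?_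
  have h2 : 1 ≤ g ^ l := Nat.one_le_pow _ _ (by omega)
  obtain ⟨q, hq⟩ : ∃ q, g ^ l = q + 1 := ⟨g ^ l - 1, by omega⟩
  rw [hq]; simp

theorem log_rep (g l : ℕ) (hg : 2 ≤ g) (hl : 1 ≤ l) :
    |Real.log (g ^ l - 1 : ℕ) - l * Real.log g| ≤ 2 / (g : ℝ) ^ l ∧
    Real.log (g ^ l - 1 : ℕ) ≤ l * Real.log g ∧ g - 1 ≤ g ^ l - 1 := by
  have h2 : g ≤ g ^ l := Nat.le_self_pow (by omega) g
  have h2' : (2 : ℝ) ≤ (g : ℝ) ^ l := by exact_mod_cast (hg.trans h2)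
  have hc : ((g ^ l - 1 : ℕ) : ℝ) = (g : ℝ) ^ l - 1 := by
    rw [Nat.cast_sub (by omega)]; push_cast; ring
  obtain ⟨P, hP⟩ : ∃ P : ℝ, P = (g : ℝ) ^ l := ⟨_, rfl⟩
  have hlP : Real.log P = l * Real.log g := by rw [hP, Real.log_pow]
  rw [hc, ← hlP, ← hP]
  rw [← hP] at h2'
  refine ⟨?_, Real.log_le_log (by linarith) (by linarith), by omega⟩
  have hP0 : 0 < P := by linarith
  rw [← Real.log_div (by linarith) (by linarith)]
  have h1 : |(-(1 / P))| = 1 / P := by rw [abs_neg, abs_of_pos (by positivity)]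
  have := abs_log_one_add (-(1 / P)) (by rw [h1]; gcongr)
  rw [h1] at this
  have e : (P - 1) / P = 1 + -(1 / P) := by field_simp; ring
  rw [e]
  calc _ ≤ _ := this
    _ = _ := by ring

theorem log_rep' (g l l0 : ℕ) (hg : 2 ≤ g) (hl : 1 ≤ l0) (h : l0 ≤ l) :
    |Real.log (g ^ l - 1 : ℕ) - l * Real.log g| ≤ 2 / (g : ℝ) ^ l0 := by
  refine (log_rep g l hg (by omega)).1.trans ?_
  have : (1 : ℝ) ≤ g := by exact_mod_cast (by omega : 1 ≤ g)
  gcongr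

theorem exp_ge_lin (x : ℝ) (hx : 0 ≤ x) : 2.7 * x ≤ Real.exp x := by
  have h1 := Real.add_one_le_exp (x - 1)
  have h2 : Real.exp x = Real.exp 1 * Real.exp (x - 1) := by rw [← Real.exp_add]; congr 1; ring
  have h3 := Real.exp_one_gt_d9
  rw [h2]
  nlinarith [Real.exp_pos (x - 1)]

theorem final_contra (y γ : ℝ) (hy : 100 ≤ y) (hγ : 0.69 ≤ γ)
    (h1 : 1.1e57 * y ^ 4 * γ ^ 8 ≤ Real.exp y) (h2 : Real.exp y ≤ 5e39 * y ^ 10 * γ ^ 5) : False := by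
  have hy0 : 0 < y := by linarith
  have hγ0 : 0 < γ := by linarith
  have h3 : 1.1e57 * γ ^ 3 ≤ 5e39 * y ^ 6 := by
    have h := h1.trans h2
    have hc : 0 < y ^ 4 * γ ^ 5 := by positivity
    refine le_of_mul_le_mul_right ?_ hc
    calc 1.1e57 * γ ^ 3 * (y ^ 4 * γ ^ 5) = 1.1e57 * y ^ 4 * γ ^ 8 := by ring
      _ ≤ _ := h
      _ = _ := by ring
  have h4 : 5.8e5 * γ ≤ y ^ 2 := by
    refine le_of_pow_le_pow_left₀ (n := 3) (by norm_num) (by positivity) ?_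
    have : (y ^ 2) ^ 3 = y ^ 6 := by ring
    rw [this, mul_pow]
    have : 0 < γ ^ 3 := by positivity
    norm_num at h3 ⊢
    linarith
  have h5 : 630 ≤ y := by nlinarith
  have h6 : γ ^ 5 ≤ (y ^ 2 / 5.8e5) ^ 5 := by
    gcongr
    rw [le_div_iff₀ (by norm_num)]; linarith
  have h7 : Real.exp y ≤ 8e10 * y ^ 20 := by
    calc Real.exp y ≤ 5e39 * y ^ 10 * (y ^ 2 / 5.8e5) ^ 5 := h2.trans (by gcongr)
      _ = (5e39 / 5.8e5 ^ 5) * y ^ 20 := by ring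
      _ ≤ _ := by gcongr; norm_num
  have h8 : (0.045 * y) ^ 60 ≤ Real.exp y := by
    have h := exp_ge_lin (y / 60) (by positivity)
    have e : Real.exp y = Real.exp (y / 60) ^ 60 := by
      rw [← Real.exp_nat_mul]; congr 1; push_cast; ring
    rw [e]
    gcongr
    linarith
  have h9 : (28 : ℝ) ^ 40 * (0.045 ^ 20 * y ^ 20) ≤ (0.045 * y) ^ 60 := by
    have : (0.045 * y) ^ 60 = (0.045 * y) ^ 40 * (0.045 ^ 20 * y ^ 20) := by
      rw [← mul_pow, ← pow_add]
    rw [this]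
    gcongr
    linarith
  have h10 : (28 : ℝ) ^ 40 * (0.045 ^ 20 * y ^ 20) ≤ 8e10 * y ^ 20 := h9.trans (h8.trans h7)
  rw [← mul_assoc] at h10
  have := le_of_mul_le_mul_right h10 (by positivity)
  norm_num at this

theorem y_big (t y γ : ℝ) (ht : 2 ≤ t) (hy : y = Real.log t) (hγ : 0.69 ≤ γ)
    (h1 : 1.1e57 * y ^ 4 * γ ^ 8 ≤ t) : 100 ≤ y := by
  have hy0 : 0.69 ≤ y := by
    rw [hy]
    have := Real.log_le_log (by norm_num) ht
    linarith [Real.log_two_gt_d9]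
  have h2 : (1.1e57 : ℝ) * 0.69 ^ 4 * 0.69 ^ 8 ≤ t := le_trans (by gcongr) h1
  rw [hy, Real.le_log_iff_exp_le (by linarith)]
  refine le_trans ?_ h2
  rw [show (100 : ℝ) = (100 : ℕ) by norm_num, ← Real.exp_one_pow]
  calc Real.exp 1 ^ 100 ≤ 2.72 ^ 100 := by gcongr; linarith [Real.exp_one_lt_d9]
    _ ≤ _ := by norm_num

theorem z_facts (t y γ z : ℝ) (ht : 2 ≤ t) (hy : y = Real.log t) (hγ : 0.69 ≤ γ) (hy100 : 100 ≤ y)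
    (hz : z = Real.exp (y / 8)) (h1 : 1.1e57 * y ^ 4 * γ ^ 8 ≤ t) :
    z ^ 8 = t ∧ 14 * y ≤ z ∧ 1.3e8 * γ ≤ z := by
  have hz8 : z ^ 8 = t := by
    rw [hz, ← Real.exp_nat_mul, hy]
    have : ((8 : ℕ) : ℝ) * (Real.log t / 8) = Real.log t := by push_cast; ring
    rw [this, Real.exp_log (by linarith)]
  have hz0 : 0 < z := by rw [hz]; positivity
  refine ⟨hz8, ?_, ?_⟩
  · have h := exp_ge_lin (y / 24) (by positivity)
    have e : z = Real.exp (y / 24) ^ 3 := by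
      rw [hz, ← Real.exp_nat_mul]; congr 1; push_cast; ring
    rw [e]
    calc 14 * y ≤ (2.7 * (y / 24)) ^ 3 := by
          have : (2.7 * (y / 24)) ^ 3 = (2.7 / 24) ^ 3 * y * (y * y) := by ring
          rw [this]
          have : 10000 ≤ y * y := by nlinarith
          calc 14 * y ≤ (2.7 / 24) ^ 3 * y * 10000 := by norm_num; linarith
            _ ≤ _ := by gcongr
      _ ≤ _ := by gcongr
  · refine le_of_pow_le_pow_left₀ (n := 8) (by norm_num) hz0.le ?_
    rw [hz8]
    refine le_trans ?_ h1
    have : (100 : ℝ) ^ 4 ≤ y ^ 4 := by gcongr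
    rw [mul_pow]
    gcongr
    calc (1.3e8 : ℝ) ^ 8 ≤ 1.1e57 * 100 ^ 4 := by norm_num
      _ ≤ _ := by gcongr

theorem numX (y z B G L e κ T K S k b2 E : ℝ) (hy : 100 ≤ y) (hzy : 14 * y ≤ z) (hB0 : 0 ≤ B)
    (hB : B ≤ 1.31 * y) (hG : 1 ≤ G) (hGz : G ≤ 2e-8 * z) (hL : L ≤ 3 * z ^ 8)
    (he : e = 2 * B + 6 * G + 5) (hT : T = 32000 * B * G)
    (hκ : κ = 10720 * B * G * (e + 1) + 50 * (G * (4 + L) + 1)) (hL0 : 0 ≤ L)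
    (hK : K = T * κ) (hS : S = 160 * B * (3 * κ + T * e + 1))
    (hk : k ≤ 2e-7 * z ^ 9) (hk0 : 0 ≤ k) (hb : b2 ≤ 4 * z ^ 8) (hb0 : 0 ≤ b2)
    (hE : 0.05 * y * z ^ 10 ≤ E) : K + T * k ≤ E ∧ S + T * b2 ≤ E := by
  have hz : 1400 ≤ z := by linarith
  have hz0 : 0 < z := by linarith
  have hy0 : 0 < y := by linarith
  have hBz : B ≤ 0.1 * z := by linarith
  have he0 : 0 ≤ e := by rw [he]; positivity
  have hez : e + 1 ≤ z := by rw [he]; linarith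
  have hz6 : (1400 : ℝ) ^ 6 ≤ z ^ 6 := by gcongr
  have h1 : 10720 * B * (e + 1) + 250 ≤ z ^ 8 := by
    have a : 10720 * B * (e + 1) ≤ 10720 * (0.1 * z) * z := by gcongr
    have b : 1400 ^ 6 * z ^ 2 ≤ z ^ 8 := by
      calc 1400 ^ 6 * z ^ 2 ≤ z ^ 6 * z ^ 2 := by gcongr
        _ = z ^ 8 := by ring
    have c : 1400 ^ 2 ≤ z ^ 2 := by gcongr
    nlinarith
  have h2 : κ ≤ 151 * G * z ^ 8 := by
    rw [hκ]
    have a : G * (10720 * B * (e + 1) + 250) ≤ G * z ^ 8 := by gcongr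
    have b : G * L ≤ G * (3 * z ^ 8) := by gcongr
    nlinarith
  have hκ0 : 0 ≤ κ := by rw [hκ]; positivity
  have hT0 : 0 ≤ T := by rw [hT]; positivity
  have hTz : T ≤ 32000 * (1.31 * y) * (2e-8 * z) := by rw [hT]; gcongr
  have hκz : κ ≤ 151 * (2e-8 * z) * z ^ 8 := h2.trans (by gcongr)
  have hp : 0 < y * z ^ 10 := by positivity
  have z9 : y * z ^ 9 * 1400 ≤ y * z ^ 10 := by
    calc y * z ^ 9 * 1400 ≤ y * z ^ 9 * z := by gcongr
      _ = _ := by ring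
  constructor
  · have a : K ≤ 32000 * (1.31 * y) * (2e-8 * z) * (151 * (2e-8 * z) * z ^ 8) := by rw [hK]; gcongr
    have b : T * k ≤ 32000 * (1.31 * y) * (2e-8 * z) * (2e-7 * z ^ 9) := by gcongr
    have a' : 32000 * (1.31 * y) * (2e-8 * z) * (151 * (2e-8 * z) * z ^ 8) =
      32000 * 1.31 * 2e-8 * 151 * 2e-8 * (y * z ^ 10) := by ring
    have b' : 32000 * (1.31 * y) * (2e-8 * z) * (2e-7 * z ^ 9) =
      32000 * 1.31 * 2e-8 * 2e-7 * (y * z ^ 10) := by ring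
    rw [a'] at a
    rw [b'] at b
    norm_num at a b hE
    linarith
  · have c : T * e ≤ 32000 * (0.1 * z) * (2e-8 * z) * z := by
      rw [hT]; gcongr; linarith
    have d : z ^ 3 * 1400 ^ 6 ≤ z ^ 9 := by
      calc z ^ 3 * 1400 ^ 6 ≤ z ^ 3 * z ^ 6 := by gcongr
        _ = _ := by ring
    have d1 : (1400 : ℝ) ^ 3 ≤ z ^ 3 := by gcongr
    have f : 3 * κ + T * e + 1 ≤ 1e-5 * z ^ 9 := by
      norm_num at hκz c d d1 ⊢
      have : 151 * (1 / 50000000 * z) * z ^ 8 = 151 * (1 / 50000000) * z ^ 9 := by ring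
      nlinarith
    have a : S ≤ 160 * (1.31 * y) * (1e-5 * z ^ 9) := by rw [hS]; gcongr
    have b : T * b2 ≤ 32000 * (1.31 * y) * (2e-8 * z) * (4 * z ^ 8) := by gcongr
    have a' : 160 * (1.31 * y) * (1e-5 * z ^ 9) = 160 * 1.31 * 1e-5 * (y * z ^ 9) := by ring
    have b' : 32000 * (1.31 * y) * (2e-8 * z) * (4 * z ^ 8) =
      32000 * 1.31 * 2e-8 * 4 * (y * z ^ 9) := by ring
    rw [a'] at a
    rw [b'] at b
    norm_num at a b hE
    linarith

theorem expB_ge (y z B : ℝ) (hy : 100 ≤ y) (hz : z = Real.exp (y / 8)) (hB : 1.3 * y ≤ B) :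
    0.05 * y * z ^ 10 ≤ Real.exp B := by
  have h1 : Real.exp (1.3 * y) = Real.exp (0.05 * y) * z ^ 10 := by
    rw [hz, ← Real.exp_nat_mul, ← Real.exp_add]; congr 1; push_cast; ring
  have h2 := Real.add_one_le_exp (0.05 * y)
  calc 0.05 * y * z ^ 10 ≤ Real.exp (0.05 * y) * z ^ 10 := by
        have : 0 < z := by rw [hz]; positivity
        gcongr; linarith
    _ = _ := h1.symm
    _ ≤ _ := Real.exp_le_exp.mpr hB

/-- one step of the chain in simplified form -/
theorem step_simp (γ B G L e κ l : ℝ) (hγ : 0.69 ≤ γ) (hB : 20 ≤ B) (hG : 1 ≤ G) (hGγ : G ≤ 2.45 * γ)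
    (hL : 0 ≤ L) (he : e = 2 * B + 6 * G + 5)
    (hκ : κ = 10720 * B * G * (e + 1) + 50 * (G * (4 + L) + 1))
    (h : l * γ ≤ 2688000 * B ^ 2 * G * κ) :
    l ≤ 1.6135e7 * γ * B ^ 2 * (10720 * B * (2 * B + 6 * G + 7) + 50 * L) := by
  have hγ0 : 0 < γ := by linarith
  have h1 : κ ≤ G * (10720 * B * (2 * B + 6 * G + 7) + 50 * L) := by
    rw [hκ, he]
    have : 20 * G ≤ B * G := by gcongr
    nlinarith
  have h2 : G ^ 2 ≤ 2.45 ^ 2 * γ ^ 2 := by rw [← mul_pow]; gcongr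
  have hM : 0 ≤ 10720 * B * (2 * B + 6 * G + 7) + 50 * L := by positivity
  refine le_of_mul_le_mul_right ?_ hγ0
  calc l * γ ≤ 2688000 * B ^ 2 * G * κ := h
    _ ≤ 2688000 * B ^ 2 * G * (G * (10720 * B * (2 * B + 6 * G + 7) + 50 * L)) := by gcongr
    _ = 2688000 * B ^ 2 * G ^ 2 * (10720 * B * (2 * B + 6 * G + 7) + 50 * L) := by ring
    _ ≤ 2688000 * B ^ 2 * (2.45 ^ 2 * γ ^ 2) * (10720 * B * (2 * B + 6 * G + 7) + 50 * L) := by gcongr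
    _ = (2688000 * 2.45 ^ 2) * γ * B ^ 2 * (10720 * B * (2 * B + 6 * G + 7) + 50 * L) * γ := by ring
    _ ≤ _ := by gcongr; norm_num

theorem chain4 (x M l1 l2 l3 l4 : ℝ) (hx : 1e7 ≤ x) (hM : 0 ≤ M) (h1 : l1 ≤ x * (M + 50 * 0))
    (h2 : l2 ≤ x * (M + 50 * l1)) (h3 : l3 ≤ x * (M + 50 * (l1 + l2)))
    (h4 : l4 ≤ x * (M + 50 * (l1 + l2 + l3))) : l4 ≤ 125100 * x ^ 4 * M := by
  have hx0 : 0 ≤ x := by linarith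
  have s1 : M + 50 * l1 ≤ M * (1 + 50 * x) := by linarith
  have s2 : M + 50 * (l1 + l2) ≤ M * (1 + 50 * x) ^ 2 := by
    have : x * (M + 50 * l1) ≤ x * (M * (1 + 50 * x)) := by gcongr
    linarith
  have s3 : M + 50 * (l1 + l2 + l3) ≤ M * (1 + 50 * x) ^ 3 := by
    have : x * (M + 50 * (l1 + l2)) ≤ x * (M * (1 + 50 * x) ^ 2) := by gcongr
    linarith
  calc l4 ≤ x * (M + 50 * (l1 + l2 + l3)) := h4
    _ ≤ x * (M * (1 + 50 * x) ^ 3) := by gcongr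
    _ ≤ x * (M * (50.001 * x) ^ 3) := by gcongr; linarith
    _ = 50.001 ^ 3 * x ^ 4 * M := by ring
    _ ≤ _ := by gcongr; norm_num

theorem chain_final (t y γ B G : ℝ) (hy : 100 ≤ y) (hγ : 0.69 ≤ γ) (hB0 : 0 ≤ B) (hB : B ≤ 1.31 * y)
    (hG0 : 1 ≤ G) (hG : G ≤ 2.45 * γ)
    (h : t ≤ 125100 * (1.6135e7 * γ * B ^ 2) ^ 4 * (10720 * B * (2 * B + 6 * G + 7))) :
    t ≤ 5e39 * y ^ 10 * γ ^ 5 := by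
  have hγ0 : 0 < γ := by linarith
  have h1 : 2 * B + 6 * G + 7 ≤ 4.1 * y * γ := by
    have : 0.69 * y ≤ y * γ := by nlinarith
    have : 100 * γ ≤ y * γ := by gcongr
    nlinarith
  calc t ≤ _ := h
    _ ≤ 125100 * (1.6135e7 * γ * (1.31 * y) ^ 2) ^ 4 * (10720 * (1.31 * y) * (4.1 * y * γ)) := by
        gcongr
    _ = 125100 * 1.6135e7 ^ 4 * 1.31 ^ 9 * 10720 * 4.1 * (y ^ 10 * γ ^ 5) := by ring
    _ ≤ 5e39 * (y ^ 10 * γ ^ 5) := by gcongr; norm_num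
    _ = _ := by ring

theorem k_bound (α : ℝ) (hα : 1.46 < α) (hα2 : α < 1.4656) (h3 : α ^ 3 = α ^ 2 + 1) (g k t : ℕ)
    (hg : 2 ≤ g) (ht : 2 ≤ t) (hN1 : 1 ≤ narayana k) (hN : narayana k ≤ g ^ (4 * t)) :
    (k : ℝ) ≤ 20 * t * Real.log g := by
  have err := (abs_le.mp (nar_err α hα hα2 h3 k)).1
  have hN1' : (1 : ℝ) ≤ narayana k := by exact_mod_cast hN1
  have hN' : (narayana k : ℝ) ≤ (g : ℝ) ^ (4 * t) := by exact_mod_cast hN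
  have h32 : 0 < 3 * α - 2 := by linarith
  have hg2 : (2 : ℝ) ≤ g := by exact_mod_cast hg
  have ht2 : (2 : ℝ) ≤ t := by exact_mod_cast ht
  have hγ : 0.69 ≤ Real.log g := by
    have := Real.log_le_log (by norm_num) hg2
    linarith [Real.log_two_gt_d9]
  have h1 : α ^ k ≤ 5 * (g : ℝ) ^ (4 * t) := by
    have : α ^ k / (3 * α - 2) ≤ 2 * (g : ℝ) ^ (4 * t) := by linarith
    rw [div_le_iff₀ h32] at this
    have : 2 * (g : ℝ) ^ (4 * t) * (3 * α - 2) ≤ 2 * (g : ℝ) ^ (4 * t) * 2.5 := by gcongr; linarith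
    linarith
  have h2 := Real.log_le_log (by positivity) h1
  rw [Real.log_mul (by norm_num) (by positivity), Real.log_pow, Real.log_pow] at h2
  have h5 : Real.log 5 ≤ 2.1 := by
    have h : Real.log 5 ≤ Real.log (2 ^ 3) := Real.log_le_log (by norm_num) (by norm_num)
    rw [Real.log_pow] at h
    have := Real.log_two_lt_d9
    push_cast at h
    linarith
  have hA : 0.3 ≤ Real.log α := by
    have h := Real.one_sub_inv_le_log_of_pos (show 0 < α by linarith)
    have : α⁻¹ ≤ 1.46⁻¹ := by gcongr
    norm_num at this ⊢
    linarith
  push_cast at h2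
  have h6 : (k : ℝ) * 0.3 ≤ k * Real.log α := by gcongr
  have h7 : 2 * 0.69 ≤ t * Real.log g := by gcongr
  nlinarith


theorem nar_sizes (N u D d₁ d₂ d₃ d₄ A1 A2 A3 A4 g P : ℕ) (hu : 1 ≤ u) (hgu : g = u + 1)
    (h1 : 1 ≤ d₁) (h1' : d₁ ≤ u) (h2 : 1 ≤ d₂) (h2' : d₂ ≤ u) (h3 : 1 ≤ d₃) (h3' : d₃ ≤ u)
    (h4 : 1 ≤ d₄) (h4' : d₄ ≤ u) (a1 : u ≤ A1) (a2 : u ≤ A2) (a3 : u ≤ A3) (a4 : u ≤ A4)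
    (b1 : A1 ≤ P) (b2 : A2 ≤ P) (b3 : A3 ≤ P) (hP : P = A4 + 1) (hD : D = d₁ * d₂ * d₃ * d₄)
    (h : N * u ^ 4 = d₁ * d₂ * d₃ * d₄ * A1 * A2 * A3 * A4) :
    1 ≤ D ∧ D ≤ u ^ 4 ∧ 1 ≤ N ∧ P ≤ N * g ∧ N ≤ P ^ 4 := by
  have hD1 : 1 ≤ D := by
    rw [hD]
    exact Nat.one_le_iff_ne_zero.mpr (by positivity)
  have hD2 : D ≤ u ^ 4 := by
    rw [hD]
    calc d₁ * d₂ * d₃ * d₄ ≤ u * u * u * u := by gcongr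
      _ = u ^ 4 := by ring
  have hN1 : 1 ≤ N := by
    rcases Nat.eq_zero_or_pos N with h0 | h0
    · exfalso
      rw [h0, zero_mul] at h
      have : 0 < A1 := by omega
      have : 0 < A2 := by omega
      have : 0 < A3 := by omega
      have : 0 < A4 := by omega
      have : 0 < d₁ * d₂ * d₃ * d₄ * A1 * A2 * A3 * A4 := by positivity
      omega
    · exact h0
  refine ⟨hD1, hD2, hN1, ?_, ?_⟩
  · have e : u ^ 3 * A4 ≤ u ^ 3 * (N * u) := by
      calc u ^ 3 * A4 = 1 * 1 * 1 * 1 * u * u * u * A4 := by ring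
        _ ≤ d₁ * d₂ * d₃ * d₄ * A1 * A2 * A3 * A4 := by gcongr
        _ = N * u ^ 4 := h.symm
        _ = _ := by ring
    have := Nat.le_of_mul_le_mul_left e (by positivity)
    rw [hP, hgu, mul_add]
    omega
  · refine Nat.le_of_mul_le_mul_right (c := u ^ 4) ?_ (by positivity)
    rw [h]
    calc d₁ * d₂ * d₃ * d₄ * A1 * A2 * A3 * A4 ≤ u * u * u * u * P * P * P * P := by
          gcongr; omega
      _ = _ := by ring

set_option maxHeartbeats 2000000 in
theorem t_bound (g k d₁ d₂ d₃ d₄ ℓ m n t : ℕ) (hg : 2 ≤ g) (hk : 1 ≤ k)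
    (hd₁ : 1 ≤ d₁) (hd₁g : d₁ ≤ g - 1) (hd₂ : 1 ≤ d₂) (hd₂g : d₂ ≤ g - 1)
    (hd₃ : 1 ≤ d₃) (hd₃g : d₃ ≤ g - 1) (hd₄ : 1 ≤ d₄) (hd₄g : d₄ ≤ g - 1)
    (hℓ : 1 ≤ ℓ) (hℓm : ℓ ≤ m) (hmn : m ≤ n) (hnt : n ≤ t) (ht : 2 ≤ t)
    (heq : narayana k * (g - 1) ^ 4 =
      d₁ * d₂ * d₃ * d₄ * (g ^ ℓ - 1) * (g ^ m - 1) * (g ^ n - 1) * (g ^ t - 1)) :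
    (t : ℝ) < 1.1e57 * Real.log t ^ 4 * Real.log g ^ 8 := by
  by_contra hcon
  push Not at hcon
  obtain ⟨α, β, hα, hα2, h3, hβ, hs, hp⟩ := exists_roots
  have hg2 : (2 : ℝ) ≤ g := by exact_mod_cast hg
  have ht2 : (2 : ℝ) ≤ t := by exact_mod_cast ht
  have hγ' : 0.693 ≤ Real.log g := by
    have := Real.log_le_log (by norm_num) hg2
    linarith [Real.log_two_gt_d9]
  have hγ : 0.69 ≤ Real.log g := by linarith
  obtain ⟨y, hy⟩ : ∃ y, y = Real.log t := ⟨_, rfl⟩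
  rw [← hy] at hcon
  have hy100 := y_big t y (Real.log g) ht2 hy hγ hcon
  obtain ⟨z, hz⟩ : ∃ z, z = Real.exp (y / 8) := ⟨_, rfl⟩
  obtain ⟨hz8, hzy, hzγ⟩ := z_facts t y (Real.log g) z ht2 hy hγ hy100 hz hcon
  obtain ⟨G, hGd⟩ : ∃ G, G = ⌈Real.log g⌉₊ := ⟨_, rfl⟩
  have hgG : Real.log g ≤ G := by rw [hGd]; exact Nat.le_ceil _
  have hG2 : (G : ℝ) ≤ 2.45 * Real.log g := by
    have := Nat.ceil_lt_add_one (show 0 ≤ Real.log g by linarith)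
    rw [← hGd] at this
    linarith
  have hG1 : 1 ≤ G := by
    rw [hGd]; exact Nat.one_le_ceil_iff.mpr (by linarith)
  obtain ⟨B, hBd⟩ : ∃ B, B = ⌈1.3 * y⌉₊ := ⟨_, rfl⟩
  have hB1 : 1.3 * y ≤ B := by rw [hBd]; exact Nat.le_ceil _
  have hB2 : (B : ℝ) ≤ 1.31 * y := by
    have := Nat.ceil_lt_add_one (show 0 ≤ 1.3 * y by linarith)
    rw [← hBd] at this
    linarith
  have rB : (20 : ℝ) ≤ B := by linarith
  have hB20 : 20 ≤ B := by exact_mod_cast rB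
  have rG : (1 : ℝ) ≤ G := by exact_mod_cast hG1
  have hGz : (G : ℝ) ≤ 2e-8 * z := by norm_num at hG2 hzγ ⊢; linarith
  have hm : 1 ≤ m := by omega
  have hn : 1 ≤ n := by omega
  have ht1 : 1 ≤ t := by omega
  have pw : ∀ l, l ≤ t → g ^ l - 1 ≤ g ^ t := fun l hl =>
    (Nat.sub_le _ _).trans (Nat.pow_le_pow_right (by omega) hl)
  have pt : 1 ≤ g ^ t := Nat.one_le_pow _ _ (by omega)
  obtain ⟨hD1, hD2, hN1, hNb, hN4⟩ := nar_sizes (narayana k) (g - 1) (d₁ * d₂ * d₃ * d₄) d₁ d₂ d₃ d₄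
    (g ^ ℓ - 1) (g ^ m - 1) (g ^ n - 1) (g ^ t - 1) g (g ^ t) (by omega) (by omega) hd₁ hd₁g hd₂ hd₂g
    hd₃ hd₃g hd₄ hd₄g (log_rep g ℓ hg hℓ).2.2 (log_rep g m hg hm).2.2 (log_rep g n hg hn).2.2
    (log_rep g t hg ht1).2.2 (pw ℓ (by omega)) (pw m (by omega)) (pw n (by omega)) (by omega) rfl heq
  have hkb := k_bound α hα hα2 h3 g k t hg ht hN1 (by rw [mul_comm, pow_mul]; exact hN4)
  have hk9 : (k : ℝ) ≤ 2e-7 * z ^ 9 := by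
    rw [← hz8] at hkb
    have hz0 : 0 < z := by rw [hz]; positivity
    have : 20 * z ^ 8 * Real.log g ≤ 20 * z ^ 8 * (z / 1.3e8) := by
      gcongr
      rw [le_div_iff₀ (by norm_num)]; linarith
    have e : 20 * z ^ 8 * (z / 1.3e8) = 20 / 1.3e8 * z ^ 9 := by ring
    rw [e] at this
    have : 0 < z ^ 9 := by positivity
    norm_num at *
    linarith
  have hexp := expB_ge y z B hy100 hz hB1
  obtain ⟨D0, hD0⟩ : ∃ D0, D0 = d₁ * d₂ * d₃ * d₄ := ⟨_, rfl⟩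
  rw [← hD0] at hD1 hD2 heq
  -- one step
  have step : ∀ (w V l b2 L : ℕ), 1 ≤ w → 1 ≤ V → narayana k * (g - 1) ^ 4 = D0 * w * V →
      |Real.log V - b2 * Real.log g| ≤ 8 / (g : ℝ) ^ l → l ≤ t → t ≤ b2 → b2 ≤ 4 * t → L ≤ 3 * t →
      Nat.Coprime g w → Real.log w ≤ L * Real.log g →
      (l : ℝ) ≤ 1.6135e7 * Real.log g * (B : ℝ) ^ 2 *
        (10720 * B * (2 * B + 6 * G + 7) + 50 * (L : ℝ)) := by
    intro w V l b2 L hw hV0 hN hV hl hb hb4 hL hwc hwL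
    obtain ⟨e, he⟩ : ∃ e, e = 2 * B + 6 * G + 5 := ⟨_, rfl⟩
    obtain ⟨T, hT⟩ : ∃ T, T = 32000 * B * G := ⟨_, rfl⟩
    obtain ⟨κ, hκ⟩ : ∃ κ, κ = 10720 * B * G * (e + 1) + 50 * (G * (4 + L) + 1) := ⟨_, rfl⟩
    obtain ⟨K, hK⟩ : ∃ K, K = T * κ := ⟨_, rfl⟩
    obtain ⟨S, hS⟩ : ∃ S, S = 160 * B * (3 * κ + T * e + 1) := ⟨_, rfl⟩
    have he' : (e : ℝ) = 2 * B + 6 * G + 5 := by rw [he]; push_cast; ring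
    have hκ' : (κ : ℝ) = 10720 * B * G * (e + 1) + 50 * (G * (4 + L) + 1) := by rw [hκ]; push_cast; ring
    have hb' : (b2 : ℝ) ≤ 4 * z ^ 8 := by rw [hz8]; exact_mod_cast hb4
    have hL' : (L : ℝ) ≤ 3 * z ^ 8 := by rw [hz8]; exact_mod_cast hL
    obtain ⟨hX, hY⟩ := numX y z B G L e κ T K S k b2 (Real.exp B) hy100 hzy (by linarith) hB2 rG hGz hL'
      he' (by rw [hT]; push_cast; ring) hκ' (Nat.cast_nonneg _) (by rw [hK]; push_cast; ring)
      (by rw [hS]; push_cast; ring) hk9 (Nat.cast_nonneg _) hb' (Nat.cast_nonneg _) hexp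
    have := stepJ α hα hα2 h3 β hβ hs hp g k D0 w V l t b2 B G L e T κ K S hg hD1 hD2 hw hV0 hN hV hl ht
      hNb hb hwc hwL hB20 hG1 he hT hκ hK hS hgG hX hY
    exact step_simp (Real.log g) B G L e κ l hγ rB rG hG2 (Nat.cast_nonneg _) he' hκ' this
  have pos : ∀ l, 1 ≤ l → 0 < g ^ l - 1 := fun l hl => by
    have := (log_rep g l hg hl).2.2
    omega
  have p1 := pos ℓ hℓ
  have p2 := pos m hm
  have p3 := pos n hn
  have p4 := pos t ht1
  have c1 := cop_rep g ℓ hg hℓ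
  have c2 := cop_rep g m hg hm
  have c3 := cop_rep g n hg hn
  have u1 := (log_rep g ℓ hg hℓ).2.1
  have u2 := (log_rep g m hg hm).2.1
  have u3 := (log_rep g n hg hn).2.1
  have v1 : ∀ l0, 1 ≤ l0 → l0 ≤ ℓ → _ := fun l0 h1 h2 => log_rep' g ℓ l0 hg h1 h2
  have v2 : ∀ l0, 1 ≤ l0 → l0 ≤ m → _ := fun l0 h1 h2 => log_rep' g m l0 hg h1 h2
  have v3 : ∀ l0, 1 ≤ l0 → l0 ≤ n → _ := fun l0 h1 h2 => log_rep' g n l0 hg h1 h2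
  have v4 : ∀ l0, 1 ≤ l0 → l0 ≤ t → _ := fun l0 h1 h2 => log_rep' g t l0 hg h1 h2
  obtain ⟨A1, hA1⟩ : ∃ A, A = g ^ ℓ - 1 := ⟨_, rfl⟩
  obtain ⟨A2, hA2⟩ : ∃ A, A = g ^ m - 1 := ⟨_, rfl⟩
  obtain ⟨A3, hA3⟩ : ∃ A, A = g ^ n - 1 := ⟨_, rfl⟩
  obtain ⟨A4, hA4⟩ : ∃ A, A = g ^ t - 1 := ⟨_, rfl⟩
  rw [← hA1] at heq p1 c1 u1 v1
  rw [← hA2] at heq p2 c2 u2 v2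
  rw [← hA3] at heq p3 c3 u3 v3
  rw [← hA4] at heq p4 v4
  have q1 : (A1 : ℝ) ≠ 0 := by positivity
  have q2 : (A2 : ℝ) ≠ 0 := by positivity
  have q3 : (A3 : ℝ) ≠ 0 := by positivity
  have q4 : (A4 : ℝ) ≠ 0 := by positivity
  have ab : ∀ a b c d r : ℝ, |a| ≤ 2 / r → |b| ≤ 2 / r → |c| ≤ 2 / r → |d| ≤ 2 / r →
      |a + b + c + d| ≤ 8 / r := by
    intro a b c d r ha hb hc hd
    have e : 8 / r = 4 * (2 / r) := by ring
    rw [e, abs_le]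
    rw [abs_le] at ha hb hc hd
    constructor <;> linarith [ha.1, ha.2]
  have z0 : ∀ l : ℕ, |(0 : ℝ)| ≤ 2 / (g : ℝ) ^ l := fun l => by rw [abs_zero]; positivity
  have s1 := step 1 (A1 * A2 * A3 * A4) ℓ (ℓ + m + n + t) 0 le_rfl (Nat.succ_le_of_lt (by positivity))
    (by rw [heq]; ring)
    (by
      have := ab _ _ _ _ _ (v1 ℓ hℓ le_rfl) (v2 ℓ hℓ hℓm) (v3 ℓ hℓ (by omega)) (v4 ℓ hℓ (by omega))
      push_cast
      rw [Real.log_mul (by positivity) q4, Real.log_mul (by positivity) q3, Real.log_mul q1 q2]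
      convert this using 2; ring)
    (by omega) (by omega) (by omega) (by omega) (Nat.coprime_one_right g) (by simp)
  have s2 := step A1 (A2 * A3 * A4) m (m + n + t) ℓ p1 (Nat.succ_le_of_lt (by positivity))
    (by rw [heq]; ring)
    (by
      have := ab _ _ _ _ _ (v2 m hm le_rfl) (v3 m hm hmn) (v4 m hm (by omega)) (z0 m)
      push_cast
      rw [Real.log_mul (by positivity) q4, Real.log_mul q2 q3]
      convert this using 2; ring)
    (by omega) (by omega) (by omega) (by omega) c1 u1
  have s3 := step (A1 * A2) (A3 * A4) n (n + t) (ℓ + m) (Nat.succ_le_of_lt (by positivity)) (Nat.succ_le_of_lt (by positivity))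
    (by rw [heq]; ring)
    (by
      have := ab _ _ _ _ _ (v3 n hn le_rfl) (v4 n hn hnt) (z0 n) (z0 n)
      push_cast
      rw [Real.log_mul q3 q4]
      convert this using 2; ring)
    (by omega) (by omega) (by omega) (by omega) (Nat.Coprime.mul_right c1 c2)
    (by push_cast; rw [Real.log_mul q1 q2]; linarith)
  have s4 := step (A1 * A2 * A3) A4 t t (ℓ + m + n) (Nat.succ_le_of_lt (by positivity)) p4
    (by rw [heq]; ring)
    (by
      have := ab _ _ _ _ _ (v4 t ht1 le_rfl) (z0 t) (z0 t) (z0 t)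
      convert this using 2; ring)
    (by omega) (by omega) (by omega) (by omega) (Nat.Coprime.mul_right (Nat.Coprime.mul_right c1 c2) c3)
    (by push_cast; rw [Real.log_mul (by positivity) q3, Real.log_mul q1 q2]; linarith)
  push_cast at s1 s2 s3 s4
  have hx : 1e7 ≤ 1.6135e7 * Real.log g * (B : ℝ) ^ 2 := by
    calc (1e7 : ℝ) ≤ 1.6135e7 * 0.69 * 20 ^ 2 := by norm_num
      _ ≤ _ := by gcongr
  have hc := chain4 _ (10720 * (B : ℝ) * (2 * B + 6 * G + 7)) ℓ m n t hx (by positivity) s1 s2 s3 s4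
  have hf := chain_final t y (Real.log g) B G hy100 hγ (by linarith) hB2 rG hG2 hc
  have hty : (t : ℝ) = Real.exp y := by rw [hy, Real.exp_log (by linarith)]
  rw [hty] at hf hcon
  exact final_contra y (Real.log g) hy100 hγ hcon hf
end

section
/- Let M be a positive integer, τ an irrational real number, and p/q a convergent of the continued fraction expansion of τ with q > 6M. Let A > 0, B > 1 and μ be real numbers, and set ε := ‖μq‖ − M·‖τq‖, where ‖X‖ denotes the distance from X to the nearest integer. If ε > 0, then there are no positive integers u, v, w with u ≤ M and w ≥ log(Aq/ε)/log B satisfying 0 < |uτ − v + μ| < A·B^{−w}. -/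
/-- `‖X‖`, the distance from the real number `X` to the nearest integer. -/
noncomputable def distNearestInt (x : ℝ) : ℝ := |x - round x|

theorem dujella_petho_reduction (M : ℕ) (hM : 0 < M) (τ : ℝ) (hτ : Irrational τ)
    (p : ℤ) (q : ℕ) (hq : 0 < q)
    (hconv : ∃ i : ℕ, (GenContFract.of τ).convs i = (p : ℝ) / (q : ℝ))
    (hq6M : 6 * M < q) (A B μ : ℝ) (hA : 0 < A) (hB : 1 < B)
    (ε : ℝ) (hε : ε = distNearestInt (μ * q) - M * distNearestInt (τ * q))
    (hεpos : 0 < ε) :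
    ¬ ∃ u v w : ℕ, 0 < u ∧ 0 < v ∧ 0 < w ∧ u ≤ M ∧
      Real.log (A * q / ε) / Real.log B ≤ (w : ℝ) ∧
      0 < |(u : ℝ) * τ - (v : ℝ) + μ| ∧
      |(u : ℝ) * τ - (v : ℝ) + μ| < A * B ^ (-(w : ℤ)) := by
  rintro ⟨u, v, w, hu, hv, hw, huM, hlog, hpos, hlt⟩
  have hq' : (0 : ℝ) < q := by exact_mod_cast hq
  have hlB : 0 < Real.log B := Real.log_pos hB
  have hB0 : 0 < B := by linarith
  -- the key lower bound `ε ≤ q * |u τ - v + μ|`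
  have key : ε ≤ q * |(u : ℝ) * τ - (v : ℝ) + μ| := by
    have h1 := round_le (μ * q) ((v : ℤ) * q - u * round (τ * q))
    have h2 : |μ * q - (((v : ℤ) * q - u * round (τ * q) : ℤ) : ℝ)|
        ≤ |(q : ℝ) * ((u : ℝ) * τ - (v : ℝ) + μ)| + |(u : ℝ) * (τ * q - round (τ * q))| := by
      have e : μ * q - (((v : ℤ) * q - u * round (τ * q) : ℤ) : ℝ)
          = (q : ℝ) * ((u : ℝ) * τ - (v : ℝ) + μ) - (u : ℝ) * (τ * q - round (τ * q)) := by
        push_cast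
        ring
      rw [e]
      exact abs_sub _ _
    rw [abs_mul, abs_mul, Nat.abs_cast, Nat.abs_cast] at h2
    have h3 : (u : ℝ) * |τ * q - round (τ * q)| ≤ M * |τ * q - round (τ * q)| :=
      mul_le_mul_of_nonneg_right (by exact_mod_cast huM) (abs_nonneg _)
    rw [hε]
    unfold distNearestInt
    linarith
  have hBw : 0 < B ^ w := pow_pos hB0 w
  have h4 : A * q / ε ≤ B ^ w := by
    rw [div_le_iff₀ hlB, ← Real.log_pow] at hlog
    exact (Real.log_le_log_iff (by positivity) hBw).1 hlog
  rw [div_le_iff₀ hεpos] at h4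
  rw [zpow_neg, zpow_natCast, ← div_eq_mul_inv, lt_div_iff₀ hBw] at hlt
  have h5 := mul_lt_mul_of_pos_right hlt hq'
  have h6 := mul_le_mul_of_nonneg_left key hBw.le
  nlinarith
end
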